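/- arXiv:1509.08859 — 2 statements merged into one kernel-verified Lean document; each statement's English description precedes it below -/
import Mathlib

section
/- For any eight points p₁,…,p₈ in EuclideanSpace ℝ (Fin 3) each of norm 1 (i.e., lying on the unit sphere), the volume of their convex hull satisfies vol(convexHull ℝ {p₁,…,p₈}) ≤ √((475 + 29·√145)/250). (Berman–Hanes: the maximal volume polyhedron with 8 vertices inscribed in the unit sphere is the medial polyhedron with this volume; in particular it is not the cube.) -/
open MeasureTheory Real

abbrev E3 := EuclideanSpace ℝ (Fin 3)

/-- dot product in coordinates -/
def dt (a b : E3) : ℝ := a 0 * b 0 + a 1 * b 1 + a 2 * b 2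

/-- determinant in coordinates -/
def det3 (a b c : E3) : ℝ :=
  a 0 * (b 1 * c 2 - b 2 * c 1) + a 1 * (b 2 * c 0 - b 0 * c 2) + a 2 * (b 0 * c 1 - b 1 * c 0)

lemma lsq {x y : ℝ} (hy : 0 ≤ y) (h : x ^ 2 ≤ y ^ 2) : x ≤ y :=
  (le_abs_self x).trans (abs_le_of_sq_le_sq h hy)

lemma dt_cs (a b : E3) : (dt a b) ^ 2 ≤ dt a a * dt b b := by
  simp only [dt]
  nlinarith [sq_nonneg (a 0 * b 1 - a 1 * b 0), sq_nonneg (a 1 * b 2 - a 2 * b 1),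
    sq_nonneg (a 0 * b 2 - a 2 * b 0)]

lemma dt_nn (a : E3) : 0 ≤ dt a a := by
  simp only [dt]; nlinarith [sq_nonneg (a 0), sq_nonneg (a 1), sq_nonneg (a 2)]

lemma dt_unit {a b : E3} (ha : dt a a = 1) (hb : dt b b = 1) : -1 ≤ dt a b ∧ dt a b ≤ 1 := by
  have h := dt_cs a b
  rw [ha, hb] at h
  constructor <;> nlinarith

lemma det3_sq (x a b : E3) : (det3 x a b) ^ 2 ≤ dt x x * (dt a a * dt b b - dt a b ^ 2) := by
  have h : dt x x * (dt a a * dt b b - dt a b ^ 2) - (det3 x a b) ^ 2 =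
    (x 1 * (a 0 * b 1 - a 1 * b 0) - x 2 * (a 2 * b 0 - a 0 * b 2)) ^ 2 +
    (x 2 * (a 1 * b 2 - a 2 * b 1) - x 0 * (a 0 * b 1 - a 1 * b 0)) ^ 2 +
    (x 0 * (a 2 * b 0 - a 0 * b 2) - x 1 * (a 1 * b 2 - a 2 * b 1)) ^ 2 := by
    simp only [dt, det3]; ring
  have := add_nonneg (add_nonneg
    (sq_nonneg (x 1 * (a 0 * b 1 - a 1 * b 0) - x 2 * (a 2 * b 0 - a 0 * b 2)))
    (sq_nonneg (x 2 * (a 1 * b 2 - a 2 * b 1) - x 0 * (a 0 * b 1 - a 1 * b 0))))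
    (sq_nonneg (x 0 * (a 2 * b 0 - a 0 * b 2) - x 1 * (a 1 * b 2 - a 2 * b 1)))
  linarith

/-- triangle normal in coordinates, against `p` -/
lemma star_sq (p a b c : E3) (hp : dt p p = 1) :
    (det3 p a b + det3 p b c + det3 p c a) ^ 2 ≤
      dt (b - a) (b - a) * dt (c - a) (c - a) - dt (b - a) (c - a) ^ 2 := by
  have h := det3_sq p (b - a) (c - a)
  rw [hp, one_mul] at h
  have e : det3 p a b + det3 p b c + det3 p c a = det3 p (b - a) (c - a) := by
    simp only [det3, PiLp.sub_apply]; ring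
  rw [e]; exact h

lemma dt_sub (a b c d : E3) : dt (a - b) (c - d) = dt a c - dt a d - dt b c + dt b d := by
  simp only [dt, PiLp.sub_apply]; ring

lemma dt_comm (a b : E3) : dt a b = dt b a := by simp only [dt]; ring

lemma dt_add_left (a b c : E3) : dt (a + b) c = dt a c + dt b c := by
  simp only [dt, PiLp.add_apply]; ring
lemma dt_add_right (a b c : E3) : dt c (a + b) = dt c a + dt c b := by
  simp only [dt, PiLp.add_apply]; ring
lemma dt_smul_left (r : ℝ) (a c : E3) : dt (r • a) c = r * dt a c := by
  simp only [dt, PiLp.smul_apply, smul_eq_mul]; ring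
lemma dt_smul_right (r : ℝ) (a c : E3) : dt c (r • a) = r * dt c a := by
  simp only [dt, PiLp.smul_apply, smul_eq_mul]; ring
lemma dt_sub_left (a b c : E3) : dt (a - b) c = dt a c - dt b c := by
  simp only [dt, PiLp.sub_apply]; ring
lemma dt_sub_right (a b c : E3) : dt c (a - b) = dt c a - dt c b := by
  simp only [dt, PiLp.sub_apply]; ring

lemma face_le {a b c : E3} (ha : dt a a = 1) (hb : dt b b = 1) (hc : dt c c = 1) :
    det3 a b c ≤ 1 := by
  have h := det3_sq a b c
  rw [ha, hb, hc] at h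
  apply lsq (by norm_num); nlinarith [sq_nonneg (dt b c)]

/-- sine bound: `x·(a×b)·√3 ≤ 2 + a·b` -/
lemma sine_le {x a b : E3} (hx : dt x x = 1) (ha : dt a a = 1) (hb : dt b b = 1)
    {s : ℝ} (hs : s ^ 2 = 3) : det3 x a b * s ≤ 2 + dt a b := by
  have h := det3_sq x a b
  rw [hx, ha, hb] at h
  have hu := dt_unit ha hb
  apply lsq (by linarith)
  rw [mul_pow, hs]
  nlinarith [sq_nonneg (2 * dt a b + 1)]

/-- general tangent sine bound -/
lemma sine_tan {x a b : E3} (hx : dt x x = 1) (ha : dt a a = 1) (hb : dt b b = 1)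
    {c d : ℝ} (hd : 0 ≤ c) (h1 : c ^ 2 ≤ 1) (hcd : 1 ≤ d ^ 2 * (1 - c ^ 2)) (hd' : 0 ≤ d) :
    det3 x a b ≤ d * (1 + c * dt a b) := by
  have h := det3_sq x a b
  rw [hx, ha, hb] at h
  have hu := dt_unit ha hb
  have hc1 : c ≤ 1 := by nlinarith
  apply lsq (by apply mul_nonneg hd'; nlinarith)
  refine h.trans ?_
  rw [mul_pow]
  have k1 : 0 ≤ (dt a b + c) ^ 2 := sq_nonneg _
  have k2 : (1 - c ^ 2) * (1 - dt a b ^ 2) ≤ (1 + c * dt a b) ^ 2 := by nlinarith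
  have k3 : 0 ≤ 1 - dt a b ^ 2 := by nlinarith
  nlinarith [mul_le_mul_of_nonneg_left k2 (sq_nonneg d), mul_le_mul_of_nonneg_right hcd k3]

lemma sig_ge {a b c : E3} (ha : dt a a = 1) (hb : dt b b = 1) (hc : dt c c = 1) :
    -(3 / 2) ≤ dt a b + dt b c + dt c a := by
  have h := dt_nn (a + b + c)
  simp only [dt_add_left, dt_add_right, ha, hb, hc] at h
  rw [dt_comm b a, dt_comm c b, dt_comm a c] at h
  linarith

/-- star of a vertex of degree 3 -/
lemma star3_lin {p a b c : E3} (hp : dt p p = 1) (ha : dt a a = 1) (hb : dt b b = 1)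
    (hc : dt c c = 1) {s : ℝ} (hs : s ^ 2 = 3) :
    (det3 p a b + det3 p b c + det3 p c a) * s ≤ 3 - (dt a b + dt b c + dt c a) := by
  have h := star_sq p a b c hp
  simp only [dt_sub, ha, hb, hc] at h
  rw [dt_comm b a, dt_comm a c] at h
  have h1 := dt_unit ha hb
  have h2 := dt_unit hb hc
  have h3 := dt_unit hc ha
  apply lsq (by linarith)
  rw [mul_pow, hs]
  nlinarith [sq_nonneg (dt a b - dt b c), sq_nonneg (dt c a - dt b c), sq_nonneg (dt a b - dt c a)]

lemma star3_le {p a b c : E3} (hp : dt p p = 1) (ha : dt a a = 1) (hb : dt b b = 1)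
    (hc : dt c c = 1) : det3 p a b + det3 p b c + det3 p c a ≤ 2.5981 := by
  have hs : (√3 : ℝ) ^ 2 = 3 := Real.sq_sqrt (by norm_num)
  have h := star3_lin hp ha hb hc hs
  have h2 := sig_ge ha hb hc
  have h3 : (1.73205 : ℝ) ≤ √3 := Real.le_sqrt_of_sq_le (by norm_num)
  nlinarith

lemma block6_le {p a b c x y z : E3} (hp : dt p p = 1) (ha : dt a a = 1) (hb : dt b b = 1)
    (hc : dt c c = 1) (hx : dt x x = 1) (hy : dt y y = 1) (hz : dt z z = 1) :
    det3 p a b + det3 p b c + det3 p c a + det3 x a b + det3 y b c + det3 z c a ≤ 5.1963 := by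
  have hs : (√3 : ℝ) ^ 2 = 3 := Real.sq_sqrt (by norm_num)
  have h := star3_lin hp ha hb hc hs
  have h1 := sine_le hx ha hb hs
  have h2 := sine_le hy hb hc hs
  have h3 := sine_le hz hc ha hs
  have h4 : (1.73205 : ℝ) ≤ √3 := Real.le_sqrt_of_sq_le (by norm_num)
  nlinarith

lemma block5_le {p a b c y z : E3} (hp : dt p p = 1) (ha : dt a a = 1) (hb : dt b b = 1)
    (hc : dt c c = 1) (hy : dt y y = 1) (hz : dt z z = 1) :
    det3 p a b + det3 p b c + det3 p c a + det3 y b c + det3 z c a ≤ 4.44 := by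
  have h := star_sq p a b c hp
  simp only [dt_sub, ha, hb, hc] at h
  rw [dt_comm b a, dt_comm a c] at h
  have h1 := dt_unit ha hb
  have h2 := dt_unit hb hc
  have h3 := dt_unit hc ha
  have k1 : det3 p a b + det3 p b c + det3 p c a ≤
     0.734 * (1 - dt a b) + 0.6812 * (3 / 2 + dt a b / 2 - (dt b c + dt c a)) := by
    have kk := dt_nn (c - (1/2 : ℝ) • (a + b))
    simp only [dt_sub, dt_add_left, dt_add_right, dt_smul_left, dt_smul_right, ha, hb, hc] at kk
    rw [dt_comm b a, dt_comm a c, dt_comm c b] at kk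
    have kk' : 0 ≤ 3 / 2 + dt a b / 2 - (dt b c + dt c a) := by linarith
    apply lsq (by nlinarith)
    refine h.trans ?_
    have e1 : (0:ℝ) ≤ 1 - dt a b := by linarith
    have e2 := mul_nonneg e1 kk'
    nlinarith [sq_nonneg (0.734 * (1 - dt a b) - 0.6812 * (3 / 2 + dt a b / 2 - (dt b c + dt c a))), sq_nonneg (dt b c - dt c a)]
  have k2 := sine_tan hy hb hc (c := 0.366) (d := 1.0747) (by norm_num) (by norm_num) (by norm_num) (by norm_num)
  have k3 := sine_tan hz hc ha (c := 0.366) (d := 1.0747) (by norm_num) (by norm_num) (by norm_num) (by norm_num)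
  have k4 := dt_nn (a + b + (0.732 : ℝ) • c)
  simp only [dt_add_left, dt_add_right, dt_smul_left, dt_smul_right, ha, hb, hc] at k4
  rw [dt_comm b a, dt_comm a c, dt_comm c b] at k4
  linarith

lemma chord_le {x a d : E3} (hx : dt x x = 1) (ha : dt a a = 1) (t : ℝ) (ht : 0 < t) :
    det3 x a d * (2 * t) ≤ dt d d + t ^ 2 := by
  have h := det3_sq x a d
  rw [hx, ha] at h
  have h2 := dt_nn d
  have h3 : (det3 x a d) ^ 2 ≤ dt d d := by nlinarith [sq_nonneg (dt a d)]
  nlinarith [sq_nonneg (det3 x a d - t)]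

lemma det3_sub (x a b c : E3) : det3 x a b + det3 x b c = det3 x b (c - a) := by
  simp only [det3, PiLp.sub_apply]; ring

lemma star6_le {s a1 a2 a3 a4 a5 a6 : E3} (hs : dt s s = 1) (h1 : dt a1 a1 = 1) (h2 : dt a2 a2 = 1)
    (h3 : dt a3 a3 = 1) (h4 : dt a4 a4 = 1) (h5 : dt a5 a5 = 1) (h6 : dt a6 a6 = 1) :
    det3 s a1 a2 + det3 s a2 a3 + det3 s a3 a4 + det3 s a4 a5 + det3 s a5 a6 + det3 s a6 a1
      ≤ 5.1963 := by
  have e1 := det3_sub s a1 a2 a3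
  have e2 := det3_sub s a3 a4 a5
  have e3 := det3_sub s a5 a6 a1
  have k1 := chord_le (d := a3 - a1) hs h2 1.732 (by norm_num)
  have k2 := chord_le (d := a5 - a3) hs h4 1.732 (by norm_num)
  have k3 := chord_le (d := a1 - a5) hs h6 1.732 (by norm_num)
  simp only [dt_sub, h1, h3, h5] at k1 k2 k3
  have k4 := sig_ge h1 h3 h5
  rw [dt_comm a3 a1] at k1
  rw [dt_comm a5 a3] at k2
  rw [dt_comm a1 a5] at k3
  linarith

lemma type11_le {N S q e1 e2 e3 e4 e5 : E3} (hN : dt N N = 1) (hS : dt S S = 1) (hq : dt q q = 1)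
    (h1 : dt e1 e1 = 1) (h2 : dt e2 e2 = 1)
    (h3 : dt e3 e3 = 1) (h4 : dt e4 e4 = 1) (h5 : dt e5 e5 = 1) :
    det3 q N e1 + det3 q e1 e2 + det3 q e2 N + det3 e3 N e2 + det3 e5 e1 N
     + det3 N e3 e4 + det3 N e4 e5
     + det3 S e2 e1 + det3 S e3 e2 + det3 S e4 e3 + det3 S e5 e4 + det3 S e1 e5 ≤ 10.89 := by
  have hs : (√3 : ℝ) ^ 2 = 3 := Real.sq_sqrt (by norm_num)
  have hs1 : (1.73205 : ℝ) ≤ √3 := Real.le_sqrt_of_sq_le (by norm_num)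
  have a1 := star3_lin hq hN h1 h2 hs
  have a2 := sine_le h3 hN h2 hs
  have a3 := sine_le h5 h1 hN hs
  rw [dt_comm e1 N] at a3
  rw [dt_comm e2 N] at a1
  have u1 := dt_unit h1 h2
  have A : det3 q N e1 + det3 q e1 e2 + det3 q e2 N + det3 e3 N e2 + det3 e5 e1 N
      ≤ 0.57736 * (7 - dt e1 e2) := by
    have : (det3 q N e1 + det3 q e1 e2 + det3 q e2 N + det3 e3 N e2 + det3 e5 e1 N) * √3
      ≤ (7 - dt e1 e2) := by linarith
    have hh : (1:ℝ) ≤ 0.57736 * √3 := by linarith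
    have h0 : (0:ℝ) < √3 := by linarith
    rw [← mul_le_mul_iff_left₀ h0]
    nlinarith
  have b1 := face_le hN h3 h4
  have b2 := face_le hN h4 h5
  have d1 := det3_sub S e4 e3 e2
  have d2 := det3_sub S e1 e5 e4
  have c1 := chord_le (d := e2 - e4) hS h3 1.817 (by norm_num)
  have c2 := chord_le (d := e4 - e1) hS h5 1.817 (by norm_num)
  simp only [dt_sub, h1, h2, h4] at c1 c2
  rw [dt_comm e2 e4] at c1
  rw [dt_comm e1 e4] at c2
  have c3 := sine_tan hS h2 h1 (c := 0.1528) (d := 1.0119) (by norm_num) (by norm_num) (by norm_num) (by norm_num)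
  rw [dt_comm e2 e1] at c3
  have k4 := dt_nn (e1 + e2 + (1.3 : ℝ) • e4)
  simp only [dt_add_left, dt_add_right, dt_smul_left, dt_smul_right, h1, h2, h4] at k4
  rw [dt_comm e2 e1, dt_comm e1 e4, dt_comm e2 e4] at k4
  linarith

/-- cross product -/
def cr (a b : E3) : E3 := !₂[a 1 * b 2 - a 2 * b 1, a 2 * b 0 - a 0 * b 2, a 0 * b 1 - a 1 * b 0]

lemma dt_le_mul {a b : E3} {x y : ℝ} (hx : 0 ≤ x) (hy : 0 ≤ y) (ha : dt a a ≤ x ^ 2)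
    (hb : dt b b ≤ y ^ 2) : dt a b ≤ x * y := by
  apply lsq (mul_nonneg hx hy)
  refine (dt_cs a b).trans ?_
  rw [mul_pow]
  exact mul_le_mul ha hb (dt_nn b) (sq_nonneg x)

lemma det3_le_mul {a b c : E3} {x y z : ℝ} (hx : 0 ≤ x) (hy : 0 ≤ y) (hz : 0 ≤ z)
    (ha : dt a a ≤ x ^ 2) (hb : dt b b ≤ y ^ 2) (hc : dt c c ≤ z ^ 2) :
    det3 a b c ≤ x * y * z := by
  apply lsq (by positivity)
  refine (det3_sq a b c).trans ?_
  have h1 : dt b b * dt c c - dt b c ^ 2 ≤ y ^ 2 * z ^ 2 := by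
    have := mul_le_mul hb hc (dt_nn c) (sq_nonneg y)
    nlinarith [sq_nonneg (dt b c)]
  have h2 : 0 ≤ dt b b * dt c c - dt b c ^ 2 := by linarith [dt_cs b c]
  have := mul_le_mul ha h1 h2 (sq_nonneg x)
  linarith [this, (by ring : x ^ 2 * (y ^ 2 * z ^ 2) = (x * y * z) ^ 2)]

lemma type10_le {p q a b c a' b' c' : E3} (hp : dt p p = 1) (hq : dt q q = 1)
    (ha : dt a a = 1) (hb : dt b b = 1) (hc : dt c c = 1)
    (ha' : dt a' a' = 1) (hb' : dt b' b' = 1) (hc' : dt c' c' = 1) :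
    det3 q p a + det3 q a b + det3 q b p + det3 p b c + det3 p c a + det3 c' b a
     + det3 c b a' + det3 c a' b' + det3 c b' a + det3 c' a' b + det3 c' b' a' + det3 c' a b'
      ≤ 10.893 := by
  have r1 : det3 c b a' + det3 c' a' b = det3 (c - c') b a' := by
    simp only [det3, PiLp.sub_apply]; ring
  have r2 : det3 c a' b' + det3 c' b' a' = det3 (c - c') a' b' := by
    simp only [det3, PiLp.sub_apply]; ring
  have r3 : det3 c b' a + det3 c' a b' = det3 (c - c') b' a := by
    simp only [det3, PiLp.sub_apply]; ring
  have hD : dt (c - c') (c - c') + dt (c + c') (c + c') = 4 := by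
    simp only [dt_sub_left, dt_sub_right, dt_add_left, dt_add_right, hc, hc']; ring
  have hsq : ∀ z : ℝ, 0 ≤ z → dt (c - c') (c - c') ≤ z ^ 2 → 
     det3 c b a' + det3 c a' b' + det3 c b' a + det3 c' a' b + det3 c' b' a' + det3 c' a b' ≤ 3 * z := by
    intro z hz h
    have k1 := det3_le_mul (a := c - c') (b := b) (c := a') hz zero_le_one zero_le_one h (by linarith) (by linarith)
    have k2 := det3_le_mul (a := c - c') (b := a') (c := b') hz zero_le_one zero_le_one h (by linarith) (by linarith)
    have k3 := det3_le_mul (a := c - c') (b := b') (c := a) hz zero_le_one zero_le_one h (by linarith) (by linarith)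
    linarith
  rcases le_total (dt (c - c') (c - c')) (1.898 ^ 2) with h | h
  · have := hsq 1.898 (by norm_num) h
    have F := block6_le hq hp ha hb hc hc' hc
    have e1 : det3 p b c = det3 c p b := by simp only [det3]; ring
    have e2 : det3 p c a = det3 c a p := by simp only [det3]; ring
    have e3 := block6_le (p := q) (a := b) (b := p) (c := a) (x := -c) (y := -c) (z := -c') hq hb hp ha
      (by simpa [dt] using hc) (by simpa [dt] using hc) (by simpa [dt] using hc')
    have f1 : det3 (-c) b p = det3 p b c := by simp only [det3, PiLp.neg_apply]; ring
    have f2 : det3 (-c) p a = det3 p c a := by simp only [det3, PiLp.neg_apply]; ring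
    have f3 : det3 (-c') a b = det3 c' b a := by simp only [det3, PiLp.neg_apply]; ring
    linarith
  · have R := hsq 2 (by norm_num) (by linarith [dt_nn (c + c')])
    set X := cr p a + cr b p
    set Y := cr a b
    have F : det3 q p a + det3 q a b + det3 q b p + det3 p b c + det3 p c a + det3 c' b a =
       dt q (X + Y) + (1/2) * dt (-(c + c')) (X + Y) + (1/2) * dt (c - c') (Y - X) := by
      simp [X, Y, det3, dt, cr]; ring
    have hX : dt X X ≤ dt (a - b) (a - b) := by
      have : dt (a - b) (a - b) * dt p p - dt X X = dt p (a - b) ^ 2 := by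
        simp [X, det3, dt, cr]; ring
      rw [hp] at this
      nlinarith [sq_nonneg (dt p (a - b))]
    have hY : dt Y Y = 1 - dt a b ^ 2 := by
      have : dt Y Y = dt a a * dt b b - dt a b ^ 2 := by simp [Y, det3, dt, cr]; ring
      rw [this, ha, hb]; ring
    have hu := dt_unit ha hb
    simp only [dt_sub, ha, hb] at hX
    rw [dt_comm b a] at hX
    have hXY : dt (X + Y) (X + Y) + dt (Y - X) (Y - X) ≤ 8 := by
      simp only [dt_sub_left, dt_sub_right, dt_add_left, dt_add_right]
      rw [dt_comm Y X]
      nlinarith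
    obtain ⟨α, hα, hα2⟩ : ∃ α : ℝ, 0 ≤ α ∧ dt (X + Y) (X + Y) = α ^ 2 :=
      ⟨_, Real.sqrt_nonneg _, (Real.sq_sqrt (dt_nn _)).symm⟩
    obtain ⟨β, hβ, hβ2⟩ : ∃ α : ℝ, 0 ≤ α ∧ dt (Y - X) (Y - X) = α ^ 2 :=
      ⟨_, Real.sqrt_nonneg _, (Real.sq_sqrt (dt_nn _)).symm⟩
    have g1 := dt_le_mul (a := q) zero_le_one hα (by linarith) hα2.le
    have g2 := dt_le_mul (a := -(c + c')) (x := 0.6306) (by norm_num) hα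
      (by have : dt (-(c+c')) (-(c+c')) = dt (c+c') (c+c') := by simp [dt]; ring
          rw [this]; linarith) hα2.le
    have g3 := dt_le_mul (a := c - c') (x := 2) (by norm_num) hβ
      (by linarith [dt_nn (c + c')]) hβ2.le
    rw [hα2, hβ2] at hXY
    have g4 : α + β ≤ 4 := by nlinarith [sq_nonneg (α - β)]
    have g5 : α ≤ 2.8285 := by nlinarith
    linarith

/-- quarter of six times the Berman–Hanes constant -/
noncomputable def gst : ℝ := 6 * √((23 + √145) / 160) * √((35 + √145) / 50)

lemma r145 : (12.0415 : ℝ) ≤ √145 ∧ √145 ≤ 12.0416 ∧ √145 ^ 2 = 145 :=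
  ⟨Real.le_sqrt_of_sq_le (by norm_num), Real.sqrt_le_iff.2 ⟨by norm_num, by norm_num⟩,
    Real.sq_sqrt (by norm_num)⟩

lemma gst_eq : 4 * gst = 6 * √((475 + 29 * √145) / 250) := by
  obtain ⟨h1, h2, h3⟩ := r145
  have : gst = (3 / 2) * √((475 + 29 * √145) / 250) := by
    rw [gst]
    have e0 : (0:ℝ) ≤ 6 * √((23 + √145) / 160) * √((35 + √145) / 50) := by positivity
    have e1 : (0:ℝ) ≤ (3 / 2) * √((475 + 29 * √145) / 250) := by positivity
    rw [← Real.sqrt_sq e0, ← Real.sqrt_sq e1]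
    congr 1
    rw [mul_pow, mul_pow, mul_pow, Real.sq_sqrt (by positivity), Real.sq_sqrt (by positivity),
      Real.sq_sqrt (by positivity)]
    nlinarith
  linarith

lemma gst_ge : (2.72356 : ℝ) ≤ gst := by
  have h := gst_eq
  obtain ⟨h1, h2, h3⟩ := r145
  have : (1.81571 : ℝ) ≤ √((475 + 29 * √145) / 250) := by
    apply Real.le_sqrt_of_sq_le
    linarith
  linarith

lemma G0_le {m n S C : ℝ} (hm : 0 ≤ m) (hmn : m ^ 2 + n ^ 2 = 1) (hSC : S ^ 2 + C ^ 2 = 1) :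
    2 * m * (n * S + m * C + S * C) ≤ gst := by
  obtain ⟨h1, h2, h3⟩ := r145
  rw [gst]
  set r := √145
  set z := √((23 + r) / 160) with hz
  set t := √((35 + r) / 50) with ht
  have hz2 : z ^ 2 = (23 + r) / 160 := Real.sq_sqrt (by positivity)
  have ht2 : t ^ 2 = (35 + r) / 50 := Real.sq_sqrt (by positivity)
  have hz0 : 0 < z := Real.sqrt_pos.2 (by positivity)
  have ht0 : 0 < t := Real.sqrt_pos.2 (by positivity)
  have am : ∀ (α β x y : ℝ), 0 < α → α * β = 1 → 2 * (x * y) ≤ α * x ^ 2 + β * y ^ 2 := by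
    intro α β x y hα hαβ
    have h := sq_nonneg (α * x - y)
    have : α * (2 * (x * y)) ≤ α * (α * x ^ 2 + β * y ^ 2) := by
      have : α * (α * x ^ 2 + β * y ^ 2) = α ^ 2 * x ^ 2 + (α * β) * y ^ 2 := by ring
      rw [this, hαβ]; nlinarith
    exact le_of_mul_le_mul_left this hα
  have k1 := am (5 * z) (z * (23 - r) / 12) n S (by positivity) (by
    have : 5 * z * (z * (23 - r) / 12) = z ^ 2 * (5 * (23 - r) / 12) := by ring
    rw [this, hz2]; nlinarith)
  have k2 := am (5 * z * (r + 1) / 36) (z * (r - 7) / 2) m C (by positivity) (by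
    have : 5 * z * (r + 1) / 36 * (z * (r - 7) / 2) = z ^ 2 * (5 * (r + 1) * (r - 7) / 72) := by ring
    rw [this, hz2]; nlinarith)
  have k3 := am (z * (25 + r) / 12) (z * (15 - r) / 2) S C (by positivity) (by
    have : z * (25 + r) / 12 * (z * (15 - r) / 2) = z ^ 2 * ((25 + r) * (15 - r) / 24) := by ring
    rw [this, hz2]; nlinarith)
  have k4 : 2 * (n * S + m * C + S * C) ≤ z * (9 - 5 * (35 - r) / 36 * m ^ 2) := by
    have en : n ^ 2 = 1 - m ^ 2 := by linarith
    have eS : S ^ 2 = 1 - C ^ 2 := by linarith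
    rw [en, eS] at k1
    rw [eS] at k3
    nlinarith
  have k5 : 9 * m - 5 * (35 - r) / 36 * m ^ 3 ≤ 6 * t := by
    have e : 5 * (35 - r) / 36 * t ^ 2 = 3 := by rw [ht2]; nlinarith
    have h := mul_nonneg (sq_nonneg (m - t)) (by positivity : 0 ≤ m + 2 * t)
    have h' : 3 * t ^ 2 * m ≤ m ^ 3 + 2 * t ^ 3 := by nlinarith
    have q0 : 0 < 5 * (35 - r) / 36 := by linarith
    have h'' := mul_le_mul_of_nonneg_left h' q0.le
    have e1 : 5 * (35 - r) / 36 * (3 * t ^ 2 * m) = 9 * m := by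
      calc _ = (5 * (35 - r) / 36 * t ^ 2) * (3 * m) := by ring
        _ = _ := by rw [e]; ring
    have e2 : 5 * (35 - r) / 36 * (m ^ 3 + 2 * t ^ 3) = 5 * (35 - r) / 36 * m ^ 3 + 6 * t := by
      calc _ = 5 * (35 - r) / 36 * m ^ 3 + (5 * (35 - r) / 36 * t ^ 2) * (2 * t) := by ring
        _ = _ := by rw [e]; ring
    linarith
  have k6 := mul_le_mul_of_nonneg_left k4 hm
  have k7 := mul_le_mul_of_nonneg_left k5 hz0.le
  nlinarith

lemma le_one_of_circ {x y : ℝ} (h : x ^ 2 + y ^ 2 = 1) : x ≤ 1 :=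
  lsq zero_le_one (by nlinarith [sq_nonneg y])

lemma ml {a b : ℝ} (hb : 0 ≤ b) (ha : a ≤ 1) : a * b ≤ b := mul_le_of_le_one_left hb ha

lemma half_sq_le {k l : ℝ} (h : k ^ 2 + l ^ 2 = 1) : l ^ 2 / 2 ≤ 1 - k := by
  nlinarith [sq_nonneg (1 - k)]

lemma two_mul_le_of_circ {x y z w : ℝ} (h : x ^ 2 + y ^ 2 = 1) (h' : z ^ 2 + w ^ 2 = 1) :
    x * z + y * w ≤ 1 := by
  nlinarith [sq_nonneg (x - z), sq_nonneg (y - w)]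

lemma cross_aux {C S k n c : ℝ} (hk : 0 ≤ k) (k1 : k ≤ 1) (hn : 0 ≤ n) (n1 : n ≤ 0.4201)
    (hC : 0.2 ≤ C) (C1 : C ≤ 1) (hc : 0.9075 ≤ c) (c1 : c ≤ 1) (h3 : S ^ 2 + C ^ 2 = 1) :
    c * C + n * (C ^ 2 - S ^ 2) * k ≤ C * (1 + n) ∧
    -(c * C + n * (C ^ 2 - S ^ 2) * k) ≤ C * (1 + n) := by
  have C0 : 0 ≤ C := by linarith
  constructor
  · have e0 : C ^ 2 ≤ C := by nlinarith
    have e1 : (C ^ 2 - S ^ 2) * k ≤ C := by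
      calc (C ^ 2 - S ^ 2) * k ≤ C * k :=
            mul_le_mul_of_nonneg_right (by linarith [sq_nonneg S]) hk
        _ ≤ C * 1 := mul_le_mul_of_nonneg_left k1 C0
        _ = C := mul_one C
    have e2 := mul_le_mul_of_nonneg_left e1 hn
    have e3 := mul_le_mul_of_nonneg_right c1 C0
    linarith
  · have e0 : 0.2 ^ 2 ≤ C ^ 2 := by nlinarith
    have e1 : (S ^ 2 - C ^ 2) * k ≤ 0.92 := by
      calc (S ^ 2 - C ^ 2) * k ≤ 0.92 * k :=
            mul_le_mul_of_nonneg_right (by linarith) hk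
        _ ≤ 0.92 := by linarith
    have e2 : n * ((S ^ 2 - C ^ 2) * k) ≤ n * 0.92 := mul_le_mul_of_nonneg_left e1 hn
    have e3 := mul_le_mul_of_nonneg_left hC (by linarith : 0 ≤ c + 1 + n)
    linarith

lemma disc_aux {m n S k l : ℝ} (hm : 0.9075 ≤ m) (hn : 0 ≤ n) (n1 : n ≤ 0.4201) (hS : 0.15 ≤ S)
    (hk : 0 ≤ k) (h4 : k ^ 2 + l ^ 2 = 1) (l2 : l ^ 2 ≤ 1 / 2) (hlS : l ^ 2 ≤ S ^ 2) :
    (1 + n) ^ 2 ≤ (m ^ 2 + 4 * m * S) * (2 * k) := by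
  have d1 : (1 + n) ^ 2 ≤ 2.0168 := by nlinarith
  have mS : 0.9075 * S ≤ m * S := mul_le_mul_of_nonneg_right hm (by linarith)
  have mm : 0.9075 ^ 2 ≤ m ^ 2 := pow_le_pow_left₀ (by norm_num) hm 2
  rcases le_total (l ^ 2) 0.25 with h | h
  · have hk' : 0.866 ≤ k := lsq hk (by linarith)
    have : 1.367 ≤ m ^ 2 + 4 * m * S := by linarith
    have := mul_le_mul this (by linarith : (2 * 0.866 : ℝ) ≤ 2 * k) (by norm_num) (by linarith)
    linarith
  · have hk' : 0.707 ≤ k := lsq hk (by linarith)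
    have hS' : 0.5 ≤ S := lsq (by linarith) (by linarith)
    have : 2 ≤ m ^ 2 + 4 * m * S := by linarith
    have := mul_le_mul this (by linarith : (2 * 0.707 : ℝ) ≤ 2 * k) (by norm_num) (by linarith)
    linarith

lemma half_pair {x X y Y : ℝ} (hx : 0 ≤ x) (hX : 0 ≤ X) (hy : 0 ≤ y) (hY : 0 ≤ Y)
    (h1 : x ^ 2 + X ^ 2 = 1) (h2 : y ^ 2 + Y ^ 2 = 1) :
    ∃ m n c s : ℝ, m ^ 2 + n ^ 2 = 1 ∧ c ^ 2 + s ^ 2 = 1 ∧ x = m * c + n * s ∧ X = n * c - m * s ∧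
      y = m * c - n * s ∧ Y = n * c + m * s ∧ 0 ≤ m ∧ 0 ≤ n ∧ 0 ≤ c := by
  have r : ∀ z : ℝ, 0 ≤ z → 0 ≤ arccos z ∧ arccos z ≤ π / 2 := fun z hz =>
    ⟨arccos_nonneg z, arccos_le_pi_div_two.2 hz⟩
  have q : ∀ {x X : ℝ} (_ : 0 ≤ x) (_ : 0 ≤ X) (_ : x ^ 2 + X ^ 2 = 1),
    cos (arccos x) = x ∧ sin (arccos x) = X := by
    intro x X hx hX h
    refine ⟨Real.cos_arccos (by linarith) (le_one_of_circ h), ?_⟩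
    rw [Real.sin_arccos, show 1 - x ^ 2 = X ^ 2 by linarith, Real.sqrt_sq hX]
  obtain ⟨a1, a2⟩ := q hx hX h1
  obtain ⟨b1, b2⟩ := q hy hY h2
  obtain ⟨r1, r2⟩ := r x hx
  obtain ⟨r3, r4⟩ := r y hy
  set ξ := arccos x
  set η := arccos y
  have e1 : ξ = (ξ + η) / 2 - (η - ξ) / 2 := by ring
  have e2 : η = (ξ + η) / 2 + (η - ξ) / 2 := by ring
  refine ⟨cos ((ξ + η) / 2), sin ((ξ + η) / 2), cos ((η - ξ) / 2), sin ((η - ξ) / 2),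
    cos_sq_add_sin_sq _, cos_sq_add_sin_sq _, ?_, ?_, ?_, ?_, ?_, ?_, ?_⟩
  · rw [← a1]; nth_rw 1 [e1]; rw [cos_sub]
  · rw [← a2]; nth_rw 1 [e1]; rw [sin_sub]
  · rw [← b1]; nth_rw 1 [e2]; rw [cos_add]
  · rw [← b2]; nth_rw 1 [e2]; rw [sin_add]
  · exact cos_nonneg_of_mem_Icc ⟨by linarith, by linarith⟩
  · exact sin_nonneg_of_nonneg_of_le_pi (by linarith) (by linarith [Real.pi_pos])
  · exact cos_nonneg_of_mem_Icc ⟨by linarith, by linarith⟩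

lemma G_core {m n c s S C k l : ℝ} (h1 : m ^ 2 + n ^ 2 = 1) (h2 : c ^ 2 + s ^ 2 = 1)
    (h3 : S ^ 2 + C ^ 2 = 1) (h4 : k ^ 2 + l ^ 2 = 1)
    (hm : 0.9075 ≤ m) (hc : 0.9075 ≤ c) (hn : 0 ≤ n) (hS : 0.15 ≤ S) (hC : 0.2 ≤ C) (hk : 0 ≤ k)
    (hlS : l ^ 2 ≤ S ^ 2) (hlC : l ^ 2 ≤ C ^ 2) :
    2 * m * n * (S * k) + 2 * s * c * (C * l) + ((m ^ 2 - n ^ 2) + (c ^ 2 - s ^ 2)) * (C * k)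
      + m * c * (2 * S * C) * (k ^ 2 - l ^ 2) + n * s * (C ^ 2 - S ^ 2) * (2 * k * l)
      ≤ 2 * m * (n * S + m * C + S * C) := by
  have k1 : k ≤ 1 := le_one_of_circ h4
  have c1 : c ≤ 1 := le_one_of_circ h2
  have m1 : m ≤ 1 := le_one_of_circ h1
  have C1 : C ≤ 1 := le_one_of_circ (by rw [add_comm]; exact h3)
  have n1 : n ≤ 0.4201 := by
    have mm : 0.9075 ^ 2 ≤ m ^ 2 := pow_le_pow_left₀ (by norm_num) hm 2
    exact lsq (by norm_num) (by linarith)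
  have l2 : l ^ 2 ≤ 1 / 2 := by linarith
  have kk : l ^ 2 / 2 ≤ 1 - k := half_sq_le h4
  -- cross term
  set q := |s * l| with hq
  have q0 : 0 ≤ q := abs_nonneg _
  have qa : s * l ≤ q := le_abs_self _
  have qb : -(s * l) ≤ q := neg_le_abs _
  have cross : 2 * (s * l) * (c * C + n * (C ^ 2 - S ^ 2) * k) ≤ 2 * q * (C * (1 + n)) := by
    obtain ⟨b1, b2⟩ := cross_aux hk k1 hn n1 hC C1 hc c1 h3
    rcases le_total 0 (s * l) with h | h
    · have : q = s * l := abs_of_nonneg h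
      rw [this]; exact mul_le_mul_of_nonneg_left b1 (by linarith)
    · have : q = -(s * l) := abs_of_nonpos h
      rw [this]
      have := mul_le_mul_of_nonneg_left b2 (by linarith : 0 ≤ 2 * -(s * l))
      linarith
  have q2 : q ^ 2 = s ^ 2 * l ^ 2 := by rw [hq, sq_abs]; ring
  have quad : 2 * q * (1 + n) ≤ l ^ 2 * (m ^ 2 + 4 * m * S) + 2 * k * s ^ 2 := by
    have d := disc_aux hm hn n1 hS hk h4 l2 hlS
    set A := m ^ 2 + 4 * m * S
    have A0 : 0 ≤ A := by positivity
    apply lsq (by positivity)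
    calc (2 * q * (1 + n)) ^ 2 = 4 * (s ^ 2 * l ^ 2) * (1 + n) ^ 2 := by rw [mul_pow, mul_pow, q2]; ring
      _ ≤ 4 * (s ^ 2 * l ^ 2) * (A * (2 * k)) := mul_le_mul_of_nonneg_left d (by positivity)
      _ ≤ _ := by nlinarith [sq_nonneg (l ^ 2 * A - 2 * k * s ^ 2)]
  have quadC := mul_le_mul_of_nonneg_left quad (by linarith : 0 ≤ C)
  -- assemble
  have t1 : 0 ≤ 2 * m * n * S * (1 - k) := by
    have : 0 ≤ 1 - k := by linarith
    have : 0 ≤ S := by linarith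
    have : 0 ≤ m := by linarith
    positivity
  have t2 : C * m ^ 2 * (l ^ 2 / 2) ≤ C * m ^ 2 * (1 - k) :=
    mul_le_mul_of_nonneg_left kk (by positivity)
  have t3 : 2 * m * S * C * (2 * l ^ 2) ≤ 2 * m * S * C * (1 - c * (1 - 2 * l ^ 2)) := by
    apply mul_le_mul_of_nonneg_left _ (by positivity)
    have := mul_le_mul_of_nonneg_right c1 (by linarith : 0 ≤ 1 - 2 * l ^ 2)
    linarith
  have e : 2 * m * (n * S + m * C + S * C) - (2 * m * n * (S * k) + 2 * s * c * (C * l) + ((m ^ 2 - n ^ 2) + (c ^ 2 - s ^ 2)) * (C * k)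
      + m * c * (2 * S * C) * (k ^ 2 - l ^ 2) + n * s * (C ^ 2 - S ^ 2) * (2 * k * l)) =
      2 * m * n * S * (1 - k) + 2 * (C * m ^ 2 * (1 - k)) + 2 * k * s ^ 2 * C + 
      2 * m * S * C * (1 - c * (1 - 2 * l ^ 2)) - 2 * (s * l) * (c * C + n * (C ^ 2 - S ^ 2) * k) := by
    have hk2 : k ^ 2 = 1 - l ^ 2 := by linarith
    have hn2 : n ^ 2 = 1 - m ^ 2 := by linarith
    have hc2 : c ^ 2 = 1 - s ^ 2 := by linarith
    rw [hk2, hn2, hc2]; ring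
  linarith

lemma G_le {x X y Y S1 C1 S2 C2 : ℝ} (hx : 0 ≤ x) (hX : 0 ≤ X) (hy : 0 ≤ y) (hY : 0 ≤ Y)
    (hS1 : 0 ≤ S1) (hC1 : 0 ≤ C1) (hS2 : 0 ≤ S2) (hC2 : 0 ≤ C2)
    (h1 : x ^ 2 + X ^ 2 = 1) (h2 : y ^ 2 + Y ^ 2 = 1) (h3 : C1 ^ 2 + S1 ^ 2 = 1)
    (h4 : C2 ^ 2 + S2 ^ 2 = 1) :
    x * Y * S1 + y * X * S2 + x * y * (C1 + C2) + x * S1 * C1 + y * S2 * C2 ≤ gst := by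
  have hg := gst_ge
  have sc1 : S1 * C1 ≤ 1 / 2 := by nlinarith [sq_nonneg (S1 - C1)]
  have sc2 : S2 * C2 ≤ 1 / 2 := by nlinarith [sq_nonneg (S2 - C2)]
  have x1 : x ≤ 1 := le_one_of_circ h1
  have y1 : y ≤ 1 := le_one_of_circ h2
  have S11 : S1 ≤ 1 := le_one_of_circ (by rw [add_comm]; exact h3)
  have S21 : S2 ≤ 1 := le_one_of_circ (by rw [add_comm]; exact h4)
  have C11 : C1 ≤ 1 := le_one_of_circ h3
  have C21 : C2 ≤ 1 := le_one_of_circ h4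
  have xy1 : x * Y + X * y ≤ 1 := two_mul_le_of_circ h1 (by rw [add_comm]; exact h2)
  rcases le_total (x + y) 1.815 with h | h
  · have a1 : y * C1 + Y * S1 ≤ 1 := two_mul_le_of_circ h2 h3
    have a2 : x * C2 + X * S2 ≤ 1 := two_mul_le_of_circ h1 h4
    have b1 := mul_le_mul_of_nonneg_left (add_le_add a1 sc1) hx
    have b2 := mul_le_mul_of_nonneg_left (add_le_add a2 sc2) hy
    linarith
  have xynn := mul_nonneg hx hy
  have xy11 : x * y ≤ 1 := (ml hy x1).trans y1
  have xY := mul_nonneg hx hY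
  have yX := mul_nonneg hy hX
  have b3 : x * (S1 * C1) ≤ S1 * C1 := ml (mul_nonneg hS1 hC1) x1
  have b4 : y * (S2 * C2) ≤ S2 * C2 := ml (mul_nonneg hS2 hC2) y1
  rcases le_total (S1 + S2) 0.3 with h5 | h5
  · have b1 : x * Y * S1 ≤ S1 := ml hS1 (by linarith)
    have b2 : y * X * S2 ≤ S2 := ml hS2 (by linarith)
    have b3' : C1 * S1 ≤ S1 := ml hS1 C11
    have b4' : C2 * S2 ≤ S2 := ml hS2 C21
    have b5 : x * y * (C1 + C2) ≤ C1 + C2 := ml (by linarith) xy11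
    linarith
  rcases le_total (C1 + C2) 0.4 with h6 | h6
  · have b1 : S1 * (x * Y) ≤ x * Y := ml xY S11
    have b2 : S2 * (y * X) ≤ y * X := ml yX S21
    have b3' : S1 * C1 ≤ C1 := ml hC1 S11
    have b4' : S2 * C2 ≤ C2 := ml hC2 S21
    have b5 : x * y * (C1 + C2) ≤ C1 + C2 := ml (by linarith) xy11
    linarith
  clear b3 b4 xY yX xynn xy11 xy1 sc1 sc2
  obtain ⟨m, n, c, s, h1', h2', rfl, rfl, rfl, rfl, hm0, hn0, hc0⟩ :=
    half_pair hx hX hy hY h1 h2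
  obtain ⟨C, S, k, l, h3', h4', rfl, rfl, rfl, rfl, hC0, hS0, hk0⟩ :=
    half_pair hC2 hS2 hC1 hS1 h4 h3
  have hm1 := le_one_of_circ h1'
  have hc1 := le_one_of_circ h2'
  have hk1 := le_one_of_circ h4'
  have m9 : 0.9075 ≤ m := by
    have := mul_le_mul_of_nonneg_left hc1 hm0
    linarith
  have c9 : 0.9075 ≤ c := by
    have := mul_le_mul_of_nonneg_right hm1 hc0
    linarith
  have S9 : 0.15 ≤ S := by
    have := mul_le_mul_of_nonneg_left hk1 hS0
    linarith
  have C9 : 0.2 ≤ C := by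
    have := mul_le_mul_of_nonneg_left hk1 hC0
    linarith
  have hlS : l ^ 2 ≤ S ^ 2 := by
    have := mul_nonneg hS1 hS2
    have e : k ^ 2 = 1 - l ^ 2 := by linarith
    have e' : C ^ 2 = 1 - S ^ 2 := by linarith
    have : 0 ≤ S ^ 2 * k ^ 2 - C ^ 2 * l ^ 2 := by linarith
    rw [e, e'] at this; linarith
  have hlC : l ^ 2 ≤ C ^ 2 := by
    have := mul_nonneg hC1 hC2
    have e : k ^ 2 = 1 - l ^ 2 := by linarith
    have e' : C ^ 2 = 1 - S ^ 2 := by linarith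
    have : 0 ≤ C ^ 2 * k ^ 2 - S ^ 2 * l ^ 2 := by linarith
    rw [e, e'] at this; linarith
  have core := G_core h1' h2' (by rw [add_comm]; exact h3') h4' m9 c9 hn0 S9 C9 hk0 hlS hlC
  have g0 := G0_le (m := m) (n := n) (S := S) (C := C) hm0 h1' (by rw [add_comm]; exact h3')
  refine le_trans (le_of_eq ?_) (core.trans g0)
  have e1 : n ^ 2 = 1 - m ^ 2 := by linarith
  have e2 : s ^ 2 = 1 - c ^ 2 := by linarith
  have e3 : S ^ 2 = 1 - C ^ 2 := by linarith
  have e4 : l ^ 2 = 1 - k ^ 2 := by linarith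
  have e5 : (C ^ 2 + S ^ 2) = 1 := h3'
  ring_nf
  rw [e1, e2, e3, e4]
  ring

lemma mid_pair {a b : E3} (ha : dt a a = 1) (hb : dt b b = 1) :
    ∃ P Q : E3, ∃ x X : ℝ, a = P + Q ∧ b = P - Q ∧ 0 ≤ x ∧ 0 ≤ X ∧ dt Q Q = x ^ 2 ∧ dt P P = X ^ 2 ∧
      x ^ 2 + X ^ 2 = 1 := by
  refine ⟨(1/2 : ℝ) • (a + b), (1/2 : ℝ) • (a - b), √(dt ((1/2 : ℝ) • (a - b)) ((1/2 : ℝ) • (a - b))),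
    √(dt ((1/2 : ℝ) • (a + b)) ((1/2 : ℝ) • (a + b))), ?_, ?_, sqrt_nonneg _, sqrt_nonneg _, ?_, ?_, ?_⟩
  · module
  · module
  · rw [sq_sqrt (dt_nn _)]
  · rw [sq_sqrt (dt_nn _)]
  · rw [sq_sqrt (dt_nn _), sq_sqrt (dt_nn _)]
    simp only [dt_smul_left, dt_smul_right, dt_add_left, dt_add_right, dt_sub_left, dt_sub_right, ha, hb]
    ring

lemma det3_neg_le {a b c : E3} {x y z : ℝ} (hx : 0 ≤ x) (hy : 0 ≤ y) (hz : 0 ≤ z)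
    (ha : dt a a = x ^ 2) (hb : dt b b = y ^ 2) (hc : dt c c = z ^ 2) :
    -det3 a b c ≤ x * y * z := by
  have := det3_le_mul (a := b) (b := a) hy hx hz hb.le ha.le hc.le
  have e : det3 b a c = - det3 a b c := by simp only [det3]; ring
  linarith

lemma type13_le {A A' B B' C C' D D' : E3} (hA : dt A A = 1) (hA' : dt A' A' = 1)
    (hB : dt B B = 1) (hB' : dt B' B' = 1) (hC : dt C C = 1) (hC' : dt C' C' = 1)
    (hD : dt D D = 1) (hD' : dt D' D' = 1) :
    det3 A A' C + det3 A C D + det3 A D C' + det3 A C' A' + det3 A' C' D' + det3 A' D' C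
     + det3 B D C + det3 B C D' + det3 B D' B' + det3 B B' D + det3 B' C' D + det3 B' D' C'
     ≤ 4 * gst := by
  obtain ⟨P, Q, S1, C1, rfl, rfl, hS1, hC1, eQ, eP, h1⟩ := mid_pair hA hA'
  obtain ⟨R, S, S2, C2, rfl, rfl, hS2, hC2, eS, eR, h2⟩ := mid_pair hB hB'
  obtain ⟨m, δ, x, X, rfl, rfl, hx, hX, eδ, em, h3⟩ := mid_pair hC hC'
  obtain ⟨n, ε, y, Y, rfl, rfl, hy, hY, eε, en, h4⟩ := mid_pair hD hD'
  have g := G_le hx hX hy hY hS1 hC1 hS2 hC2 h3 h4 (by rw [add_comm]; exact h1) (by rw [add_comm]; exact h2)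
  have e : det3 (P + Q) (P - Q) (m + δ) + det3 (P + Q) (m + δ) (n + ε) + det3 (P + Q) (n + ε) (m - δ)
     + det3 (P + Q) (m - δ) (P - Q) + det3 (P - Q) (m - δ) (n - ε) + det3 (P - Q) (n - ε) (m + δ)
     + det3 (R + S) (n + ε) (m + δ) + det3 (R + S) (m + δ) (n - ε) + det3 (R + S) (n - ε) (R - S)
     + det3 (R + S) (R - S) (n + ε) + det3 (R - S) (m - δ) (n + ε) + det3 (R - S) (n - ε) (m - δ)
     = 4 * (- det3 P Q δ + det3 P δ ε + det3 Q δ n - det3 R S ε + det3 R ε δ + det3 S ε m) := by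
    simp only [det3, PiLp.add_apply, PiLp.sub_apply]; ring
  rw [e]
  have k1 := det3_neg_le hC1 hS1 hx eP eQ eδ
  have k2 := det3_le_mul hC1 hx hy eP.le eδ.le eε.le
  have k3 := det3_le_mul hS1 hx hY eQ.le eδ.le en.le
  have k4 := det3_neg_le hC2 hS2 hy eR eS eε
  have k5 := det3_le_mul hC2 hy hx eR.le eε.le eδ.le
  have k6 := det3_le_mul hS2 hy hX eS.le eε.le em.le
  linarith

section
/-- signed volume (times six) of the tetrahedron `i j k l` -/
def chi (p : ℕ → E3) (i j k l : ℕ) : ℝ := det3 (p j - p i) (p k - p i) (p l - p i)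

lemma chi_s1 (p : ℕ → E3) (i j k l : ℕ) : chi p j i k l = - chi p i j k l := by
  simp only [chi, det3, PiLp.sub_apply]; ring
lemma chi_s2 (p : ℕ → E3) (i j k l : ℕ) : chi p i k j l = - chi p i j k l := by
  simp only [chi, det3, PiLp.sub_apply]; ring
lemma chi_s3 (p : ℕ → E3) (i j k l : ℕ) : chi p i j l k = - chi p i j k l := by
  simp only [chi, det3, PiLp.sub_apply]; ring

/-- generic points on the sphere -/
structure Gen (p : ℕ → E3) : Prop where
  unit : ∀ i < 8, dt (p i) (p i) = 1
  ne : ∀ i < 8, ∀ j < 8, ∀ k < 8, ∀ l < 8, i ≠ j → i ≠ k → i ≠ l → j ≠ k → j ≠ l → k ≠ l →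
    chi p i j k l ≠ 0

/-- oriented facets -/
structure Fc (p : ℕ → E3) (i j k : ℕ) : Prop where
  hi : i < 8
  hj : j < 8
  hk : k < 8
  ij : i ≠ j
  ik : i ≠ k
  jk : j ≠ k
  neg : ∀ l < 8, l ≠ i → l ≠ j → l ≠ k → chi p i j k l < 0

variable {p : ℕ → E3}

lemma Fc.cyc {i j k : ℕ} (h : Fc p i j k) : Fc p j k i := by
  refine ⟨h.hj, h.hk, h.hi, h.jk, h.ij.symm, h.ik.symm, fun l hl h1 h2 h3 => ?_⟩
  have := h.neg l hl h3 h1 h2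
  have e : chi p j k i l = chi p i j k l := by rw [chi_s2, chi_s1, neg_neg]
  rw [e]; exact this

lemma Fc.uniq {i j k l : ℕ} (h : Fc p i j k) (h' : Fc p i j l) : k = l := by
  by_contra hne
  have h1 := h.neg l h'.hk h'.ik.symm h'.jk.symm (Ne.symm hne)
  have h2 := h'.neg k h.hk h.ik.symm h.jk.symm hne
  rw [chi_s3] at h2; linarith

lemma exists_other (a b c : ℕ) : ∃ l < 8, l ≠ a ∧ l ≠ b ∧ l ≠ c := by
  have : ∃ l ∈ Finset.range 8, l ∉ ({a, b, c} : Finset ℕ) := by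
    by_contra hcon
    push Not at hcon
    have h1 : Finset.range 8 ⊆ ({a, b, c} : Finset ℕ) := hcon
    have h2 := Finset.card_le_card h1
    have h3 : ({a, b, c} : Finset ℕ).card ≤ 3 := Finset.card_le_three
    simp at h2; omega
  obtain ⟨l, hl, h⟩ := this
  simp at h hl
  exact ⟨l, hl, h.1, h.2.1, h.2.2⟩

lemma Fc.not_flip {i j k : ℕ} (h : Fc p i j k) (h' : Fc p i k j) : False := by
  obtain ⟨l, hl, h1, h2, h3⟩ := exists_other i j k
  have a := h.neg l hl h1 h2 h3
  have b := h'.neg l hl h1 h3 h2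
  rw [chi_s2] at b; linarith

lemma ord_trans {u x a b c : ℕ} (w : E3) (hx : dt w (p x - p u) = 0)
    (ha : 0 < dt w (p a - p u)) (hb : 0 < dt w (p b - p u)) (hc : 0 < dt w (p c - p u))
    (hab : chi p u x a b < 0) (hbc : chi p u x b c < 0) : chi p u x a c < 0 := by
  have e : chi p u a b c * dt w (p x - p u) - chi p u x b c * dt w (p a - p u)
     + chi p u x a c * dt w (p b - p u) - chi p u x a b * dt w (p c - p u) = 0 := by
    simp only [chi, det3, dt, PiLp.sub_apply]; ring
  rw [hx] at e
  have k1 : chi p u x b c * dt w (p a - p u) < 0 := mul_neg_of_neg_of_pos hbc ha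
  have k2 : chi p u x a b * dt w (p c - p u) < 0 := mul_neg_of_neg_of_pos hab hc
  by_contra hcon
  push Not at hcon
  have := mul_nonneg hcon hb.le
  linarith

lemma ord_max (hg : Gen p) {u x : ℕ} (hu : u < 8) (hx8 : x < 8) (hux : u ≠ x) (w : E3)
    (hx : dt w (p x - p u) = 0) (S : Finset ℕ) (hne : S.Nonempty)
    (hS : ∀ m ∈ S, m < 8 ∧ m ≠ u ∧ m ≠ x ∧ 0 < dt w (p m - p u)) :
    ∃ l ∈ S, ∀ m ∈ S, m ≠ l → chi p u x m l < 0 := by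
  induction hne using Finset.Nonempty.cons_induction with
  | singleton a => exact ⟨a, by simp, by simp⟩
  | cons a s has hs ih =>
    obtain ⟨l, hl, hmax⟩ := ih (fun m hm => hS m (Finset.mem_cons_of_mem hm))
    have Sl := hS l (Finset.mem_cons_of_mem hl)
    have Sa := hS a (Finset.mem_cons_self a s)
    have hal : a ≠ l := fun h => has (h ▸ hl)
    have hn := hg.ne u hu x hx8 a Sa.1 l Sl.1 hux Sa.2.1.symm Sl.2.1.symm Sa.2.2.1.symm Sl.2.2.1.symm hal
    rcases lt_or_gt_of_ne hn with h | h
    · refine ⟨l, Finset.mem_cons_of_mem hl, fun m hm hml => ?_⟩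
      rcases Finset.mem_cons.1 hm with rfl | hm
      · exact h
      · exact hmax m hm hml
    · have h' : chi p u x l a < 0 := by rw [chi_s3]; linarith
      refine ⟨a, Finset.mem_cons_self a s, fun m hm hma => ?_⟩
      rcases Finset.mem_cons.1 hm with rfl | hm
      · exact absurd rfl hma
      · by_cases hml : m = l
        · rw [hml]; exact h'
        · have Sm := hS m (Finset.mem_cons_of_mem hm)
          exact ord_trans w hx Sm.2.2.2 Sl.2.2.2 Sa.2.2.2 (hmax m hm hml) h'

lemma dt_cr (a b c : E3) : dt (cr a b) c = det3 a b c := by simp [dt, cr, det3]; ring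

lemma neg_chi_dt (i j k m : ℕ) : dt (cr (p k - p i) (p j - p i)) (p m - p i) = - chi p i j k m := by
  rw [dt_cr, ← chi_s2, chi]

lemma Fc.opp (hg : Gen p) {i j k : ℕ} (h : Fc p i j k) : ∃ l, Fc p j i l := by
  obtain ⟨l0, hl0, o1, o2, o3⟩ := exists_other i j k
  obtain ⟨l, hl, hmax⟩ := ord_max hg h.hi h.hj h.ij (cr (p k - p i) (p j - p i))
    (by rw [neg_chi_dt]; simp [chi, det3]; ring)
    ((Finset.range 8).filter fun m => m ≠ i ∧ m ≠ j ∧ m ≠ k) ⟨l0, by simp; tauto⟩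
    (by
      intro m hm
      simp at hm
      refine ⟨hm.1, hm.2.1, hm.2.2.1, ?_⟩
      rw [neg_chi_dt]
      linarith [h.neg m hm.1 hm.2.1 hm.2.2.1 hm.2.2.2])
  simp at hl
  refine ⟨l, h.hj, h.hi, hl.1, h.ij.symm, Ne.symm hl.2.2.1, Ne.symm hl.2.1, fun m hm h1 h2 h3 => ?_⟩
  have e : chi p j i l m = chi p i j m l := by rw [chi_s1, chi_s3, neg_neg]
  rw [e]
  by_cases hmk : m = k
  · subst hmk
    exact h.neg l hl.1 hl.2.1 hl.2.2.1 hl.2.2.2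
  · exact hmax m (by simp; tauto) h3

/-- next vertex around `u` -/
lemma Fc.next (hg : Gen p) {u a b : ℕ} (h : Fc p u a b) : ∃ c, Fc p u b c := h.cyc.cyc.opp hg

lemma Fc.pred_uniq {u a b c : ℕ} (h : Fc p u a c) (h' : Fc p u b c) : a = b :=
  h.cyc.cyc.uniq h'.cyc.cyc

lemma Fc.rot {u a b j : ℕ} (h : Fc p u a b) (hj : j < 8) (h1 : j ≠ u) (h2 : j ≠ a) (h3 : j ≠ b) :
    chi p u j a b < 0 := by
  have e : chi p u j a b = chi p u a b j := by rw [chi_s2, chi_s3, neg_neg]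
  rw [e]; exact h.neg j hj h1 h2 h3

lemma link (hg : Gen p) {u : ℕ} (S : Finset ℕ) (hne : S.Nonempty)
    (hS : ∀ a ∈ S, ∃ b ∈ S, Fc p u a b) {j k : ℕ} (hj : Fc p u j k) : j ∈ S := by
  by_contra hjS
  -- facet before j
  obtain ⟨i, hi⟩ : ∃ i, Fc p u i j := by
    obtain ⟨i, hi⟩ := hj.opp hg
    exact ⟨i, hi.cyc⟩
  have hSp : ∀ m ∈ S, m < 8 ∧ m ≠ u ∧ m ≠ j := fun m hm => by
    obtain ⟨b, hb, hf⟩ := hS m hm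
    exact ⟨hf.hj, hf.ij.symm, fun h => hjS (h ▸ hm)⟩
  by_cases hkS : k ∈ S
  · -- use the functional of (u,i,j), or derive membership along
    by_cases hiS : i ∈ S
    · -- i in S and successor of i is j, so j in S
      obtain ⟨b, hb, hf⟩ := hS i hiS
      exact hjS (hf.uniq hi ▸ hb)
    · obtain ⟨l, hl, hmax⟩ := ord_max hg hj.hi hj.hj hj.ij (cr (p j - p u) (p i - p u))
        (by rw [neg_chi_dt]; simp [chi, det3]; ring) S hne (by
          intro m hm
          obtain ⟨h1, h2, h3⟩ := hSp m hm
          refine ⟨h1, h2, h3, ?_⟩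
          rw [neg_chi_dt]
          linarith [hi.neg m h1 h2 (fun h => hiS (h ▸ hm)) h3])
      obtain ⟨b, hb, hf⟩ := hS l hl
      have h1 := hmax b hb hf.jk.symm
      have h2 := hf.rot hj.hj hj.ij.symm (fun h => hjS (h ▸ hl)) (fun h => hjS (h ▸ hb))
      rw [chi_s3] at h1; linarith
  · obtain ⟨l, hl, hmax⟩ := ord_max hg hj.hi hj.hj hj.ij (cr (p k - p u) (p j - p u))
        (by rw [neg_chi_dt]; simp [chi, det3]; ring) S hne (by
          intro m hm
          obtain ⟨h1, h2, h3⟩ := hSp m hm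
          refine ⟨h1, h2, h3, ?_⟩
          rw [neg_chi_dt]
          linarith [hj.neg m h1 h2 h3 (fun h => hkS (h ▸ hm))])
    obtain ⟨b, hb, hf⟩ := hS l hl
    have h1 := hmax b hb hf.jk.symm
    have h2 := hf.rot hj.hj hj.ij.symm (fun h => hjS (h ▸ hl)) (fun h => hjS (h ▸ hb))
    rw [chi_s3] at h1; linarith

lemma Gen.inj (hg : Gen p) {i j : ℕ} (hi : i < 8) (hj : j < 8) (hij : i ≠ j) : p i ≠ p j := by
  intro h
  obtain ⟨k, hk, k1, k2, _⟩ := exists_other i j j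
  obtain ⟨l, hl, l1, l2, l3⟩ := exists_other i j k
  apply hg.ne i hi j hj k hk l hl hij k1.symm l1.symm k2.symm l2.symm l3.symm
  simp [chi, det3, h]

lemma dt_lt_one (hg : Gen p) {i j : ℕ} (hi : i < 8) (hj : j < 8) (hij : i ≠ j) :
    dt (p i) (p j) < 1 := by
  by_contra hcon
  push Not at hcon
  apply hg.inj hi hj hij
  have h : dt (p i - p j) (p i - p j) ≤ 0 := by
    rw [dt_sub, hg.unit i hi, hg.unit j hj, dt_comm (p j)]; linarith
  have h0 : ∀ t, p i t = p j t := by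
    simp only [dt, PiLp.sub_apply] at h
    have a := sq_nonneg (p i 0 - p j 0)
    have b := sq_nonneg (p i 1 - p j 1)
    have c := sq_nonneg (p i 2 - p j 2)
    intro t
    fin_cases t
    · have : (p i 0 - p j 0) ^ 2 = 0 := by nlinarith
      simpa [sub_eq_zero] using this
    · have : (p i 1 - p j 1) ^ 2 = 0 := by nlinarith
      simpa [sub_eq_zero] using this
    · have : (p i 2 - p j 2) ^ 2 = 0 := by nlinarith
      simpa [sub_eq_zero] using this
  ext t; exact h0 t

lemma conn (hg : Gen p) (U : Finset ℕ) (hU : U ⊆ Finset.range 8) (hne : U.Nonempty)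
    (hne' : U ≠ Finset.range 8) : ∃ u ∈ U, ∃ x ∉ U, ∃ k, Fc p u x k := by
  have hV : (Finset.range 8 \ U).Nonempty := by
    rw [Finset.sdiff_nonempty]
    intro h
    exact hne' (Finset.Subset.antisymm hU h)
  obtain ⟨⟨u, x⟩, hux, hmax⟩ := Finset.exists_max_image (U ×ˢ (Finset.range 8 \ U))
    (fun q => dt (p q.1) (p q.2)) (hne.product hV)
  simp only [Finset.mem_product, Finset.mem_sdiff, Finset.mem_range, and_imp, Prod.forall] at hux hmax
  obtain ⟨huU, hx8, hxU⟩ := hux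
  have hu8 : u < 8 := by simpa using hU huU
  have hne : u ≠ x := fun h => hxU (h ▸ huU)
  have key : ∀ m < 8, m ≠ u → m ≠ x → 0 < dt (-(p u) - p x) (p m - p u) := by
    intro m hm h1 h2
    have e : dt (-(p u) - p x) (p m - p u) = 1 + dt (p u) (p x) - dt (p u) (p m) - dt (p x) (p m) := by
      have := hg.unit u hu8
      simp only [dt, PiLp.sub_apply, PiLp.neg_apply] at this ⊢
      linear_combination this
    rw [e]
    by_cases hmU : m ∈ U
    · have a := hmax m x hmU hx8 hxU
      have b := dt_lt_one hg hu8 hm h1.symm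
      have c := dt_comm (p x) (p m)
      linarith
    · have a := hmax u m huU hm hmU
      have b := dt_lt_one hg hx8 hm h2.symm
      linarith
  obtain ⟨l0, hl0, o1, o2, _⟩ := exists_other u x x
  obtain ⟨l, hl, hlmax⟩ := ord_max hg hu8 hx8 hne (-(p u) - p x) (by
      have h1 := hg.unit u hu8
      have h2 := hg.unit x hx8
      simp only [dt, PiLp.sub_apply, PiLp.neg_apply] at h1 h2 ⊢
      linear_combination h1 - h2) ((Finset.range 8).filter fun m => m ≠ u ∧ m ≠ x)
      ⟨l0, by simp; tauto⟩ (by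
        intro m hm
        simp at hm
        exact ⟨hm.1, hm.2.1, hm.2.2, key m hm.1 hm.2.1 hm.2.2⟩)
  simp at hl
  have F : Fc p x u l := by
    refine ⟨hx8, hu8, hl.1, hne.symm, Ne.symm hl.2.2, Ne.symm hl.2.1, fun m hm h1 h2 h3 => ?_⟩
    have e : chi p x u l m = chi p u x m l := by rw [chi_s1, chi_s3, neg_neg]
    rw [e]
    exact hlmax m (by simp; tauto) h3
  obtain ⟨k, hk⟩ := F.opp hg
  exact ⟨u, huU, x, hxU, k, hk⟩

lemma cross_aux2 {o i j k l : ℕ} (hjkl : chi p o j k l < 0) (hikl : chi p o i k l < 0)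
    (hijl : chi p o i j l < 0) (hijk : chi p o i j k < 0) {m m' : ℕ}
    (ho : o < 8) (h1 : o ≠ i) (h2 : o ≠ j) (h3 : o ≠ k) (h4 : o ≠ l)
    (hij : i ≠ j) (hil : i ≠ l) (hkj : k ≠ j) (hkl : k ≠ l)
    (F : Fc p i k m) (F' : Fc p j l m') : False := by
  have id : ∀ a b c : ℕ, chi p o j k l * (chi p a b c i - chi p a b c o)
      - chi p o i k l * (chi p a b c j - chi p a b c o)
      + chi p o i j l * (chi p a b c k - chi p a b c o)
      - chi p o i j k * (chi p a b c l - chi p a b c o) = 0 := by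
    intro a b c
    have e : ∀ z, chi p a b c z - chi p a b c o = dt (cr (p b - p a) (p c - p a)) (p z - p o) := by
      intro z
      simp [chi, dt, cr, det3]; ring
    simp only [e]
    generalize cr (p b - p a) (p c - p a) = w
    simp only [chi, det3, dt, PiLp.sub_apply]; ring
  have z1 : ∀ a b c : ℕ, chi p a b c a = 0 := by intro a b c; simp [chi, det3]
  have z2 : ∀ a b c : ℕ, chi p a b c b = 0 := by intro a b c; simp [chi, det3]; ring
  have z3 : ∀ a b c : ℕ, chi p a b c c = 0 := by intro a b c; simp [chi, det3]; ring
  have np : ∀ {a b c}, Fc p a b c → ∀ z < 8, chi p a b c z ≤ 0 := by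
    intro a b c h z hz
    by_cases e1 : z = a
    · rw [e1, z1]
    by_cases e2 : z = b
    · rw [e2, z2]
    by_cases e3 : z = c
    · rw [e3, z3]
    exact (h.neg z hz e1 e2 e3).le
  have i1 := id i k m
  have i2 := id j l m'
  rw [z1, z2] at i1 i2
  have f0 := np F o ho
  have g0 := np F' o ho
  have fj := np F j F'.hi
  have fl := np F l F'.hj
  have gi := np F' i F.hi
  have gk := np F' k F.hj
  -- strictness
  have s1 : 0 < chi p o i k l * chi p i k m j + chi p o i j k * chi p i k m l := by
    by_cases hm : m = j
    · have : chi p i k m l < 0 := F.neg l F'.hj hil.symm hkl.symm (by rw [hm]; exact F'.ij.symm)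
      have := mul_pos_of_neg_of_neg hijk this
      have := mul_nonneg_of_nonpos_of_nonpos hikl.le fj
      linarith
    · have : chi p i k m j < 0 := F.neg j F'.hi hij.symm hkj.symm (Ne.symm hm)
      have := mul_pos_of_neg_of_neg hikl this
      have := mul_nonneg_of_nonpos_of_nonpos hijk.le fl
      linarith
  have s2 : 0 < chi p o j k l * chi p j l m' i + chi p o i j l * chi p j l m' k := by
    by_cases hm : m' = i
    · have : chi p j l m' k < 0 := F'.neg k F.hj hkj hkl (by rw [hm]; exact F.ij.symm)
      have := mul_pos_of_neg_of_neg hijl this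
      have := mul_nonneg_of_nonpos_of_nonpos hjkl.le gi
      linarith
    · have : chi p j l m' i < 0 := F'.neg i F.hi hij hil (Ne.symm hm)
      have := mul_pos_of_neg_of_neg hjkl this
      have := mul_nonneg_of_nonpos_of_nonpos hijl.le gk
      linarith
  set T := chi p o j k l + chi p o i j l - chi p o i k l - chi p o i j k with hT
  have t1 : 0 < -(T * chi p i k m o) := by
    rw [hT]; linarith
  have t2 : 0 < T * chi p j l m' o := by
    rw [hT]; linarith
  rcases le_total 0 T with h | h
  · have := mul_nonpos_of_nonneg_of_nonpos h g0; linarith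
  · have := mul_nonneg_of_nonpos_of_nonpos h f0; linarith

/-- labelled root: the link of `0` is `1,…,d` in order -/
structure Root (p : ℕ → E3) (d : ℕ) : Prop where
  step : ∀ t, 1 ≤ t → t < d → Fc p 0 t (t + 1)
  last : Fc p 0 d 1

lemma Root.chain {d : ℕ} (hr : Root p d) {i j k : ℕ} (hi : 1 ≤ i) (hij : i < j) (hjk : j < k)
    (hk : k ≤ d) : chi p 0 i j k < 0 := by
  have hd := hr.last.hj
  have F := hr.step i hi (by omega)
  rcases Nat.eq_or_lt_of_le (Nat.succ_le_of_lt hij) with h | h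
  · have h' : j = i + 1 := h.symm
    subst h'
    exact F.neg k (by omega) (by omega) (by omega) (by omega)
  · have hpos : ∀ m, i + 1 < m → m ≤ d →
        0 < dt (cr (p (i + 1) - p 0) (p i - p 0)) (p m - p 0) := by
      intro m h1 h2
      rw [neg_chi_dt]
      linarith [F.neg m (by omega) (by omega) (by omega) (by omega)]
    have hz : dt (cr (p (i + 1) - p 0) (p i - p 0)) (p i - p 0) = 0 := by
      rw [neg_chi_dt]; simp [chi, det3]; ring
    have main : ∀ n, j + 1 + n ≤ d → chi p 0 i j (j + 1 + n) < 0 := by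
      intro n
      induction n with
      | zero =>
        intro hn
        exact (hr.step j (by omega) (by omega)).rot (by omega) (by omega) (by omega) (by omega)
      | succ n ih =>
        intro hn
        exact ord_trans _ hz (hpos j (by omega) (by omega)) (hpos (j + 1 + n) (by omega) (by omega))
          (hpos (j + 1 + (n + 1)) (by omega) (by omega)) (ih (by omega))
          ((hr.step (j + 1 + n) (by omega) (by omega)).rot (by omega) (by omega) (by omega) (by omega))
    have := main (k - (j + 1)) (by omega)
    rwa [show j + 1 + (k - (j + 1)) = k by omega] at this

lemma Root.cross {d : ℕ} (hr : Root p d) {i j k l m m' : ℕ} (hi : 1 ≤ i) (hij : i < j)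
    (hjk : j < k) (hkl : k < l) (hl : l ≤ d) (F : Fc p i k m) (F' : Fc p j l m') : False :=
  cross_aux2 (hr.chain (by omega) hjk hkl hl) (hr.chain hi (by omega) hkl hl)
    (hr.chain hi hij (by omega) hl) (hr.chain hi hij hjk (by omega)) (by omega) (by omega) (by omega)
    (by omega) (by omega) (by omega) (by omega) (by omega) (by omega) F F'

end

abbrev Tri := ℕ × ℕ × ℕ

/-- all rotations of a list of faces -/
def ent : List Tri → List Tri
  | [] => []
  | (a, b, c) :: L => (a, b, c) :: (b, c, a) :: (c, a, b) :: ent L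

def triEq (e f : Tri) : Bool := Nat.beq e.1 f.1 && (Nat.beq e.2.1 f.2.1 && Nat.beq e.2.2 f.2.2)

def memB (E : List Tri) (f : Tri) : Bool := E.any fun e => triEq e f

def nodupB : List Tri → Bool
  | [] => true
  | f :: L => !(memB L f) && nodupB L

def isEdge (a b : ℕ) (e : Tri) : Bool := Nat.beq e.1 a && Nat.beq e.2.1 b

def third : List Tri → ℕ → ℕ → ℕ
  | [], _, _ => 9
  | e :: E, a, b => bif isEdge a b e then e.2.2 else third E a b

def nb : List Tri → ℕ → ℕ
  | [], _ => 9
  | e :: E, a => bif Nat.beq e.1 a then e.2.1 else nb E a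

def chk (E P : List Tri) : Bool := (ent P).all (memB E) && nodupB (ent P)

def vs : List ℕ := [0, 1, 2, 3, 4, 5, 6, 7]

def star3L (p a b c : ℕ) : List Tri := [(p, a, b), (p, b, c), (p, c, a)]

def D3 (E : List Tri) : List (ℕ × ℕ × ℕ × ℕ) :=
  (vs.map fun p => (p, nb E p, third E p (nb E p), third E p (third E p (nb E p)))).filter
    fun q => chk E (star3L q.1 q.2.1 q.2.2.1 q.2.2.2)

def rots (L : List (ℕ × ℕ × ℕ × ℕ)) : List (ℕ × ℕ × ℕ × ℕ) :=
  L.flatMap fun q => [q, (q.1, q.2.2.1, q.2.2.2, q.2.1), (q.1, q.2.2.2, q.2.1, q.2.2.1)]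

def block6L (p a b c x y z : ℕ) : List Tri :=
  [(p, a, b), (p, b, c), (p, c, a), (x, b, a), (y, c, b), (z, a, c)]

def block5L (p a b c y z : ℕ) : List Tri :=
  [(p, a, b), (p, b, c), (p, c, a), (y, c, b), (z, a, c)]

def star6L (s a b c d e f : ℕ) : List Tri :=
  [(s, a, b), (s, b, c), (s, c, d), (s, d, e), (s, e, f), (s, f, a)]

def t11L (N S q e1 e2 e3 e4 e5 : ℕ) : List Tri :=
  [(q, N, e1), (q, e1, e2), (q, e2, N), (e3, N, e2), (e5, e1, N), (N, e3, e4), (N, e4, e5),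
   (S, e2, e1), (S, e3, e2), (S, e4, e3), (S, e5, e4), (S, e1, e5)]

def t10L (p q a b c a' b' c' : ℕ) : List Tri :=
  [(q, p, a), (q, a, b), (q, b, p), (p, b, c), (p, c, a), (c', b, a), (c, b, a'), (c, a', b'),
   (c, b', a), (c', a', b), (c', b', a'), (c', a, b')]

def t13L (A A' B B' C C' D D' : ℕ) : List Tri :=
  [(A, A', C), (A, C, D), (A, D, C'), (A, C', A'), (A', C', D'), (A', D', C), (B, D, C), (B, C, D'),
   (B, D', B'), (B, B', D), (B', C', D), (B', D', C')]

def S3 (q : ℕ × ℕ × ℕ × ℕ) : List Tri := star3L q.1 q.2.1 q.2.2.1 q.2.2.2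

def S6 (E : List Tri) (q : ℕ × ℕ × ℕ × ℕ) : List Tri :=
  block6L q.1 q.2.1 q.2.2.1 q.2.2.2 (third E q.2.2.1 q.2.1) (third E q.2.2.2 q.2.2.1)
    (third E q.2.1 q.2.2.2)

def S5 (E : List Tri) (q : ℕ × ℕ × ℕ × ℕ) : List Tri :=
  block5L q.1 q.2.1 q.2.2.1 q.2.2.2 (third E q.2.2.2 q.2.2.1) (third E q.2.1 q.2.2.2)

def H6 (E : List Tri) (s : ℕ) : List Tri :=
  let a := nb E s
  let b := third E s a
  let c := third E s b
  let d := third E s c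
  let e := third E s d
  star6L s a b c d e (third E s e)

def R1 (E : List Tri) : Bool :=
  let D := D3 E
  D.any fun p => D.any fun q => D.any fun r => chk E (S3 p ++ S3 q ++ S3 r)

def R2 (E : List Tri) : Bool :=
  let D := D3 E
  D.any fun p => D.any fun q => chk E (S6 E p ++ S3 q)

def R3 (E : List Tri) : Bool :=
  let D := rots (D3 E)
  D.any fun p => D.any fun q => chk E (S5 E p ++ S5 E q)

def R12 (E : List Tri) : Bool :=
  let D := vs.filter fun s => chk E (H6 E s)
  D.any fun p => D.any fun q => chk E (H6 E p ++ H6 E q)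

def R11 (E : List Tri) : Bool :=
  (rots (D3 E)).any fun q =>
    let N := q.2.1
    let e1 := q.2.2.1
    let e2 := q.2.2.2
    let e3 := third E N e2
    let e4 := third E N e3
    chk E (t11L N (third E e2 e1) q.1 e1 e2 e3 e4 (third E N e4))

def R10 (E : List Tri) : Bool :=
  (rots (D3 E)).any fun q =>
    let p := q.2.1
    let a := q.2.2.1
    let b := q.2.2.2
    let c := third E p b
    let a' := third E c b
    chk E (t10L p q.1 a b c a' (third E c a') (third E b a))

def R13 (E : List Tri) : Bool :=
  E.any fun e =>
    let A := e.1
    let A' := e.2.1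
    let C := e.2.2
    let C' := third E A' A
    let D := third E A C
    chk E (t13L A A' (third E D C) (third E C' D) C C' D (third E A' C'))

def certs (E : List Tri) : Bool :=
  Nat.ble E.length 36 && (R1 E || (R2 E || (R3 E || (R12 E || (R11 E || (R10 E || R13 E))))))

def missing (E : List Tri) : Bool := vs.any fun u => E.all fun e => !(Nat.beq e.1 u)

def orb (E : List Tri) (u : ℕ) : ℕ → ℕ → List ℕ
  | 0, s => [s]
  | n + 1, s => s :: orb E u n (third E u s)

def memN (S : List ℕ) (a : ℕ) : Bool := S.any fun b => Nat.beq a b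

def badLink (E : List Tri) (u : ℕ) : Bool :=
  let Eu := E.filter fun e => Nat.beq e.1 u
  let S := orb Eu u 7 (nb Eu u)
  S.all (fun a => Eu.any fun e => Nat.beq e.2.1 a && memN S e.2.2) &&
    Eu.any fun e => !(memN S e.2.1)

def leaf (E : List Tri) : Bool := missing E || (certs E || vs.any (badLink E))

def hasEdge (E : List Tri) (a b : ℕ) : Bool := E.any (isEdge a b)

/-- first open edge -/
def openE (E : List Tri) : List Tri → Option (ℕ × ℕ)
  | [] => none
  | e :: F => bif hasEdge E e.2.1 e.1 then openE E F else some (e.2.1, e.1)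

def inter1 (d a b c e : ℕ) : Bool :=
  Nat.ble 1 a && (Nat.blt a c && (Nat.blt c b && (Nat.blt b e && Nat.ble e d)))

def inter (d a b c e : ℕ) : Bool :=
  bif Nat.ble a b then
    (bif Nat.ble c e then inter1 d a b c e || inter1 d c e a b
      else inter1 d a b e c || inter1 d e c a b)
  else
    (bif Nat.ble c e then inter1 d b a c e || inter1 d c e b a
      else inter1 d b a e c || inter1 d e c b a)

def clash (d : ℕ) (f e : Tri) : Bool :=
  (isEdge f.1 f.2.1 e && !(Nat.beq e.2.2 f.2.2)) || inter d f.1 f.2.1 e.1 e.2.1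

def degB (E : List Tri) (u : ℕ) : ℕ :=
  let Eu := E.filter fun e => Nat.beq e.1 u
  (vs.filter fun b => Eu.any fun e => Nat.beq e.2.1 b).length

def prune (d : ℕ) (E : List Tri) (i j k : ℕ) : Bool :=
  (E.any fun e => clash d (i, j, k) e || (clash d (j, k, i) e || clash d (k, i, j) e)) ||
  (let E' := (i, j, k) :: (j, k, i) :: (k, i, j) :: E
   (Nat.blt d (degB E' i) || (Nat.blt d (degB E' j) || Nat.blt d (degB E' k))))

/-- evaluates its first argument to a numeral before continuing -/
def frc (i : ℕ) (f : ℕ → Bool) : Bool := vs.any fun i' => Nat.beq i i' && f i'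

def dfs (d : ℕ) : ℕ → List Tri → Bool
  | 0, _ => false
  | n + 1, E =>
    match openE E E with
    | none => leaf E
    | some (i, j) => frc i fun i => frc j fun j => vs.all fun k =>
        Nat.beq k i || (Nat.beq k j || (prune d E i j k ||
          dfs d n ((i, j, k) :: (j, k, i) :: (k, i, j) :: E)))

def fanList (d : ℕ) : List Tri :=
  ent ((0, d, 1) :: (List.range (d - 1)).map fun t => (0, t + 1, t + 2))

section
variable {p : ℕ → E3}

/-- determinant of a labelled face -/
def dP (p : ℕ → E3) (e : Tri) : ℝ := det3 (p e.1) (p e.2.1) (p e.2.2)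

/-- facet predicate on triples -/
def FcT (p : ℕ → E3) (e : Tri) : Prop := Fc p e.1 e.2.1 e.2.2

open Classical in
/-- the finite set of oriented facets -/
noncomputable def facets (p : ℕ → E3) : Finset Tri :=
  (Finset.range 8 ×ˢ Finset.range 8 ×ˢ Finset.range 8).filter (FcT p)

lemma mem_facets {e : Tri} : e ∈ facets p ↔ FcT p e := by
  simp only [facets, Finset.mem_filter, Finset.mem_product, Finset.mem_range, and_iff_right_iff_imp]
  intro h
  exact ⟨h.hi, h.hj, h.hk⟩

/-- sum of determinants over all facets, each counted three times -/
noncomputable def sumD (p : ℕ → E3) : ℝ := ∑ e ∈ facets p, dP p e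

/-- sum over a list of faces -/
noncomputable def lsum (p : ℕ → E3) (P : List Tri) : ℝ := (P.map (dP p)).sum

lemma triEq_iff {e f : Tri} : triEq e f = true ↔ e = f := by
  obtain ⟨a, b, c⟩ := e
  obtain ⟨a', b', c'⟩ := f
  simp [triEq]

lemma memB_iff {E : List Tri} {f : Tri} : memB E f = true ↔ f ∈ E := by
  simp [memB, triEq_iff]

lemma nodupB_iff {E : List Tri} : nodupB E = true ↔ E.Nodup := by
  induction E with
  | nil => simp [nodupB]
  | cons f L ih =>
    rw [nodupB, Bool.and_eq_true, ih, List.nodup_cons, ← memB_iff]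
    simp

lemma mem_ent {P : List Tri} {f : Tri} (h : f ∈ P) : f ∈ ent P := by
  induction P with
  | nil => simp at h
  | cons g L ih =>
    obtain ⟨a, b, c⟩ := g
    rw [ent]
    rcases List.mem_cons.1 h with h | h
    · simp [h]
    · simp [ih h]

lemma det3_cyc (a b c : E3) : det3 b c a = det3 a b c := by simp only [det3]; ring

lemma lsum_ent (P : List Tri) : lsum p (ent P) = 3 * lsum p P := by
  induction P with
  | nil => simp [lsum, ent]
  | cons g L ih =>
    obtain ⟨a, b, c⟩ := g
    simp only [lsum, ent, List.map_cons, List.sum_cons] at ih ⊢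
    rw [ih]
    simp only [dP]
    rw [det3_cyc (p c) (p a) (p b), det3_cyc (p b) (p c) (p a)]
    ring

lemma length_ent (P : List Tri) : (ent P).length = 3 * P.length := by
  induction P with
  | nil => simp [ent]
  | cons g L ih => obtain ⟨a, b, c⟩ := g; simp only [ent, List.length_cons, ih]; ring

lemma FcT.dP_le (hg : Gen p) {e : Tri} (h : FcT p e) : dP p e ≤ 1 :=
  face_le (hg.unit _ h.hi) (hg.unit _ h.hj) (hg.unit _ h.hk)

lemma chk_bound (hg : Gen p) {E P : List Tri} (hE : ∀ e, e ∈ E ↔ FcT p e) (hl : E.length ≤ 36)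
    (hc : chk E P = true) :
    (∀ f ∈ P, FcT p f) ∧ sumD p ≤ 3 * lsum p P + (36 - 3 * (P.length : ℝ)) := by
  rw [chk, Bool.and_eq_true, List.all_eq_true, nodupB_iff] at hc
  obtain ⟨h1, h2⟩ := hc
  have h1' : ∀ f ∈ ent P, FcT p f := fun f hf => (hE f).1 (memB_iff.1 (h1 f hf))
  refine ⟨fun f hf => h1' f (mem_ent hf), ?_⟩
  have hsub : (ent P).toFinset ⊆ facets p := by
    intro f hf
    rw [List.mem_toFinset] at hf
    exact mem_facets.2 (h1' f hf)
  have hsum : ∑ e ∈ (ent P).toFinset, dP p e = 3 * lsum p P := by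
    rw [List.sum_toFinset _ h2, ← lsum_ent]; rfl
  have hcard : (ent P).toFinset.card = 3 * P.length := by
    rw [List.toFinset_card_of_nodup h2, length_ent]
  have hcF : (facets p).card ≤ 36 := by
    have : facets p ⊆ E.toFinset := by
      intro e he
      rw [List.mem_toFinset]
      exact (hE e).2 (mem_facets.1 he)
    exact (Finset.card_le_card this).trans ((List.toFinset_card_le E).trans hl)
  rw [sumD, ← Finset.sum_sdiff hsub, hsum]
  have h3 : ∑ e ∈ facets p \ (ent P).toFinset, dP p e ≤
      ((facets p \ (ent P).toFinset).card : ℝ) := by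
    have := Finset.sum_le_card_nsmul (facets p \ (ent P).toFinset) (dP p) 1 (by
      intro e he
      exact (mem_facets.1 (Finset.mem_sdiff.1 he).1).dP_le hg)
    simpa using this
  have h4 : (facets p \ (ent P).toFinset).card + 3 * P.length ≤ 36 := by
    rw [← hcard, Finset.card_sdiff_add_card_eq_card hsub]; exact hcF
  have h5 : ((facets p \ (ent P).toFinset).card : ℝ) + 3 * P.length ≤ 36 := by exact_mod_cast h4
  linarith

lemma lsum_append (P Q : List Tri) : lsum p (P ++ Q) = lsum p P + lsum p Q := by
  simp [lsum]

lemma lsum_S3 (hg : Gen p) {q : ℕ × ℕ × ℕ × ℕ} (h : ∀ f ∈ S3 q, FcT p f) :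
    lsum p (S3 q) ≤ 2.5981 := by
  obtain ⟨x, a, b, c⟩ := q
  have h1 := h (x, a, b) (by simp [S3, star3L])
  have h2 := h (x, b, c) (by simp [S3, star3L])
  have := star3_le (hg.unit _ h1.hi) (hg.unit _ h1.hj) (hg.unit _ h1.hk) (hg.unit _ h2.hk)
  simp only [S3, star3L, lsum, dP, List.map_cons, List.map_nil, List.sum_cons, List.sum_nil] at *
  linarith

lemma det3_neg_flip (x a b : E3) : det3 (-x) a b = det3 x b a := by
  simp only [det3, PiLp.neg_apply]; ring

lemma dt_neg_neg (x : E3) : dt (-x) (-x) = dt x x := by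
  simp only [dt, PiLp.neg_apply]; ring

lemma Gen.unit_neg (hg : Gen p) (i : ℕ) (hi : i < 8) : dt (-p i) (-p i) = 1 := by
  rw [dt_neg_neg]; exact hg.unit i hi

lemma lsum_S6 (hg : Gen p) {E : List Tri} {q : ℕ × ℕ × ℕ × ℕ} (h : ∀ f ∈ S6 E q, FcT p f) :
    lsum p (S6 E q) ≤ 5.1963 := by
  obtain ⟨x, a, b, c⟩ := q
  simp only [S6] at *
  generalize third E b a = x1 at *
  generalize third E c b = y1 at *
  generalize third E a c = z1 at *
  have h1 := h (x, a, b) (by simp [block6L])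
  have h2 := h (x, b, c) (by simp [block6L])
  have h3 := h (x1, b, a) (by simp [block6L])
  have h4 := h (y1, c, b) (by simp [block6L])
  have h5 := h (z1, a, c) (by simp [block6L])
  have := block6_le (hg.unit _ h1.hi) (hg.unit _ h1.hj) (hg.unit _ h1.hk) (hg.unit _ h2.hk)
    (hg.unit_neg _ h3.hi) (hg.unit_neg _ h4.hi) (hg.unit_neg _ h5.hi)
  simp only [det3_neg_flip] at this
  simp only [block6L, lsum, dP, List.map_cons, List.map_nil, List.sum_cons, List.sum_nil] at *
  linarith

lemma lsum_S5 (hg : Gen p) {E : List Tri} {q : ℕ × ℕ × ℕ × ℕ} (h : ∀ f ∈ S5 E q, FcT p f) :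
    lsum p (S5 E q) ≤ 4.44 := by
  obtain ⟨x, a, b, c⟩ := q
  simp only [S5] at *
  generalize third E c b = y1 at *
  generalize third E a c = z1 at *
  have h1 := h (x, a, b) (by simp [block5L])
  have h2 := h (x, b, c) (by simp [block5L])
  have h4 := h (y1, c, b) (by simp [block5L])
  have h5 := h (z1, a, c) (by simp [block5L])
  have := block5_le (hg.unit _ h1.hi) (hg.unit _ h1.hj) (hg.unit _ h1.hk) (hg.unit _ h2.hk)
    (hg.unit_neg _ h4.hi) (hg.unit_neg _ h5.hi)
  simp only [det3_neg_flip] at this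
  simp only [block5L, lsum, dP, List.map_cons, List.map_nil, List.sum_cons, List.sum_nil] at *
  linarith

lemma lsum_star6 (hg : Gen p) {s a b c d e f : ℕ} (h : ∀ g ∈ star6L s a b c d e f, FcT p g) :
    lsum p (star6L s a b c d e f) ≤ 5.1963 := by
  have h1 := h (s, a, b) (by simp [star6L])
  have h2 := h (s, c, d) (by simp [star6L])
  have h3 := h (s, e, f) (by simp [star6L])
  have := star6_le (hg.unit _ h1.hi) (hg.unit _ h1.hj) (hg.unit _ h1.hk) (hg.unit _ h2.hj)
    (hg.unit _ h2.hk) (hg.unit _ h3.hj) (hg.unit _ h3.hk)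
  simp only [star6L, lsum, dP, List.map_cons, List.map_nil, List.sum_cons, List.sum_nil] at *
  linarith

lemma lsum_t11 (hg : Gen p) {N S q e1 e2 e3 e4 e5 : ℕ}
    (h : ∀ g ∈ t11L N S q e1 e2 e3 e4 e5, FcT p g) :
    lsum p (t11L N S q e1 e2 e3 e4 e5) ≤ 10.89 := by
  have h1 := h (q, N, e1) (by simp [t11L])
  have h2 := h (S, e3, e2) (by simp [t11L])
  have h3 := h (N, e4, e5) (by simp [t11L])
  have := type11_le (hg.unit _ h1.hj) (hg.unit _ h2.hi) (hg.unit _ h1.hi) (hg.unit _ h1.hk)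
    (hg.unit _ h2.hk) (hg.unit _ h2.hj) (hg.unit _ h3.hj) (hg.unit _ h3.hk)
  simp only [t11L, lsum, dP, List.map_cons, List.map_nil, List.sum_cons, List.sum_nil] at *
  linarith

lemma lsum_t10 (hg : Gen p) {x q a b c a' b' c' : ℕ}
    (h : ∀ g ∈ t10L x q a b c a' b' c', FcT p g) :
    lsum p (t10L x q a b c a' b' c') ≤ 10.893 := by
  have h1 := h (q, x, a) (by simp [t10L])
  have h2 := h (x, b, c) (by simp [t10L])
  have h3 := h (c', b', a') (by simp [t10L])
  have := type10_le (hg.unit _ h1.hj) (hg.unit _ h1.hi) (hg.unit _ h1.hk) (hg.unit _ h2.hj)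
    (hg.unit _ h2.hk) (hg.unit _ h3.hk) (hg.unit _ h3.hj) (hg.unit _ h3.hi)
  simp only [t10L, lsum, dP, List.map_cons, List.map_nil, List.sum_cons, List.sum_nil] at *
  linarith

lemma lsum_t13 (hg : Gen p) {A A' B B' C C' D D' : ℕ}
    (h : ∀ g ∈ t13L A A' B B' C C' D D', FcT p g) :
    lsum p (t13L A A' B B' C C' D D') ≤ 4 * gst := by
  have h1 := h (A, A', C) (by simp [t13L])
  have h2 := h (B, D', B') (by simp [t13L])
  have h3 := h (A, D, C') (by simp [t13L])
  have := type13_le (hg.unit _ h1.hi) (hg.unit _ h1.hj) (hg.unit _ h2.hi) (hg.unit _ h2.hk)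
    (hg.unit _ h1.hk) (hg.unit _ h3.hk) (hg.unit _ h3.hj) (hg.unit _ h2.hj)
  simp only [t13L, lsum, dP, List.map_cons, List.map_nil, List.sum_cons, List.sum_nil] at *
  linarith

lemma certs_bound (hg : Gen p) {E : List Tri} (hE : ∀ e, e ∈ E ↔ FcT p e)
    (hc : certs E = true) : sumD p ≤ 12 * gst := by
  have hgst := gst_ge
  simp only [certs, Bool.and_eq_true, Bool.or_eq_true, Nat.ble_eq] at hc
  obtain ⟨hl, h | h | h | h | h | h | h⟩ := hc
  · simp only [R1, List.any_eq_true] at h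
    obtain ⟨a, -, b, -, c, -, h⟩ := h
    obtain ⟨h1, h2⟩ := chk_bound hg hE hl h
    have i1 := lsum_S3 hg (q := a) (fun f hf => h1 f (by simp [hf]))
    have i2 := lsum_S3 hg (q := b) (fun f hf => h1 f (by simp [hf]))
    have i3 := lsum_S3 hg (q := c) (fun f hf => h1 f (by simp [hf]))
    rw [lsum_append, lsum_append] at h2
    simp [S3, star3L] at h2 i1 i2 i3
    linarith
  · simp only [R2, List.any_eq_true] at h
    obtain ⟨a, -, b, -, h⟩ := h
    obtain ⟨h1, h2⟩ := chk_bound hg hE hl h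
    have i1 := lsum_S6 hg (E := E) (q := a) (fun f hf => h1 f (by simp [hf]))
    have i2 := lsum_S3 hg (q := b) (fun f hf => h1 f (by simp [hf]))
    rw [lsum_append] at h2
    simp [S3, star3L, S6, block6L] at h2 i1 i2
    linarith
  · simp only [R3, List.any_eq_true] at h
    obtain ⟨a, -, b, -, h⟩ := h
    obtain ⟨h1, h2⟩ := chk_bound hg hE hl h
    have i1 := lsum_S5 hg (E := E) (q := a) (fun f hf => h1 f (by simp [hf]))
    have i2 := lsum_S5 hg (E := E) (q := b) (fun f hf => h1 f (by simp [hf]))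
    rw [lsum_append] at h2
    simp [S5, block5L] at h2 i1 i2
    linarith
  · simp only [R12, List.any_eq_true] at h
    obtain ⟨a, -, b, -, h⟩ := h
    obtain ⟨h1, h2⟩ := chk_bound hg hE hl h
    have i1 : lsum p (H6 E a) ≤ 5.1963 :=
      lsum_star6 hg (fun f hf => h1 f (List.mem_append_left _ hf))
    have i2 : lsum p (H6 E b) ≤ 5.1963 :=
      lsum_star6 hg (fun f hf => h1 f (List.mem_append_right _ hf))
    rw [lsum_append] at h2
    simp [H6, star6L] at h2 i1 i2
    linarith
  · simp only [R11, List.any_eq_true] at h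
    obtain ⟨a, -, h⟩ := h
    obtain ⟨h1, h2⟩ := chk_bound hg hE hl h
    have i1 := lsum_t11 hg h1
    simp [t11L] at h2 i1
    linarith
  · simp only [R10, List.any_eq_true] at h
    obtain ⟨a, -, h⟩ := h
    obtain ⟨h1, h2⟩ := chk_bound hg hE hl h
    have i1 := lsum_t10 hg h1
    simp [t10L] at h2 i1
    linarith
  · simp only [R13, List.any_eq_true] at h
    obtain ⟨a, -, h⟩ := h
    obtain ⟨h1, h2⟩ := chk_bound hg hE hl h
    have i1 := lsum_t13 hg h1
    simp [t13L] at h2 i1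
    linarith
end

section
variable {p : ℕ → E3}

/-- partial list of facets, closed under rotation -/
structure Good (p : ℕ → E3) (E : List Tri) : Prop where
  fc : ∀ e ∈ E, FcT p e
  rot : ∀ a b c, (a, b, c) ∈ E → (b, c, a) ∈ E

open Classical in
/-- degree of a vertex -/
noncomputable def deg (p : ℕ → E3) (u : ℕ) : ℕ :=
  ((Finset.range 8).filter fun b => ∃ c, Fc p u b c).card

lemma nbeq_iff {a b : ℕ} : Nat.beq a b = true ↔ a = b :=
  ⟨Nat.eq_of_beq_eq_true, fun h => by subst h; exact Nat.beq_refl a⟩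

lemma mem_vs {u : ℕ} : u ∈ vs ↔ u < 8 := by
  simp only [vs, List.mem_cons, List.not_mem_nil, or_false]
  omega

lemma hasEdge_iff {E : List Tri} {a b : ℕ} : hasEdge E a b = true ↔ ∃ c, (a, b, c) ∈ E := by
  simp only [hasEdge, List.any_eq_true, isEdge, Bool.and_eq_true, nbeq_iff]
  constructor
  · rintro ⟨⟨x, y, z⟩, h, h1, h2⟩
    simp only at h1 h2
    subst h1 h2
    exact ⟨z, h⟩
  · rintro ⟨c, h⟩
    exact ⟨_, h, rfl, rfl⟩

lemma closed_full (hg : Gen p) {E : List Tri} (hE : Good p E)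
    (hc : ∀ e ∈ E, hasEdge E e.2.1 e.1 = true) {u a b : ℕ} (hu : (u, a, b) ∈ E) {j k : ℕ}
    (hj : Fc p u j k) : (u, j, k) ∈ E := by
  have hm : ∀ x, x ∈ ((E.filter fun e => decide (e.1 = u)).map fun e => e.2.1).toFinset ↔
      ∃ y, (u, x, y) ∈ E := by
    intro x
    simp only [List.mem_toFinset, List.mem_map, List.mem_filter, decide_eq_true_eq]
    constructor
    · rintro ⟨⟨a1, a2, a3⟩, ⟨h1, h2⟩, h3⟩
      simp only at h2 h3
      subst h2 h3
      exact ⟨_, h1⟩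
    · rintro ⟨y, hy⟩
      exact ⟨_, ⟨hy, rfl⟩, rfl⟩
  have := link hg _ ⟨a, (hm a).2 ⟨b, hu⟩⟩ (by
    intro x hx
    obtain ⟨y, hy⟩ := (hm x).1 hx
    have h1 := hc _ (hE.rot _ _ _ (hE.rot _ _ _ hy))
    rw [hasEdge_iff] at h1
    obtain ⟨c, h1⟩ := h1
    exact ⟨y, (hm y).2 ⟨c, h1⟩, hE.fc _ hy⟩) hj
  obtain ⟨y, hy⟩ := (hm j).1 this
  have h2 : Fc p u j y := hE.fc _ hy
  rw [hj.uniq h2]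
  exact hy

lemma closed_all (hg : Gen p) {E : List Tri} (hE : Good p E) (hne : E ≠ [])
    (hc : ∀ e ∈ E, hasEdge E e.2.1 e.1 = true) {u : ℕ} (hu : u < 8) : ∃ a b, (u, a, b) ∈ E := by
  classical
  by_contra hcon
  obtain ⟨⟨x, y, z⟩, hx⟩ := List.exists_mem_of_ne_nil E hne
  have hm : ∀ v, v ∈ (Finset.range 8).filter (fun v => ∃ a b, (v, a, b) ∈ E) ↔
      ∃ a b, (v, a, b) ∈ E := by
    intro v
    simp only [Finset.mem_filter, Finset.mem_range, and_iff_right_iff_imp]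
    rintro ⟨a, b, h⟩
    exact (hE.fc _ h).hi
  obtain ⟨v, hv, w, hw, k, hF⟩ := conn hg _ (Finset.filter_subset _ _) ⟨x, (hm x).2 ⟨y, z, hx⟩⟩ (by
    intro h
    have h2 : u ∈ Finset.range 8 := Finset.mem_range.2 hu
    rw [← h, hm] at h2
    exact hcon h2)
  obtain ⟨a, b, h⟩ := (hm v).1 hv
  exact hw ((hm w).2 ⟨_, _, hE.rot _ _ _ (closed_full hg hE hc h hF)⟩)

lemma orb_ne (E : List Tri) (u n s : ℕ) : s ∈ orb E u n s := by
  cases n <;> simp [orb]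

lemma memN_iff {S : List ℕ} {a : ℕ} : memN S a = true ↔ a ∈ S := by
  simp [memN]

lemma badLink_false (hg : Gen p) {E : List Tri} (hE : Good p E) {u : ℕ}
    (h : badLink E u = true) : False := by
  rw [badLink] at h
  simp only [Bool.and_eq_true] at h
  obtain ⟨h1, h2⟩ := h
  revert h1 h2
  generalize hS : orb (E.filter fun e => Nat.beq e.1 u) u 7 (nb (E.filter fun e => Nat.beq e.1 u) u) = S
  have hmem : nb (E.filter fun e => Nat.beq e.1 u) u ∈ S := by rw [← hS]; exact orb_ne _ _ _ _
  intro h1 h2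
  rw [List.all_eq_true] at h1
  rw [List.any_eq_true] at h2
  obtain ⟨⟨x, y, z⟩, he, h2⟩ := h2
  simp only [List.mem_filter, nbeq_iff] at he
  obtain ⟨he, rfl⟩ := he
  have hF : Fc p x y z := hE.fc _ he
  have := link hg S.toFinset ⟨_, List.mem_toFinset.2 hmem⟩ (by
    intro a ha
    have h3 := h1 a (List.mem_toFinset.1 ha)
    rw [List.any_eq_true] at h3
    obtain ⟨⟨x', y', z'⟩, he', h3⟩ := h3
    simp only [List.mem_filter, nbeq_iff] at he'
    obtain ⟨he', rfl⟩ := he'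
    simp only [Bool.and_eq_true, nbeq_iff, memN_iff] at h3
    obtain ⟨rfl, h3⟩ := h3
    exact ⟨z', List.mem_toFinset.2 h3, hE.fc _ he'⟩) hF
  rw [List.mem_toFinset, ← memN_iff] at this
  simp [this] at h2

lemma leaf_bound (hg : Gen p) {E : List Tri} (hE : Good p E) (hne : E ≠ [])
    (hc : ∀ e ∈ E, hasEdge E e.2.1 e.1 = true) (h : leaf E = true) : sumD p ≤ 12 * gst := by
  simp only [leaf, Bool.or_eq_true] at h
  rcases h with h | h | h
  · exfalso
    simp only [missing, List.any_eq_true, List.all_eq_true] at h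
    obtain ⟨u, hu, h⟩ := h
    obtain ⟨a, b, hab⟩ := closed_all hg hE hne hc (mem_vs.1 hu)
    simpa using h _ hab
  · refine certs_bound hg (fun e => ⟨hE.fc e, fun he => ?_⟩) h
    obtain ⟨a, b, hab⟩ := closed_all hg hE hne hc he.hi
    exact closed_full hg hE hc hab he
  · exfalso
    simp only [List.any_eq_true] at h
    obtain ⟨u, -, h⟩ := h
    exact badLink_false hg hE h

lemma openE_none {E F : List Tri} (h : openE E F = none) : ∀ e ∈ F, hasEdge E e.2.1 e.1 = true := by
  induction F with
  | nil => simp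
  | cons f F ih =>
    rw [openE] at h
    cases h1 : hasEdge E f.2.1 f.1 with
    | false => simp [h1] at h
    | true =>
      simp only [h1, cond_true] at h
      intro e he
      rcases List.mem_cons.1 he with rfl | he
      · exact h1
      · exact ih h e he

lemma openE_some {E F : List Tri} {i j : ℕ} (h : openE E F = some (i, j)) :
    ∃ k, (j, i, k) ∈ F := by
  induction F with
  | nil => simp [openE] at h
  | cons f F ih =>
    rw [openE] at h
    cases h1 : hasEdge E f.2.1 f.1 with
    | true =>
      simp only [h1, cond_true] at h
      obtain ⟨k, hk⟩ := ih h
      exact ⟨k, by simp [hk]⟩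
    | false =>
      simp only [h1, cond_false, Option.some.injEq, Prod.mk.injEq] at h
      obtain ⟨rfl, rfl⟩ := h
      exact ⟨f.2.2, by simp⟩

lemma inter1_false {d : ℕ} (hr : Root p d) {a b c e m m' : ℕ} (F : Fc p a b m)
    (F' : Fc p c e m') (h : inter1 d a b c e = true) : False := by
  simp only [inter1, Bool.and_eq_true, Nat.ble_eq, Nat.blt_eq] at h
  obtain ⟨h1, h2, h3, h4, h5⟩ := h
  exact hr.cross h1 h2 h3 h4 h5 F F'

lemma inter_false (hg : Gen p) {d : ℕ} (hr : Root p d) {a b c e m m' : ℕ} (F : Fc p a b m)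
    (F' : Fc p c e m') (h : inter d a b c e = true) : False := by
  obtain ⟨n, G⟩ := F.opp hg
  obtain ⟨n', G'⟩ := F'.opp hg
  rw [inter] at h
  cases h1 : Nat.ble a b <;> cases h2 : Nat.ble c e <;>
    simp only [h1, h2, cond_true, cond_false, Bool.or_eq_true] at h <;>
    rcases h with h | h
  · exact inter1_false hr G G' h
  · exact inter1_false hr G' G h
  · exact inter1_false hr G F' h
  · exact inter1_false hr F' G h
  · exact inter1_false hr F G' h
  · exact inter1_false hr G' F h
  · exact inter1_false hr F F' h
  · exact inter1_false hr F' F h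

lemma clash_false (hg : Gen p) {d : ℕ} (hr : Root p d) {f e : Tri} (hf : FcT p f) (he : FcT p e)
    (h : clash d f e = true) : False := by
  obtain ⟨a, b, c⟩ := f
  obtain ⟨a', b', c'⟩ := e
  simp only [clash, isEdge, Bool.or_eq_true, Bool.and_eq_true, nbeq_iff,
    Bool.not_eq_true'] at h
  rcases h with ⟨⟨rfl, rfl⟩, h⟩ | h
  · have := Fc.uniq hf he
    simp only at this
    simp [this] at h
  · exact inter_false hg hr hf he h

lemma degB_le {E : List Tri} (hE : Good p E) (u : ℕ) : degB E u ≤ deg p u := by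
  classical
  rw [degB, deg]
  have hn : vs.Nodup := by decide
  rw [← List.toFinset_card_of_nodup (hn.filter _)]
  apply Finset.card_le_card
  intro b hb
  simp only [List.mem_toFinset, List.mem_filter, List.any_eq_true, nbeq_iff, mem_vs] at hb
  obtain ⟨hb, ⟨x, y, z⟩, ⟨h1, rfl⟩, rfl⟩ := hb
  simp only [Finset.mem_filter, Finset.mem_range]
  exact ⟨hb, z, hE.fc _ h1⟩

lemma prune_false (hg : Gen p) {d : ℕ} (hr : Root p d) (hd : ∀ u < 8, deg p u ≤ d) {E : List Tri}
    {i j k : ℕ} (hE : Good p ((i, j, k) :: (j, k, i) :: (k, i, j) :: E))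
    (h : prune d E i j k = true) : False := by
  have f1 : Fc p i j k := hE.fc (i, j, k) (by simp)
  simp only [prune, Bool.or_eq_true, List.any_eq_true, Nat.blt_eq] at h
  rcases h with ⟨e, he, h⟩ | h
  · have he' : FcT p e := hE.fc e (by simp [he])
    rcases h with h | h | h
    · exact clash_false hg hr (hE.fc (i, j, k) (by simp)) he' h
    · exact clash_false hg hr (hE.fc (j, k, i) (by simp)) he' h
    · exact clash_false hg hr (hE.fc (k, i, j) (by simp)) he' h
  · have g1 := (degB_le hE i).trans (hd i f1.hi)
    have g2 := (degB_le hE j).trans (hd j f1.hj)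
    have g3 := (degB_le hE k).trans (hd k f1.hk)
    omega

lemma Good.cons {E : List Tri} (hE : Good p E) {i j k : ℕ} (h : Fc p i j k) :
    Good p ((i, j, k) :: (j, k, i) :: (k, i, j) :: E) := by
  constructor
  · intro e he
    simp only [List.mem_cons] at he
    rcases he with rfl | rfl | rfl | he
    · exact h
    · exact h.cyc
    · exact h.cyc.cyc
    · exact hE.fc e he
  · intro a b c habc
    simp only [List.mem_cons, Prod.mk.injEq] at habc ⊢
    rcases habc with ⟨rfl, rfl, rfl⟩ | ⟨rfl, rfl, rfl⟩ | ⟨rfl, rfl, rfl⟩ | h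
    · simp
    · simp
    · simp
    · simp [hE.rot _ _ _ h]

lemma frc_elim {i : ℕ} {f : ℕ → Bool} (h : frc i f = true) : f i = true := by
  rw [frc, List.any_eq_true] at h
  obtain ⟨j, -, hj⟩ := h
  rw [Bool.and_eq_true, nbeq_iff] at hj
  rw [hj.1]; exact hj.2

theorem dfs_sound (hg : Gen p) {d : ℕ} (hr : Root p d) (hd : ∀ u < 8, deg p u ≤ d) (n : ℕ) :
    ∀ E : List Tri, Good p E → E ≠ [] → dfs d n E = true → sumD p ≤ 12 * gst := by
  induction n with
  | zero => intro E _ _ h; simp [dfs] at h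
  | succ n ih =>
    intro E hE hne h
    rw [dfs] at h
    rcases ho : openE E E with _ | ⟨i, j⟩
    · simp only [ho] at h
      exact leaf_bound hg hE hne (openE_none ho) h
    · simp only [ho] at h
      have h := frc_elim (frc_elim h)
      simp only [List.all_eq_true] at h
      obtain ⟨k0, hk0⟩ := openE_some ho
      obtain ⟨k, hk⟩ := Fc.opp hg (hE.fc _ hk0)
      simp only at hk
      have hE' := hE.cons hk
      have h1 := h k (mem_vs.2 hk.hk)
      simp only [Bool.or_eq_true, nbeq_iff] at h1
      rcases h1 with h1 | h1 | h1 | h1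
      · exact absurd h1 hk.ik.symm
      · exact absurd h1 hk.jk.symm
      · exact (prune_false hg hr hd hE' h1).elim
      · exact ih _ hE' (by simp) h1

lemma Good.ent {P : List Tri} (h : ∀ f ∈ P, FcT p f) : Good p (ent P) := by
  induction P with
  | nil => constructor <;> simp [_root_.ent]
  | cons g L ih =>
    obtain ⟨a, b, c⟩ := g
    rw [_root_.ent]
    exact (ih fun f hf => h f (by simp [hf])).cons (h (a, b, c) (by simp))

lemma init_good {d : ℕ} (hr : Root p d) : Good p (fanList d) ∧ fanList d ≠ [] := by
  refine ⟨Good.ent ?_, by simp [fanList, ent]⟩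
  intro f hf
  simp only [List.mem_cons, List.mem_map, List.mem_range] at hf
  rcases hf with rfl | ⟨t, ht, rfl⟩
  · exact hr.last
  · exact hr.step (t + 1) (by omega) (by omega)

end

section
variable {p : ℕ → E3}

/-- swapping two labels -/
def sw (p : ℕ → E3) (a b : ℕ) : ℕ → E3 := fun i => p (Equiv.swap a b i)

lemma swap_lt {a b : ℕ} (ha : a < 8) (hb : b < 8) {i : ℕ} (hi : i < 8) : Equiv.swap a b i < 8 := by
  rw [Equiv.swap_apply_def]
  split_ifs <;> assumption

lemma sw_chi (a b i j k l : ℕ) : chi (sw p a b) i j k l =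
    chi p (Equiv.swap a b i) (Equiv.swap a b j) (Equiv.swap a b k) (Equiv.swap a b l) := rfl

lemma Fc_sw {a b : ℕ} (ha : a < 8) (hb : b < 8) {i j k : ℕ} (h : Fc p i j k) :
    Fc (sw p a b) (Equiv.swap a b i) (Equiv.swap a b j) (Equiv.swap a b k) := by
  refine ⟨swap_lt ha hb h.hi, swap_lt ha hb h.hj, swap_lt ha hb h.hk, ?_, ?_, ?_, ?_⟩
  · exact fun e => h.ij ((Equiv.swap a b).injective e)
  · exact fun e => h.ik ((Equiv.swap a b).injective e)
  · exact fun e => h.jk ((Equiv.swap a b).injective e)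
  · intro l hl h1 h2 h3
    rw [sw_chi]
    simp only [Equiv.swap_apply_self]
    refine h.neg _ (swap_lt ha hb hl) ?_ ?_ ?_
    · rintro rfl; exact h1 (Equiv.swap_apply_self _ _ _).symm
    · rintro rfl; exact h2 (Equiv.swap_apply_self _ _ _).symm
    · rintro rfl; exact h3 (Equiv.swap_apply_self _ _ _).symm

lemma sw_sw (a b : ℕ) : sw (sw p a b) a b = p := by
  funext i
  simp [sw]

lemma deg_sw_le {a b : ℕ} (ha : a < 8) (hb : b < 8) (u : ℕ) :
    deg p u ≤ deg (sw p a b) (Equiv.swap a b u) := by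
  classical
  rw [deg, deg]
  apply Finset.card_le_card_of_injOn (Equiv.swap a b)
  · intro x hx
    simp only [Finset.coe_filter, Finset.mem_range, Set.mem_ofPred_eq] at hx ⊢
    obtain ⟨h1, c, hc⟩ := hx
    exact ⟨swap_lt ha hb h1, _, Fc_sw ha hb hc⟩
  · exact (Equiv.swap a b).injective.injOn

lemma deg_sw {a b : ℕ} (ha : a < 8) (hb : b < 8) (u : ℕ) :
    deg (sw p a b) u = deg p (Equiv.swap a b u) := by
  apply le_antisymm
  · have := deg_sw_le (p := sw p a b) ha hb u
    rwa [sw_sw] at this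
  · have := deg_sw_le (p := p) ha hb (Equiv.swap a b u)
    rwa [Equiv.swap_apply_self] at this

lemma Gen.sw (hg : Gen p) {a b : ℕ} (ha : a < 8) (hb : b < 8) : Gen (sw p a b) := by
  refine ⟨fun i hi => hg.unit _ (swap_lt ha hb hi), ?_⟩
  intro i hi j hj k hk l hl h1 h2 h3 h4 h5 h6
  rw [sw_chi]
  have inj := (Equiv.swap a b).injective
  exact hg.ne _ (swap_lt ha hb hi) _ (swap_lt ha hb hj) _ (swap_lt ha hb hk) _ (swap_lt ha hb hl)
    (inj.ne h1) (inj.ne h2) (inj.ne h3) (inj.ne h4) (inj.ne h5) (inj.ne h6)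

/-- generic labellings of a fixed set, with vertex `0` of maximal degree -/
structure Lab (X : Set E3) (q : ℕ → E3) : Prop where
  gen : Gen q
  img : q '' Set.Iio 8 = X
  max : ∀ u < 8, deg q u ≤ deg q 0

lemma img_sw {a b : ℕ} (ha : a < 8) (hb : b < 8) : sw p a b '' Set.Iio 8 = p '' Set.Iio 8 := by
  ext x
  constructor
  · rintro ⟨i, hi, rfl⟩
    exact ⟨_, swap_lt ha hb hi, rfl⟩
  · rintro ⟨i, hi, rfl⟩
    exact ⟨_, swap_lt ha hb hi, by simp [sw]⟩

lemma Lab.sw {X : Set E3} {q : ℕ → E3} (h : Lab X q) {a b : ℕ} (ha : a < 8) (hb : b < 8)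
    (ha0 : a ≠ 0) (hb0 : b ≠ 0) : Lab X (sw q a b) := by
  refine ⟨h.gen.sw ha hb, by rw [img_sw ha hb, h.img], fun u hu => ?_⟩
  rw [deg_sw ha hb, deg_sw ha hb, Equiv.swap_apply_of_ne_of_ne ha0.symm hb0.symm]
  exact h.max _ (swap_lt ha hb hu)

lemma Lab.exists (hg : Gen p) : ∃ q, Lab (p '' Set.Iio 8) q := by
  obtain ⟨u, hu, hmax⟩ := Finset.exists_max_image (Finset.range 8) (deg p) ⟨0, by simp⟩
  have hu := Finset.mem_range.1 hu
  refine ⟨_root_.sw p 0 u, hg.sw (by norm_num) hu, img_sw (by norm_num) hu, fun v hv => ?_⟩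
  rw [deg_sw (by norm_num) hu, deg_sw (by norm_num) hu, Equiv.swap_apply_left]
  exact hmax _ (Finset.mem_range.2 (swap_lt (by norm_num) hu hv))

lemma label_step {X : Set E3} (n : ℕ) : ∀ (t : ℕ) (q : ℕ → E3), t + n = 8 → 1 ≤ t → t < 8 →
    Lab X q → (∃ k, Fc q 0 t k) → (∀ i, 1 ≤ i → i < t → Fc q 0 i (i + 1)) →
    ∃ d q, Lab X q ∧ Root q d ∧ 3 ≤ d ∧ d ≤ 7 := by
  induction n with
  | zero => intro t q h1 h2 h3; omega
  | succ n ih =>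
    intro t q h1 h2 h3 hL ⟨k, hk⟩ hs
    rcases Nat.lt_or_ge t k with hkt | hkt
    · have hk8 := hk.hk
      have e0 : Equiv.swap (t + 1) k 0 = 0 :=
        Equiv.swap_apply_of_ne_of_ne (by omega) hk.ik
      have hf : ∀ i, i < t + 1 → Equiv.swap (t + 1) k i = i := fun i hi =>
        Equiv.swap_apply_of_ne_of_ne (by omega) (by omega)
      have F := Fc_sw (a := t + 1) (b := k) (by omega) hk8 hk
      rw [Equiv.swap_apply_right, hf t (by omega), e0] at F
      have hL' := hL.sw (a := t + 1) (b := k) (by omega) hk8 (by omega) (by omega)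
      refine ih (t + 1) (sw q (t + 1) k) (by omega) (by omega) (by omega) hL' (F.next hL'.gen) ?_
      intro i hi hit
      rcases Nat.eq_or_lt_of_le (Nat.le_of_lt_succ hit) with h | h
      · subst h; exact F
      · have G := Fc_sw (a := t + 1) (b := k) (by omega) hk8 (hs i hi h)
        rwa [e0, hf i (by omega), hf (i + 1) (by omega)] at G
    · have hk0 := hk.ik
      rcases Nat.eq_or_lt_of_le (show 1 ≤ k by omega) with h | h
      · subst h
        refine ⟨t, q, hL, ⟨hs, hk⟩, ?_, by omega⟩
        by_contra hcon
        have : t = 1 ∨ t = 2 := by omega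
        rcases this with rfl | rfl
        · exact hk.jk rfl
        · exact hk.not_flip (hs 1 le_rfl (by norm_num))
      · exfalso
        have G := hs (k - 1) (by omega) (by omega)
        rw [Nat.sub_add_cancel (by omega)] at G
        have := hk.pred_uniq G
        omega

lemma exists_root (hg : Gen p) : ∃ d q, Lab (p '' Set.Iio 8) q ∧ Root q d ∧ 3 ≤ d ∧ d ≤ 7 := by
  obtain ⟨q, hq⟩ := Lab.exists hg
  obtain ⟨u, hu, x, hx, k, hF⟩ := conn hq.gen {0} (by simp) (by simp) (by decide)
  rw [Finset.mem_singleton] at hu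
  subst hu
  have hx8 := hF.hj
  have hx0 := hF.ij
  have F := Fc_sw (a := 1) (b := x) (by norm_num) hx8 hF
  rw [Equiv.swap_apply_right, Equiv.swap_apply_of_ne_of_ne (by norm_num) hx0] at F
  exact label_step 7 1 _ (by norm_num) le_rfl (by norm_num)
    (hq.sw (by norm_num) hx8 (by norm_num) hx0.symm) ⟨_, F⟩ (by intro i h1 h2; omega)

lemma Root.deg_le (hg : Gen p) {d : ℕ} (hr : Root p d) (hd : 1 ≤ d) : deg p 0 ≤ d := by
  classical
  have : (Finset.range 8).filter (fun b => ∃ c, Fc p 0 b c) ⊆ Finset.Icc 1 d := by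
    intro b hb
    obtain ⟨-, c, hc⟩ := Finset.mem_filter.1 hb
    refine link hg (Finset.Icc 1 d) ⟨1, by simp [hd]⟩ ?_ hc
    intro a ha
    rw [Finset.mem_Icc] at ha
    rcases Nat.eq_or_lt_of_le ha.2 with h | h
    · subst h
      exact ⟨1, by simp [hd], hr.last⟩
    · exact ⟨a + 1, by simp; omega, hr.step a ha.1 h⟩
  have := Finset.card_le_card this
  rw [deg]
  simpa using this

set_option maxRecDepth 1000000 in
theorem dfs3 : dfs 3 20 (fanList 3) = true := by decide +kernel
set_option maxRecDepth 1000000 in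
theorem dfs4 : dfs 4 20 (fanList 4) = true := by decide +kernel
set_option maxRecDepth 1000000 in
theorem dfs5 : dfs 5 20 (fanList 5) = true := by decide +kernel
set_option maxRecDepth 1000000 in
theorem dfs6 : dfs 6 20 (fanList 6) = true := by decide +kernel
set_option maxRecDepth 1000000 in
theorem dfs7 : dfs 7 20 (fanList 7) = true := by decide +kernel

theorem comb_main (hg : Gen p) :
    ∃ q, Gen q ∧ q '' Set.Iio 8 = p '' Set.Iio 8 ∧ sumD q ≤ 12 * gst := by
  obtain ⟨d, q, hq, hr, h3, h7⟩ := exists_root hg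
  refine ⟨q, hq.gen, hq.img, ?_⟩
  have hd : ∀ u < 8, deg q u ≤ d := fun u hu =>
    (hq.max u hu).trans (hr.deg_le hq.gen (by omega))
  obtain ⟨g1, g2⟩ := init_good hr
  refine dfs_sound hq.gen hr hd 20 _ g1 g2 ?_
  have : d = 3 ∨ d = 4 ∨ d = 5 ∨ d = 6 ∨ d = 7 := by omega
  rcases this with rfl | rfl | rfl | rfl | rfl
  · exact dfs3
  · exact dfs4
  · exact dfs5
  · exact dfs6
  · exact dfs7

end

lemma plane_null {E : Type*} [NormedAddCommGroup E] [NormedSpace ℝ E]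
    [MeasurableSpace E] [BorelSpace E] [FiniteDimensional ℝ E] (μ : Measure E)
    [μ.IsAddHaarMeasure] (f : E →ₗ[ℝ] ℝ) (hf : f ≠ 0) (c : ℝ) : μ {x | f x = c} = 0 := by
  by_cases h : ∃ x0, f x0 = c
  · obtain ⟨x0, hx0⟩ := h
    refine measure_mono_null ?_ (Measure.addHaar_affineSubspace μ
      (AffineSubspace.mk' x0 (LinearMap.ker f)) ?_)
    · intro x hx
      have hx : f x = c := hx
      rw [SetLike.mem_coe, AffineSubspace.mem_mk', LinearMap.mem_ker, vsub_eq_sub, map_sub, hx, hx0,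
        sub_self]
    · intro htop
      apply hf
      rw [← LinearMap.ker_eq_top]
      have := congrArg AffineSubspace.direction htop
      rwa [AffineSubspace.direction_mk', AffineSubspace.direction_top] at this
  · have : {x | f x = c} = ∅ := by
      ext x
      simp only [Set.mem_ofPred_eq, Set.mem_empty_iff_false, iff_false]
      exact fun hx => h ⟨x, hx⟩
    rw [this, measure_empty]

/-- strictly increasing vectors in the unit cube -/
def Os : Set (Fin 3 → ℝ) := {y | StrictMono y ∧ ∀ i, y i ∈ Set.Icc (0 : ℝ) 1}

lemma Os_meas : MeasurableSet Os := by
  have : Os = {y | y 0 < y 1} ∩ {y | y 1 < y 2} ∩ ⋂ i, {y | y i ∈ Set.Icc (0 : ℝ) 1} := by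
    ext y
    simp only [Os, Set.mem_ofPred_eq, Set.mem_inter_iff, Set.mem_iInter, Fin.strictMono_iff_lt_succ]
    simp [Fin.forall_fin_two]
  rw [this]
  refine ((measurableSet_lt (by fun_prop) (by fun_prop)).inter
    (measurableSet_lt (by fun_prop) (by fun_prop))).inter (MeasurableSet.iInter fun i => ?_)
  exact measurableSet_Icc.preimage (measurable_pi_apply i)

lemma Os_vol : volume Os ≤ ENNReal.ofReal (1 / 6) := by
  let A : Equiv.Perm (Fin 3) → Set (Fin 3 → ℝ) := fun σ => (fun y i => y (σ i)) ⁻¹' Os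
  have hmp : ∀ σ : Equiv.Perm (Fin 3), MeasurePreserving (fun (y : Fin 3 → ℝ) i => y (σ i)) := by
    intro σ
    have := (volume_measurePreserving_piCongrLeft (fun _ : Fin 3 => ℝ) σ.symm)
    have e : (fun (y : Fin 3 → ℝ) i => y (σ i)) =
        MeasurableEquiv.piCongrLeft (fun _ : Fin 3 => ℝ) σ.symm := by
     funext y i
     rw [MeasurableEquiv.coe_piCongrLeft]
     have := Equiv.piCongrLeft_apply_apply (fun _ : Fin 3 => ℝ) σ.symm y (σ i)
     rw [Equiv.symm_apply_apply] at this
     exact this.symm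
    rw [e]; exact this
  have hA : ∀ σ, volume (A σ) = volume Os := fun σ =>
    (hmp σ).measure_preimage Os_meas.nullMeasurableSet
  have hAm : ∀ σ, MeasurableSet (A σ) := fun σ => (hmp σ).measurable Os_meas
  have hdis : Pairwise (Function.onFun Disjoint A) := by
    intro σ τ hne
    rw [Function.onFun, Set.disjoint_left]
    intro y h1 h2
    apply hne
    have m1 : StrictMono (y ∘ σ) := h1.1
    have m2 : StrictMono (y ∘ τ) := h2.1
    have e : y ∘ σ = y ∘ τ := by
      rw [← m1.range_inj m2, Set.range_comp, Set.range_comp, σ.surjective.range_eq,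
        τ.surjective.range_eq]
    have hy : Function.Injective y := by
      have := m1.injective.comp σ.symm.injective
      rwa [Function.comp_assoc, Equiv.self_comp_symm, Function.comp_id] at this
    ext i
    exact congrArg Fin.val (hy (congrFun e i))
  have hsub : (⋃ σ, A σ) ⊆ Set.Icc (0 : Fin 3 → ℝ) 1 := by
    intro y hy
    rw [Set.mem_iUnion] at hy
    obtain ⟨σ, hy⟩ := hy
    have h2 : ∀ i, y (σ i) ∈ Set.Icc (0 : ℝ) 1 := hy.2
    constructor
    · intro i
      have := (h2 (σ.symm i)).1
      rwa [Equiv.apply_symm_apply] at this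
    · intro i
      have := (h2 (σ.symm i)).2
      rwa [Equiv.apply_symm_apply] at this
  have h1 := measure_mono (μ := volume) hsub
  rw [measure_iUnion hdis hAm, tsum_fintype, Finset.sum_congr rfl (fun σ _ => hA σ),
    Real.volume_Icc_pi] at h1
  simp [Fintype.card_perm, Nat.factorial] at h1
  rw [ENNReal.ofReal_div_of_pos (by norm_num), ENNReal.le_div_iff_mul_le (by simp) (by simp)]
  rw [mul_comm]
  simpa using h1

/-- increasing vectors in the unit cube -/
def Oc : Set (Fin 3 → ℝ) := {y | 0 ≤ y 0 ∧ y 0 ≤ y 1 ∧ y 1 ≤ y 2 ∧ y 2 ≤ 1}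

/-- difference of two coordinates -/
def dif (i j : Fin 3) : (Fin 3 → ℝ) →ₗ[ℝ] ℝ :=
  (LinearMap.proj i : (Fin 3 → ℝ) →ₗ[ℝ] ℝ) - (LinearMap.proj j : (Fin 3 → ℝ) →ₗ[ℝ] ℝ)

lemma Oc_vol : volume Oc ≤ ENNReal.ofReal (1 / 6) := by
  have hsub : Oc ⊆ Os ∪ ({y | dif 0 1 y = 0} ∪
      {y | dif 1 2 y = 0}) := by
    rintro y ⟨h0, h1, h2, h3⟩
    simp only [Set.mem_union, Set.mem_ofPred_eq, dif, LinearMap.sub_apply, LinearMap.proj_apply]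
    rcases h1.lt_or_eq with h1' | h1'
    · rcases h2.lt_or_eq with h2' | h2'
      · left
        refine ⟨Fin.strictMono_iff_lt_succ.2 ?_, ?_⟩
        · simp [Fin.forall_fin_two, h1', h2']
        · intro i
          fin_cases i <;> simp <;> constructor <;> linarith
      · right; right; linarith
    · right; left; linarith
  refine (measure_mono hsub).trans ((measure_union_le _ _).trans ?_)
  rw [measure_union_null (plane_null _ _ ?_ 0) (plane_null _ _ ?_ 0), add_zero]
  · exact Os_vol
  · intro h
    have := LinearMap.congr_fun h (Pi.single 0 1)
    simp [dif] at this
  · intro h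
    have := LinearMap.congr_fun h (Pi.single 1 1)
    simp [dif] at this

/-- solid tetrahedron -/
def tet (v a b c : E3) : Set E3 :=
  {x | ∃ r s t : ℝ, 0 ≤ r ∧ 0 ≤ s ∧ 0 ≤ t ∧ r + s + t ≤ 1 ∧ x = v + (r • a + s • b + t • c)}

lemma tet_vol (v a b c : E3) : volume (tet v a b c) ≤ ENNReal.ofReal (|det3 a b c| / 6) := by
  let M : Matrix (Fin 3) (Fin 3) ℝ := !![a 0 - b 0, b 0 - c 0, c 0; a 1 - b 1, b 1 - c 1, c 1;
    a 2 - b 2, b 2 - c 2, c 2]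
  have hdet : M.det = det3 a b c := by
    simp only [M, Matrix.det_fin_three, det3]
    simp
    ring
  have hsub : tet v a b c ⊆ (WithLp.ofLp) ⁻¹' ((fun y => v.ofLp + y) '' (Matrix.toLin' M '' Oc)) := by
    rintro x ⟨r, s, t, hr, hs, ht, h1, rfl⟩
    refine ⟨_, ⟨![r, r + s, r + s + t], ?_, rfl⟩, ?_⟩
    · simp only [Oc, Set.mem_ofPred_eq]
      simp
      exact ⟨hr, hs, ht, h1⟩
    · funext i
      fin_cases i <;> simp [M] <;> ring
  have hcl : MeasurableSet ((fun y => v.ofLp + y) '' (Matrix.toLin' M '' Oc)) := by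
    have hO : IsCompact Oc := by
      have hc : IsClosed Oc := by
        have : Oc = {y : Fin 3 → ℝ | 0 ≤ y 0} ∩ ({y | y 0 ≤ y 1} ∩ ({y | y 1 ≤ y 2} ∩ {y | y 2 ≤ 1})) := by
          ext y; rfl
        rw [this]
        exact (isClosed_le (by fun_prop) (by fun_prop)).inter
          ((isClosed_le (by fun_prop) (by fun_prop)).inter
          ((isClosed_le (by fun_prop) (by fun_prop)).inter
          (isClosed_le (by fun_prop) (by fun_prop))))
      refine IsCompact.of_isClosed_subset (isCompact_Icc (a := (0 : Fin 3 → ℝ)) (b := 1)) hc ?_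
      rintro y ⟨h0, h1, h2, h3⟩
      constructor <;> intro i <;> fin_cases i <;> simp <;> linarith
    have h2 : IsCompact (Matrix.toLin' M '' Oc) :=
      hO.image (LinearMap.continuous_of_finiteDimensional _)
    exact (h2.image (by fun_prop)).isClosed.measurableSet
  refine (measure_mono hsub).trans ?_
  rw [(PiLp.volume_preserving_ofLp (Fin 3)).measure_preimage hcl.nullMeasurableSet]
  rw [Set.image_add_left, measure_preimage_add, Measure.addHaar_image_linearMap, LinearMap.det_toLin', hdet]
  refine (mul_le_mul_right Oc_vol _).trans ?_
  rw [← ENNReal.ofReal_mul (abs_nonneg _)]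
  apply ENNReal.ofReal_le_ofReal
  linarith

section
variable {p : ℕ → E3}

lemma facets_rot {e : Tri} (h : e ∈ facets p) : ((e.2.1, e.2.2, e.1) : Tri) ∈ facets p :=
  mem_facets.2 (Fc.cyc (mem_facets.1 h))

lemma sum_rot (h : Tri → ℝ) :
    ∑ e ∈ facets p, h (e.2.1, e.2.2, e.1) = ∑ e ∈ facets p, h e := by
  refine Finset.sum_nbij' (fun e => (e.2.1, e.2.2, e.1)) (fun e => (e.2.2, e.1, e.2.1))
    (fun e he => facets_rot he) (fun e he => facets_rot (facets_rot he)) ?_ ?_ ?_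
  · intro e _; rfl
  · intro e _; rfl
  · intro e _; rfl

lemma sum_anti (hg : Gen p) (g : ℕ → ℕ → ℝ) (hanti : ∀ i j, g i j = - g j i) :
    ∑ e ∈ facets p, g e.1 e.2.1 = 0 := by
  have ho : ∀ e ∈ facets p, ∃ l, Fc p e.2.1 e.1 l := fun e he => Fc.opp hg (mem_facets.1 he)
  choose o ho using ho
  refine Finset.sum_involution (fun e he => (e.2.1, e.1, o e he)) ?_ ?_ ?_ ?_
  · intro e he
    simp only
    rw [hanti]; ring
  · intro e he _ heq
    have := congrArg Prod.fst heq
    exact (mem_facets.1 he).ij this.symm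
  · intro e he
    exact mem_facets.2 (ho e he)
  · intro e he
    obtain ⟨i, j, k⟩ := e
    have h1 : Fc p i j k := mem_facets.1 he
    simp only [Prod.mk.injEq, true_and]
    exact Fc.uniq (ho (j, i, o (i, j, k) he) (mem_facets.2 (ho (i, j, k) he))) h1

lemma sum_chi (hg : Gen p) (v : ℕ) :
    ∑ e ∈ facets p, - chi p e.1 e.2.1 e.2.2 v = sumD p := by
  let g : ℕ → ℕ → ℝ := fun i j => det3 (p v) (p i) (p j)
  have hanti : ∀ i j, g i j = - g j i := by
    intro i j; simp only [g, det3]; ring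
  have h0 := sum_anti hg g hanti
  have h1 : ∑ e ∈ facets p, g e.2.1 e.2.2 = 0 := by
    rw [← h0]; exact sum_rot (fun e => g e.1 e.2.1)
  have h2 : ∑ e ∈ facets p, g e.2.2 e.1 = 0 := by
    rw [← h1]; exact sum_rot (fun e => g e.2.1 e.2.2)
  have : ∀ e : Tri, - chi p e.1 e.2.1 e.2.2 v =
      dP p e - (g e.1 e.2.1 + g e.2.1 e.2.2 + g e.2.2 e.1) := by
    intro e
    simp only [chi, dP, g, det3, PiLp.sub_apply]; ring
  simp only [this]
  rw [Finset.sum_sub_distrib, Finset.sum_add_distrib, Finset.sum_add_distrib, h0, h1, h2, sumD]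
  ring

open Classical in
/-- facets with smallest label first -/
noncomputable def reps (p : ℕ → E3) : Finset Tri :=
  (facets p).filter fun e => e.1 < e.2.1 ∧ e.1 < e.2.2

lemma sum_reps (h : Tri → ℝ) (hrot : ∀ i j k, h (j, k, i) = h (i, j, k)) :
    ∑ e ∈ facets p, h e = 3 * ∑ e ∈ reps p, h e := by
  classical
  let m : Tri → ℝ := fun e => if e.1 < e.2.1 ∧ e.1 < e.2.2 then h e else 0
  have h1 : ∀ e ∈ facets p, h e = m e + m (e.2.1, e.2.2, e.1) + m (e.2.2, e.1, e.2.1) := by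
    rintro ⟨i, j, k⟩ he
    have hF : Fc p i j k := mem_facets.1 he
    have a1 := hF.ij
    have a2 := hF.ik
    have a3 := hF.jk
    simp only [m]
    rw [hrot i j k, hrot j k i, hrot i j k]
    rcases lt_trichotomy i j with h1 | h1 | h1
    · rcases lt_trichotomy i k with h2 | h2 | h2
      · rw [if_pos ⟨h1, h2⟩, if_neg (by omega), if_neg (by omega)]; ring
      · exact absurd h2 a2
      · rw [if_neg (by omega), if_neg (by omega), if_pos (by omega)]; ring
    · exact absurd h1 a1
    · rcases lt_trichotomy j k with h2 | h2 | h2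
      · rw [if_neg (by omega), if_pos (by omega), if_neg (by omega)]; ring
      · exact absurd h2 a3
      · rw [if_neg (by omega), if_neg (by omega), if_pos (by omega)]; ring
  rw [Finset.sum_congr rfl h1, Finset.sum_add_distrib, Finset.sum_add_distrib, sum_rot m]
  have h2 : ∑ e ∈ facets p, m (e.2.2, e.1, e.2.1) = ∑ e ∈ facets p, m e := by
    rw [← sum_rot m, ← sum_rot (fun e => m (e.2.1, e.2.2, e.1))]
  rw [h2, reps, Finset.sum_filter]
  ring

lemma cramer (a b c d : E3) :
    det3 a b c • d = det3 d b c • a + det3 a d c • b + det3 a b d • c := by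
  ext i
  fin_cases i <;> simp [det3] <;> ring

lemma hull_rep {y : E3} (hy : y ∈ convexHull ℝ (p '' Set.Iio 8)) :
    ∃ w : ℕ → ℝ, (∀ i, 0 ≤ w i) ∧ ∑ i ∈ Finset.range 8, w i = 1 ∧
      y = ∑ i ∈ Finset.range 8, w i • p i := by
  let W : Set E3 := {y | ∃ w : ℕ → ℝ, (∀ i, 0 ≤ w i) ∧ ∑ i ∈ Finset.range 8, w i = 1 ∧
      y = ∑ i ∈ Finset.range 8, w i • p i}
  have hsub : convexHull ℝ (p '' Set.Iio 8) ⊆ W := by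
    apply convexHull_min
    · rintro _ ⟨i, hi, rfl⟩
      have hi : i < 8 := hi
      refine ⟨fun j => if j = i then 1 else 0, fun j => by dsimp only; split_ifs <;> norm_num, ?_, ?_⟩
      · simp [hi]
      · simp [hi]
    · rintro _ ⟨w, h1, h2, rfl⟩ _ ⟨w', h1', h2', rfl⟩ a b ha hb hab
      refine ⟨fun i => a * w i + b * w' i, fun i => ?_, ?_, ?_⟩
      · have := h1 i; have := h1' i; positivity
      · rw [Finset.sum_add_distrib, ← Finset.mul_sum, ← Finset.mul_sum, h2, h2']; linarith
      · simp only [add_smul, mul_smul, Finset.sum_add_distrib, Finset.smul_sum]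
  exact hsub hy

/-- the tetrahedron over a facet with apex `p 0` -/
def TT (p : ℕ → E3) (e : Tri) : Set E3 := tet (p 0) (p e.1 - p 0) (p e.2.1 - p 0) (p e.2.2 - p 0)

lemma TT_rot {i j k : ℕ} {x : E3} (h : x ∈ TT p (i, j, k)) : x ∈ TT p (j, k, i) := by
  obtain ⟨r, s, t, h1, h2, h3, h4, h5⟩ := h
  refine ⟨s, t, r, h2, h3, h1, by linarith, ?_⟩
  rw [h5]; simp only; abel

lemma TT_flip {i j k : ℕ} {x : E3} (h : x ∈ TT p (i, j, k)) : x ∈ TT p (i, k, j) := by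
  obtain ⟨r, s, t, h1, h2, h3, h4, h5⟩ := h
  refine ⟨r, t, s, h1, h3, h2, by linarith, ?_⟩
  rw [h5]; simp only; abel

/-- a face of the hull seen from `p 0` -/
lemma face_case (hg : Gen p) (f : StrongDual ℝ E3) (hf : f ≠ 0) {M : ℝ}
    (hM : ∀ i < 8, f (p i) ≤ M) {i j k : ℕ} (hi : i < 8) (hj : j < 8) (hk : k < 8)
    (hij : i ≠ j) (hik : i ≠ k) (hjk : j ≠ k) (fi : f (p i) = M) (fj : f (p j) = M)
    (fk : f (p k) = M) : (Fc p i j k ∨ Fc p i k j) ∧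
      ∀ l < 8, l ≠ i → l ≠ j → l ≠ k → f (p l) < M := by
  have hlt : ∀ l < 8, l ≠ i → l ≠ j → l ≠ k → f (p l) < M := by
    intro l hl h1 h2 h3
    refine lt_of_le_of_ne (hM l hl) fun fl => ?_
    apply hg.ne i hi j hj k hk l hl hij hik h1.symm hjk h2.symm h3.symm
    by_contra hne
    apply hf
    ext d
    have := congrArg f (cramer (p j - p i) (p k - p i) (p l - p i) d)
    simp only [map_add, map_smul, map_sub, fi, fj, fk, fl, sub_self, mul_zero, add_zero,
      smul_eq_mul, mul_eq_zero] at this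
    rcases this with h | h
    · exact absurd h hne
    · simpa using h
  refine ⟨?_, hlt⟩
  have key : ∀ l < 8, l ≠ i → l ≠ j → l ≠ k → ∀ m < 8, m ≠ i → m ≠ j → m ≠ k →
      0 < chi p i j k l * chi p i j k m := by
    intro l hl h1 h2 h3 m hm g1 g2 g3
    have := congrArg f (cramer (p j - p i) (p k - p i) (p l - p i) (p m - p i))
    simp only [map_add, map_smul, map_sub, fi, fj, fk, sub_self, mul_zero, zero_add,
      smul_eq_mul] at this
    have e : chi p i j k l * (f (p m) - M) = chi p i j k m * (f (p l) - M) := this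
    have n1 := hg.ne i hi j hj k hk l hl hij hik h1.symm hjk h2.symm h3.symm
    have a1 := hlt l hl h1 h2 h3
    have a2 := hlt m hm g1 g2 g3
    by_contra hcon
    push Not at hcon
    have n2 : 0 < chi p i j k l ^ 2 := by positivity
    have e2 : chi p i j k l ^ 2 * (M - f (p m)) = chi p i j k l * chi p i j k m * (M - f (p l)) := by
      linear_combination (-chi p i j k l) * e
    have : 0 < chi p i j k l ^ 2 * (M - f (p m)) := mul_pos n2 (by linarith)
    have : chi p i j k l * chi p i j k m * (M - f (p l)) ≤ 0 :=
      mul_nonpos_of_nonpos_of_nonneg hcon (by linarith)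
    linarith
  obtain ⟨l, hl, h1, h2, h3⟩ := exists_other i j k
  have n1 := hg.ne i hi j hj k hk l hl hij hik h1.symm hjk h2.symm h3.symm
  rcases lt_or_gt_of_ne n1 with h | h
  · left
    refine ⟨hi, hj, hk, hij, hik, hjk, fun m hm g1 g2 g3 => ?_⟩
    have := key l hl h1 h2 h3 m hm g1 g2 g3
    nlinarith
  · right
    refine ⟨hi, hk, hj, hik, hij, hjk.symm, fun m hm g1 g2 g3 => ?_⟩
    have := key l hl h1 h2 h3 m hm g1 g3 g2
    rw [chi_s2]
    nlinarith

end

section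
variable {p : ℕ → E3}

lemma det3_self_comb (a b : E3) (r s : ℝ) : det3 a b (r • a + s • b) = 0 := by
  simp [det3]; ring

/-- last point on a ray inside a compact convex body, with a supporting functional -/
lemma ray_support {K : Set E3} (hK : IsCompact K) (hc : Convex ℝ K) (hnei : (interior K).Nonempty)
    {v x : E3} (hx : x ∈ K) (hxv : x ≠ v) :
    ∃ s : ℝ, 0 ≤ s ∧ s ≤ 1 ∧ ∃ y ∈ K, x - v = s • (y - v) ∧
      ∃ f : StrongDual ℝ E3, f ≠ 0 ∧ ∀ a ∈ K, f a ≤ f y := by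
  let φ : ℝ → E3 := fun t => v + t • (x - v)
  have hw : x - v ≠ 0 := sub_ne_zero.2 hxv
  have hφc : Continuous φ := by fun_prop
  have hbd : Bornology.IsBounded (φ ⁻¹' K) := by
    obtain ⟨R, hR⟩ := hK.isBounded.exists_norm_le
    rw [isBounded_iff_forall_norm_le]
    refine ⟨(R + ‖v‖) / ‖x - v‖, fun t ht => ?_⟩
    have h1 : ‖v + t • (x - v)‖ ≤ R := hR _ ht
    rw [le_div_iff₀ (norm_pos_iff.2 hw), ← norm_smul]
    have h2 : t • (x - v) = (v + t • (x - v)) - v := by abel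
    rw [h2]
    exact (norm_sub_le _ _).trans (by linarith)
  have hcomp : IsCompact (φ ⁻¹' K) :=
    Metric.isCompact_of_isClosed_isBounded (hK.isClosed.preimage hφc) hbd
  have h1 : (1 : ℝ) ∈ φ ⁻¹' K := by
    change v + (1 : ℝ) • (x - v) ∈ K
    rw [one_smul, add_sub_cancel]; exact hx
  obtain ⟨t, ht, hmax⟩ := hcomp.exists_isMaxOn ⟨1, h1⟩ continuous_id.continuousOn
  have ht1 : 1 ≤ t := hmax h1
  have hni : φ t ∉ interior K := by
    intro hin
    have hopen : IsOpen (φ ⁻¹' interior K) := isOpen_interior.preimage hφc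
    obtain ⟨ε, hε, hball⟩ := Metric.isOpen_iff.1 hopen t hin
    have hmem : t + ε / 2 ∈ Metric.ball t ε := by
      rw [Metric.mem_ball, Real.dist_eq]
      rw [show t + ε / 2 - t = ε / 2 by ring, abs_of_pos (by positivity)]; linarith
    have : t + ε / 2 ≤ t := hmax (interior_subset (s := K) (hball hmem))
    linarith
  obtain ⟨f, hf⟩ := geometric_hahn_banach_open_point hc.interior isOpen_interior hni
  refine ⟨1 / t, by positivity, by rw [div_le_one (by linarith)]; exact ht1, φ t, ht, ?_, f, ?_, ?_⟩
  · simp only [φ]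
    rw [add_sub_cancel_left, smul_smul, one_div, inv_mul_cancel₀ (by linarith), one_smul]
  · rintro rfl
    obtain ⟨a, ha⟩ := hnei
    simpa using hf a ha
  · intro a ha
    have hcl : a ∈ closure (interior K) := by
      rw [hc.closure_interior_eq_closure_of_nonempty_interior hnei]
      exact subset_closure ha
    have hclosed : IsClosed {a | f a ≤ f (φ t)} := isClosed_le f.continuous continuous_const
    exact closure_minimal (fun b hb => (hf b hb).le) hclosed hcl

lemma hull_compact : IsCompact (convexHull ℝ (p '' Set.Iio 8)) :=
  ((Set.finite_Iio 8).image p).isCompact_convexHull ℝ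

/-- generic points of the hull are covered by tetrahedra over facets -/
lemma cover (hg : Gen p) (hnei : (interior (convexHull ℝ (p '' Set.Iio 8))).Nonempty) {x : E3}
    (hx : x ∈ convexHull ℝ (p '' Set.Iio 8)) :
    (∃ e ∈ facets p, x ∈ TT p e) ∨ ∃ i ∈ Finset.Icc 1 7, ∃ j ∈ Finset.Icc 1 7, i ≠ j ∧
      det3 (p i - p 0) (p j - p 0) (x - p 0) = 0 := by
  classical
  by_cases hxv : x = p 0
  · right
    refine ⟨1, by simp, 2, by simp, by norm_num, ?_⟩
    rw [hxv]; simp [det3]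
  obtain ⟨s, hs0, hs1, y, hy, hxy, f, hf, hmax⟩ :=
    ray_support hull_compact (convex_convexHull ℝ _) hnei hx hxv
  obtain ⟨w, hw0, hw1, hyw⟩ := hull_rep hy
  have hM : ∀ i < 8, f (p i) ≤ f y := fun i hi =>
    hmax _ (subset_convexHull ℝ _ ⟨i, hi, rfl⟩)
  have hz : ∀ i < 8, f (p i) ≠ f y → w i = 0 := by
    have h0 : ∑ i ∈ Finset.range 8, w i * (f y - f (p i)) = 0 := by
      simp only [mul_sub, Finset.sum_sub_distrib]
      rw [← Finset.sum_mul, hw1, one_mul]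
      nth_rewrite 1 [hyw]
      rw [map_sum]
      simp
    rw [Finset.sum_eq_zero_iff_of_nonneg (fun i hi => mul_nonneg (hw0 i)
      (sub_nonneg.2 (hM i (Finset.mem_range.1 hi))))] at h0
    intro i hi hne
    rcases mul_eq_zero.1 (h0 i (Finset.mem_range.2 hi)) with h | h
    · exact h
    · exact absurd (sub_eq_zero.1 h).symm hne
  let Z := (Finset.range 8).filter fun i => i ≠ 0 ∧ f (p i) = f y
  have hyZ : y - p 0 = ∑ i ∈ Z, w i • (p i - p 0) := by
    have h1 : y - p 0 = ∑ i ∈ Finset.range 8, w i • (p i - p 0) := by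
      simp only [smul_sub, Finset.sum_sub_distrib]
      rw [← Finset.sum_smul, hw1, one_smul, ← hyw]
    rw [h1]
    symm
    apply Finset.sum_subset (Finset.filter_subset _ _)
    intro i hi hiZ
    by_cases h0 : i = 0
    · subst h0; simp
    · have : f (p i) ≠ f y := fun h => hiZ (Finset.mem_filter.2 ⟨hi, h0, h⟩)
      rw [hz i (Finset.mem_range.1 hi) this, zero_smul]
  rcases Nat.lt_or_ge 2 Z.card with hZ | hZ
  · left
    obtain ⟨i, hi, j, hj, k, hk, hij, hik, hjk⟩ := Finset.two_lt_card.1 hZ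
    obtain ⟨hi8, hi0, fi⟩ := Finset.mem_filter.1 hi
    obtain ⟨hj8, hj0, fj⟩ := Finset.mem_filter.1 hj
    obtain ⟨hk8, hk0, fk⟩ := Finset.mem_filter.1 hk
    rw [Finset.mem_range] at hi8 hj8 hk8
    obtain ⟨hF, hlt⟩ := face_case hg f hf hM hi8 hj8 hk8 hij hik hjk fi fj fk
    have hZ3 : Z = {i, j, k} := by
      ext l
      simp only [Finset.mem_insert, Finset.mem_singleton]
      constructor
      · intro hl
        obtain ⟨hl8, hl0, fl⟩ := Finset.mem_filter.1 hl
        by_contra hcon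
        push Not at hcon
        have := hlt l (Finset.mem_range.1 hl8) hcon.1 hcon.2.1 hcon.2.2
        linarith
      · rintro (rfl | rfl | rfl) <;> assumption
    have hsum : ∑ l ∈ Z, w l ≤ 1 := by
      rw [← hw1]
      exact Finset.sum_le_sum_of_subset_of_nonneg (Finset.filter_subset _ _) (fun l _ _ => hw0 l)
    rw [hZ3, Finset.sum_insert (by simp [hij, hik]), Finset.sum_pair hjk] at hsum hyZ
    have hmem : x ∈ TT p (i, j, k) := by
      refine ⟨s * w i, s * w j, s * w k, mul_nonneg hs0 (hw0 i), mul_nonneg hs0 (hw0 j),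
        mul_nonneg hs0 (hw0 k), ?_, ?_⟩
      · have := hw0 i
        have := hw0 j
        have := hw0 k
        nlinarith
      · simp only
        rw [mul_smul, mul_smul, mul_smul, ← smul_add, ← smul_add, add_assoc, ← hyZ, ← hxy]
        abel
    rcases hF with hF | hF
    · exact ⟨(i, j, k), mem_facets.2 hF, hmem⟩
    · exact ⟨(i, k, j), mem_facets.2 hF, TT_flip hmem⟩
  · right
    have hZs : Z ⊆ Finset.Icc 1 7 := by
      intro i hi
      obtain ⟨hi8, hi0, -⟩ := Finset.mem_filter.1 hi
      rw [Finset.mem_range] at hi8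
      rw [Finset.mem_Icc]; omega
    obtain ⟨Y, hZY, hY, hYc⟩ := Finset.exists_subsuperset_card_eq hZs hZ (by simp)
    obtain ⟨i, j, hij, rfl⟩ := Finset.card_eq_two.1 hYc
    refine ⟨i, hY (by simp), j, hY (by simp), hij, ?_⟩
    have : ∑ l ∈ Z, w l • (p l - p 0) =
        (if i ∈ Z then w i else 0) • (p i - p 0) + (if j ∈ Z then w j else 0) • (p j - p 0) := by
      rw [← Finset.sum_pair (f := fun l => (if l ∈ Z then w l else 0) • (p l - p 0)) hij]
      rw [← Finset.sum_subset hZY]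
      · apply Finset.sum_congr rfl
        intro l hl
        rw [if_pos hl]
      · intro l _ hl
        rw [if_neg hl, zero_smul]
    rw [hxy, hyZ, this, smul_add, smul_smul, smul_smul, det3_self_comb]

/-- the linear functional `x ↦ det3 a b x` -/
noncomputable def detL (a b : E3) : E3 →ₗ[ℝ] ℝ where
  toFun x := det3 a b x
  map_add' x y := by simp [det3]; ring
  map_smul' r x := by simp [det3]; ring

lemma cover_null (hg : Gen p) : volume {x : E3 | ∃ i ∈ Finset.Icc 1 7, ∃ j ∈ Finset.Icc 1 7, i ≠ j ∧
      det3 (p i - p 0) (p j - p 0) (x - p 0) = 0} = 0 := by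
  have hsub : {x : E3 | ∃ i ∈ Finset.Icc 1 7, ∃ j ∈ Finset.Icc 1 7, i ≠ j ∧
      det3 (p i - p 0) (p j - p 0) (x - p 0) = 0} ⊆
      ⋃ i ∈ Finset.Icc 1 7, ⋃ j ∈ Finset.Icc 1 7, {x : E3 | i ≠ j ∧
      det3 (p i - p 0) (p j - p 0) (x - p 0) = 0} := by
    rintro x ⟨i, hi, j, hj, h⟩
    simp only [Set.mem_iUnion]
    exact ⟨i, hi, j, hj, h⟩
  refine measure_mono_null hsub ?_
  simp only [measure_iUnion_null_iff]
  intro i hi j hj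
  have hi : i ∈ Finset.Icc 1 7 := hi
  have hj : j ∈ Finset.Icc 1 7 := hj
  rw [Finset.mem_Icc] at hi hj
  by_cases hij : i = j
  · have : {x : E3 | i ≠ j ∧ det3 (p i - p 0) (p j - p 0) (x - p 0) = 0} = ∅ := by
      ext x; simp [hij]
    rw [this, measure_empty]
  · obtain ⟨k, hk, k1, k2, k3⟩ := exists_other 0 i j
    refine measure_mono_null ?_ (plane_null volume (detL (p i - p 0) (p j - p 0)) ?_
      (detL (p i - p 0) (p j - p 0) (p 0)))
    · rintro x ⟨-, hx⟩
      have : detL (p i - p 0) (p j - p 0) (x - p 0) = 0 := hx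
      rw [map_sub] at this
      exact sub_eq_zero.1 this
    · intro h0
      have := LinearMap.congr_fun h0 (p k - p 0)
      exact hg.ne 0 (by norm_num) i (by omega) j (by omega) k hk (by omega) (by omega) k1.symm hij
        k2.symm k3.symm this

lemma rep_of {e : Tri} (he : e ∈ facets p) {x : E3} (hx : x ∈ TT p e) :
    ∃ e' ∈ reps p, x ∈ TT p e' := by
  obtain ⟨i, j, k⟩ := e
  have hF : Fc p i j k := mem_facets.1 he
  have a1 := hF.ij
  have a2 := hF.ik
  have a3 := hF.jk
  have : (i < j ∧ i < k) ∨ (j < k ∧ j < i) ∨ (k < i ∧ k < j) := by omega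
  rcases this with h | h | h
  · exact ⟨_, Finset.mem_filter.2 ⟨he, h⟩, hx⟩
  · exact ⟨(j, k, i), Finset.mem_filter.2 ⟨facets_rot he, h⟩, TT_rot hx⟩
  · exact ⟨(k, i, j), Finset.mem_filter.2 ⟨facets_rot (facets_rot he), h⟩, TT_rot (TT_rot hx)⟩

lemma facet_chi_nonpos {e : Tri} (he : e ∈ facets p) {v : ℕ} (hv : v < 8) :
    chi p e.1 e.2.1 e.2.2 v ≤ 0 := by
  have hF : Fc p e.1 e.2.1 e.2.2 := mem_facets.1 he
  by_cases h1 : v = e.1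
  · apply le_of_eq; rw [h1]; simp [chi, det3]
  by_cases h2 : v = e.2.1
  · apply le_of_eq; rw [h2]; simp only [chi, det3]; ring
  by_cases h3 : v = e.2.2
  · apply le_of_eq; rw [h3]; simp only [chi, det3]; ring
  exact (hF.neg v hv h1 h2 h3).le

theorem vol_le (hg : Gen p) :
    volume (convexHull ℝ (p '' Set.Iio 8)) ≤ ENNReal.ofReal (sumD p / 18) := by
  by_cases hnei : (interior (convexHull ℝ (p '' Set.Iio 8))).Nonempty
  · have hsub : convexHull ℝ (p '' Set.Iio 8) ⊆ (⋃ e ∈ reps p, TT p e) ∪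
        {x : E3 | ∃ i ∈ Finset.Icc 1 7, ∃ j ∈ Finset.Icc 1 7, i ≠ j ∧
          det3 (p i - p 0) (p j - p 0) (x - p 0) = 0} := by
      intro x hx
      rcases cover hg hnei hx with ⟨e, he, h⟩ | h
      · left
        obtain ⟨e', he', h'⟩ := rep_of he h
        simp only [Set.mem_iUnion]
        exact ⟨e', he', h'⟩
      · right; exact h
    refine (measure_mono hsub).trans ((measure_union_le _ _).trans ?_)
    rw [cover_null hg, add_zero]
    refine (measure_biUnion_finset_le _ _).trans ?_
    have h1 : ∀ e ∈ reps p, volume (TT p e) ≤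
        ENNReal.ofReal (- chi p e.1 e.2.1 e.2.2 0 / 6) := by
      intro e he
      refine (tet_vol _ _ _ _).trans (ENNReal.ofReal_le_ofReal (le_of_eq ?_))
      have hn := facet_chi_nonpos (Finset.mem_filter.1 he).1 (v := 0) (by norm_num)
      have : det3 (p e.1 - p 0) (p e.2.1 - p 0) (p e.2.2 - p 0) = - chi p e.1 e.2.1 e.2.2 0 := by
        simp only [chi, det3, PiLp.sub_apply]; ring
      rw [this, abs_of_nonneg (by linarith)]
    refine (Finset.sum_le_sum h1).trans ?_
    rw [← ENNReal.ofReal_sum_of_nonneg]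
    · apply ENNReal.ofReal_le_ofReal
      rw [← sum_chi hg 0, sum_reps (fun e => - chi p e.1 e.2.1 e.2.2 0), ← Finset.sum_div]
      · apply le_of_eq; ring
      · intro i j k
        simp only
        rw [chi_s2, chi_s1, neg_neg]
    · intro e he
      have hn := facet_chi_nonpos (Finset.mem_filter.1 he).1 (v := 0) (by norm_num)
      apply div_nonneg <;> linarith
  · have h0 : volume (convexHull ℝ (p '' Set.Iio 8)) = 0 := by
      rw [Set.not_nonempty_iff_eq_empty] at hnei
      refine measure_mono_null ?_ ((convex_convexHull ℝ (p '' Set.Iio 8)).addHaar_frontier volume)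
      rw [frontier, hnei, Set.sdiff_empty]
      exact subset_closure
    rw [h0]; exact zero_le

end

lemma dt_eq_norm (x : E3) : dt x x = ‖x‖ ^ 2 := by
  rw [EuclideanSpace.norm_sq_eq, Fin.sum_univ_three]
  simp only [dt, Real.norm_eq_abs, sq_abs]; ring

lemma dt_self_eq_zero {x : E3} (h : dt x x = 0) : x = 0 := by
  rw [dt_eq_norm] at h
  exact norm_eq_zero.1 (pow_eq_zero_iff (by norm_num) |>.1 h)

lemma unit_iff (x : E3) : dt x x = 1 ↔ ‖x‖ = 1 := by
  rw [dt_eq_norm]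
  constructor
  · intro h
    have := norm_nonneg x
    nlinarith
  · intro h; rw [h]; norm_num

lemma exists_perp {x : E3} (hx : dt x x = 1) : ∃ u : E3, dt x u = 0 ∧ u ≠ 0 := by
  by_cases h : (!₂[x 1, - x 0, 0] : E3) = 0
  · refine ⟨!₂[0, x 2, - x 1], ?_, ?_⟩
    · simp [dt]; ring
    · intro h'
      have h0 := congrFun (congrArg WithLp.ofLp h) 0
      have h1 := congrFun (congrArg WithLp.ofLp h) 1
      have h2 := congrFun (congrArg WithLp.ofLp h') 1
      simp at h0 h1 h2
      simp [dt, h0, h1, h2] at hx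
  · refine ⟨_, ?_, h⟩
    simp [dt]; ring

lemma plane_avoid {n x : E3} (hn : n ≠ 0) (c : ℝ) (hx : dt x x = 1) {O : Set E3} (hO : IsOpen O)
    (hxO : x ∈ O) : ∃ y ∈ O, dt y y = 1 ∧ dt n y ≠ c := by
  by_cases hc : dt n x = c
  swap
  · exact ⟨x, hxO, hx, hc⟩
  obtain ⟨u, hxu, hu0, hu⟩ : ∃ u : E3, dt x u = 0 ∧ u ≠ 0 ∧ (dt n u ≠ 0 ∨ c ≠ 0) := by
    by_cases h0 : n - (dt n x) • x = 0
    · obtain ⟨u, h1, h2⟩ := exists_perp hx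
      refine ⟨u, h1, h2, Or.inr ?_⟩
      intro hc0
      rw [hc, hc0, zero_smul, sub_zero] at h0
      exact hn h0
    · refine ⟨_, ?_, h0, Or.inl ?_⟩
      · rw [dt_sub_right, dt_smul_right, hx, dt_comm x n]; ring
      · intro h
        apply h0
        apply dt_self_eq_zero
        rw [dt_sub_left, h, dt_smul_left, dt_sub_right, dt_smul_right, hx, dt_comm x n]; ring
  have hU : 0 < dt u u := lt_of_le_of_ne (dt_nn u) (fun h => hu0 (dt_self_eq_zero h.symm))
  set U := dt u u with hUd
  have hpos : ∀ s : ℝ, 0 < 1 + s ^ 2 * U := fun s => by positivity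
  let y : ℝ → E3 := fun s => ((1 - s ^ 2 * U) / (1 + s ^ 2 * U)) • x + (2 * s / (1 + s ^ 2 * U)) • u
  have hy : Continuous y := by
    have h1 : ∀ s : ℝ, 1 + s ^ 2 * U ≠ 0 := fun s => (hpos s).ne'
    apply Continuous.add
    · exact (Continuous.div (by fun_prop) (by fun_prop) h1).smul continuous_const
    · exact (Continuous.div (by fun_prop) (by fun_prop) h1).smul continuous_const
  have hy0 : y 0 = x := by simp [y]
  have hyu : ∀ s, dt (y s) (y s) = 1 := by
    intro s
    have := (hpos s).ne'
    simp only [y, dt_add_left, dt_add_right, dt_smul_left, dt_smul_right, hx, dt_comm u x, hxu,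
      ← hUd]
    field_simp
    ring
  have hyn : ∀ s, s ≠ 0 → dt n (y s) = c → dt n u = c * s * U := by
    intro s hs h
    have h1 := (hpos s).ne'
    simp only [y, dt_add_right, dt_smul_right, hc] at h
    field_simp at h
    have h2 : s * (dt n u - c * s * U) = 0 := by linarith
    rcases mul_eq_zero.1 h2 with h3 | h3
    · exact absurd h3 hs
    · linarith
  obtain ⟨ε, hε, hball⟩ := Metric.isOpen_iff.1 (hO.preimage hy) 0 (by simpa [hy0] using hxO)
  have m1 : ε / 2 ∈ y ⁻¹' O := hball (by
    rw [Metric.mem_ball, Real.dist_eq, sub_zero, abs_of_pos (by linarith)]; linarith)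
  have m2 : ε / 4 ∈ y ⁻¹' O := hball (by
    rw [Metric.mem_ball, Real.dist_eq, sub_zero, abs_of_pos (by linarith)]; linarith)
  by_cases g1 : dt n (y (ε / 2)) = c
  · by_cases g2 : dt n (y (ε / 4)) = c
    · exfalso
      have e1 := hyn _ (by linarith) g1
      have e2 := hyn _ (by linarith) g2
      have : c * (ε * U) = 0 := by nlinarith
      have hc0 : c = 0 := by
        rcases mul_eq_zero.1 this with h | h
        · exact h
        · exact absurd h (by positivity)
      rcases hu with h | h
      · apply h; rw [e1, hc0]; ring
      · exact h hc0
    · exact ⟨_, m2, hyu _, g2⟩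
  · exact ⟨_, m1, hyu _, g1⟩

/-- the cross product -/
noncomputable def crs (a b : E3) : E3 :=
  !₂[a 1 * b 2 - a 2 * b 1, a 2 * b 0 - a 0 * b 2, a 0 * b 1 - a 1 * b 0]

lemma dt_crs (a b x : E3) : dt (crs a b) x = det3 a b x := by
  simp [dt, crs, det3]; ring

lemma crs_ne {x y z : E3} (hx : dt x x = 1) (hy : dt y y = 1) (hz : dt z z = 1)
    (h1 : y ≠ x) (h2 : z ≠ x) (h3 : z ≠ y) : crs (y - x) (z - x) ≠ 0 := by
  intro h
  have ha : 2 * dt x (y - x) = - dt (y - x) (y - x) := by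
    rw [dt_sub, dt_sub_right, hx, hy, dt_comm y x]; ring
  have hb : 2 * dt x (z - x) = - dt (z - x) (z - x) := by
    rw [dt_sub, dt_sub_right, hx, hz, dt_comm z x]; ring
  have ha0 : y - x ≠ 0 := sub_ne_zero.2 h1
  have hb0 : z - x ≠ 0 := sub_ne_zero.2 h2
  have hab : z - x ≠ y - x := fun h => h3 (sub_left_inj.1 h)
  generalize y - x = a at *
  generalize z - x = b at *
  have c0 := congrFun (congrArg WithLp.ofLp h) 0
  have c1 := congrFun (congrArg WithLp.ofLp h) 1
  have c2 := congrFun (congrArg WithLp.ofLp h) 2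
  simp [crs] at c0 c1 c2
  have hA : 0 < dt a a := lt_of_le_of_ne (dt_nn a) (fun h => ha0 (dt_self_eq_zero h.symm))
  have key : dt a a • b = dt a b • a := by
    ext i
    fin_cases i
    · simp [dt]
      linear_combination (-a 1) * c2 + a 2 * c1
    · simp [dt]
      linear_combination a 0 * c2 - a 2 * c0
    · simp [dt]
      linear_combination (-a 0) * c1 + a 1 * c0
  have k1 : dt a a * dt x b = dt a b * dt x a := by
    rw [← dt_smul_right, key, dt_smul_right]
  have k2 : dt a a * dt b b = dt a b * dt a b := by
    rw [← dt_smul_left, key, dt_smul_left]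
  have k3 : dt b b = dt a b := by
    have : dt a a * (dt b b - dt a b) = 0 := by
      linear_combination (-2) * k1 + dt a a * hb - dt a b * ha
    rcases mul_eq_zero.1 this with h | h
    · exact absurd h hA.ne'
    · linarith
  have k4 : dt a b * (dt a b - dt a a) = 0 := by rw [k3] at k2; linarith
  rcases mul_eq_zero.1 k4 with h | h
  · exact hb0 (dt_self_eq_zero (k3.trans h))
  · rw [sub_eq_zero.1 h] at key
    exact hab (smul_right_injective _ hA.ne' key)

/-- configurations of eight points on the sphere -/
abbrev Cfg := Fin 8 → Metric.sphere (0 : E3) 1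

lemma cfg_unit (P : Cfg) (i : Fin 8) : dt (P i : E3) (P i) = 1 := by
  rw [unit_iff]; simp

lemma upd_avoid {O : Set Cfg} (hO : IsOpen O) {P : Cfg} (hP : P ∈ O) (l : Fin 8) {n : E3}
    (hn : n ≠ 0) (c : ℝ) : ∃ x : Metric.sphere (0 : E3) 1, Function.update P l x ∈ O ∧
      dt n (x : E3) ≠ c := by
  have hc : Continuous fun x : Metric.sphere (0 : E3) 1 => Function.update P l x :=
    continuous_const.update l continuous_id
  obtain ⟨V, hV, hVe⟩ := isOpen_induced_iff.1 (hO.preimage hc)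
  have hmem : (P l : E3) ∈ V := by
    have : P l ∈ Subtype.val ⁻¹' V := by
      rw [hVe]; simpa using hP
    exact this
  obtain ⟨y, hyV, hy1, hyc⟩ := plane_avoid hn c (cfg_unit P l) hV hmem
  refine ⟨⟨y, by simpa using (unit_iff y).1 hy1⟩, ?_, hyc⟩
  have : (⟨y, by simpa using (unit_iff y).1 hy1⟩ : Metric.sphere (0 : E3) 1) ∈
    Subtype.val ⁻¹' V := hyV
  rw [hVe] at this
  exact this

/-- signed volume for configurations -/
def chiF (P : Cfg) (i j k l : Fin 8) : ℝ :=
  det3 ((P j : E3) - P i) ((P k : E3) - P i) ((P l : E3) - P i)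

lemma cont_chiF (i j k l : Fin 8) : Continuous fun P : Cfg => chiF P i j k l := by
  have h : ∀ (i : Fin 8) (m : Fin 3), Continuous fun P : Cfg => ((P i : E3) m) := by
    intro i m
    have h1 : Continuous fun P : Cfg => (P i : E3) := continuous_subtype_val.comp (continuous_apply i)
    fun_prop
  simp only [chiF, det3, PiLp.sub_apply]
  have := h i; have := h j; have := h k; have := h l
  fun_prop

lemma open_ne (i j : Fin 8) : IsOpen {P : Cfg | P i ≠ P j} :=
  isOpen_ne_fun (continuous_apply i) (continuous_apply j)

lemma exists_pne {O : Set Cfg} (hO : IsOpen O) (hne : O.Nonempty) {i j : Fin 8} (hij : i ≠ j) :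
    (O ∩ {P : Cfg | P i ≠ P j}).Nonempty := by
  obtain ⟨P, hP⟩ := hne
  have hn : (P i : E3) ≠ 0 := by
    intro h
    have := cfg_unit P i
    rw [h] at this
    simp [dt] at this
  obtain ⟨x, hx, hxc⟩ := upd_avoid hO hP j hn 1
  refine ⟨_, hx, ?_⟩
  intro h
  rw [Function.update_of_ne hij, Function.update_self] at h
  apply hxc
  rw [← h]
  exact cfg_unit P i

lemma dense_chi {i j k l : Fin 8} (hij : i ≠ j) (hik : i ≠ k) (hil : i ≠ l) (hjk : j ≠ k)
    (hjl : j ≠ l) (hkl : k ≠ l) : Dense {P : Cfg | chiF P i j k l ≠ 0} := by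
  rw [dense_iff_inter_open]
  intro O hO hne
  have n1 := exists_pne hO hne hij
  have o1 := hO.inter (open_ne i j)
  have n2 := exists_pne o1 n1 hik
  have o2 := o1.inter (open_ne i k)
  obtain ⟨P, ⟨⟨hPO, hPij⟩, hPik⟩, hPjk⟩ := exists_pne o2 n2 hjk
  have hv : ∀ {a b : Fin 8}, P a ≠ P b → (P a : E3) ≠ P b := fun h h' => h (Subtype.ext h')
  have hc := crs_ne (cfg_unit P i) (cfg_unit P j) (cfg_unit P k) (hv hPij).symm (hv hPik).symm
    (hv hPjk).symm
  obtain ⟨x, hx, hxc⟩ := upd_avoid hO hPO l hc (dt (crs ((P j : E3) - P i) ((P k : E3) - P i)) (P i))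
  refine ⟨_, hx, ?_⟩
  intro h
  simp only [chiF, Function.update_self, Function.update_of_ne hil, Function.update_of_ne hjl,
    Function.update_of_ne hkl] at h
  rw [← dt_crs, dt_sub_right] at h
  exact hxc (sub_eq_zero.1 h)

/-- generic configurations are dense -/
lemma dense_gen : Dense {P : Cfg | ∀ i j k l : Fin 8, i ≠ j → i ≠ k → i ≠ l → j ≠ k → j ≠ l →
    k ≠ l → chiF P i j k l ≠ 0} := by
  let S := {t : Fin 8 × Fin 8 × Fin 8 × Fin 8 // t.1 ≠ t.2.1 ∧ t.1 ≠ t.2.2.1 ∧ t.1 ≠ t.2.2.2 ∧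
    t.2.1 ≠ t.2.2.1 ∧ t.2.1 ≠ t.2.2.2 ∧ t.2.2.1 ≠ t.2.2.2}
  have h : Dense (⋂ t : S, {P : Cfg | chiF P t.1.1 t.1.2.1 t.1.2.2.1 t.1.2.2.2 ≠ 0}) := by
    apply dense_iInter_of_isOpen
    · intro t
      exact isOpen_ne_fun (cont_chiF _ _ _ _) continuous_const
    · rintro ⟨t, h1, h2, h3, h4, h5, h6⟩
      exact dense_chi h1 h2 h3 h4 h5 h6
  refine h.mono ?_
  intro P hP i j k l h1 h2 h3 h4 h5 h6
  exact Set.mem_iInter.1 hP ⟨(i, j, k, l), h1, h2, h3, h4, h5, h6⟩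

lemma gen_bound {P : Cfg} (hP : ∀ i j k l : Fin 8, i ≠ j → i ≠ k → i ≠ l → j ≠ k → j ≠ l →
    k ≠ l → chiF P i j k l ≠ 0) : volume (convexHull ℝ (Set.range fun i => (P i : E3))) ≤
      ENNReal.ofReal (Real.sqrt ((475 + 29 * Real.sqrt 145) / 250)) := by
  let p : ℕ → E3 := fun i => P (Fin.ofNat 8 i)
  have hinj : ∀ i < 8, ∀ j < 8, i ≠ j → Fin.ofNat 8 i ≠ Fin.ofNat 8 j := by
    intro i hi j hj hij h
    have := congrArg Fin.val h
    simp only [Fin.val_ofNat, Nat.mod_eq_of_lt hi, Nat.mod_eq_of_lt hj] at this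
    exact hij this
  have hg : Gen p := by
    refine ⟨fun i _ => cfg_unit P _, ?_⟩
    intro i hi j hj k hk l hl h1 h2 h3 h4 h5 h6
    exact hP _ _ _ _ (hinj i hi j hj h1) (hinj i hi k hk h2) (hinj i hi l hl h3)
      (hinj j hj k hk h4) (hinj j hj l hl h5) (hinj k hk l hl h6)
  obtain ⟨q, hq, him, hs⟩ := comb_main hg
  have hr : (Set.range fun i => (P i : E3)) = p '' Set.Iio 8 := by
    ext x
    constructor
    · rintro ⟨i, rfl⟩
      exact ⟨i.1, i.2, by simp [p]⟩
    · rintro ⟨i, -, rfl⟩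
      exact ⟨_, rfl⟩
  rw [hr, ← him]
  refine (vol_le hq).trans (ENNReal.ofReal_le_ofReal ?_)
  have := gst_eq
  linarith

lemma homothety_sub {p q : Fin 8 → E3} {c : E3} {r δ : ℝ} (hr : 0 < r)
    (hball : Metric.closedBall c r ⊆ convexHull ℝ (Set.range p)) (hδ : 0 ≤ δ) (hδr : δ ≤ r)
    (hpq : ∀ i, ‖p i - q i‖ ≤ δ) :
    (AffineMap.homothety c (1 - δ / r)) '' convexHull ℝ (Set.range p) ⊆
      convexHull ℝ (Set.range q) := by
  rintro _ ⟨k, hk, rfl⟩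
  by_contra hcon
  obtain ⟨f, u, hfu, hu⟩ := geometric_hahn_banach_closed_point (convex_convexHull ℝ (Set.range q))
    ((Set.finite_range q).isCompact_convexHull (𝕜 := ℝ)).isClosed hcon
  have hp : ∀ x ∈ convexHull ℝ (Set.range p), f x ≤ u + δ * ‖f‖ := by
    intro x hx
    have hsub : convexHull ℝ (Set.range p) ⊆ {x | f x ≤ u + δ * ‖f‖} := by
      apply convexHull_min
      · rintro _ ⟨i, rfl⟩
        have h1 := hfu (q i) (subset_convexHull _ _ ⟨i, rfl⟩)
        have h2 : f (p i - q i) ≤ ‖f‖ * ‖p i - q i‖ :=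
          (le_abs_self _).trans (f.le_opNorm (p i - q i))
        have h3 := mul_le_mul_of_nonneg_left (hpq i) (norm_nonneg f)
        rw [map_sub] at h2
        change f (p i) ≤ u + δ * ‖f‖
        linarith
      · exact convex_halfSpace_le f.toLinearMap.isLinear _
    exact hsub hx
  have hc : f c + r * ‖f‖ ≤ u + δ * ‖f‖ := by
    let v : E3 := (InnerProductSpace.toDual ℝ E3).symm f
    have hv : ∀ x, f x = inner ℝ v x := fun x => by simp [v]
    have hvn : ‖v‖ = ‖f‖ := by simp [v]
    by_cases h0 : v = 0
    · have h1 := hp c (hball (by simp [hr.le]))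
      have h2 : ‖f‖ = 0 := by rw [← hvn, h0, norm_zero]
      rw [h2] at h1 ⊢
      linarith
    · have hv0 : ‖v‖ ≠ 0 := norm_ne_zero_iff.2 h0
      have h1 := hp (c + (r / ‖v‖) • v) (hball (by
        rw [Metric.mem_closedBall, dist_eq_norm, add_sub_cancel_left, norm_smul, norm_div,
          norm_norm, Real.norm_of_nonneg hr.le, div_mul_cancel₀ _ hv0]))
      rw [map_add, map_smul, hv v, real_inner_self_eq_norm_sq, smul_eq_mul] at h1
      have e : r / ‖v‖ * ‖v‖ ^ 2 = r * ‖f‖ := by rw [← hvn]; field_simp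
      rw [e] at h1
      exact h1
  have hk' := hp k hk
  have ht0 : 0 ≤ δ / r := div_nonneg hδ hr.le
  have ht1 : δ / r ≤ 1 := (div_le_one hr).2 hδr
  have e : f (AffineMap.homothety c (1 - δ / r) k) = δ / r * f c + (1 - δ / r) * f k := by
    rw [AffineMap.homothety_apply]
    simp only [vsub_eq_sub, vadd_eq_add, map_add, map_smul, map_sub, smul_eq_mul]
    ring
  rw [e] at hu
  have e2 : δ / r * r = δ := div_mul_cancel₀ _ hr.ne'
  generalize δ / r = t at *
  have a1 := mul_le_mul_of_nonneg_left hc ht0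
  have a2 := mul_le_mul_of_nonneg_left hk' (sub_nonneg.2 ht1)
  have e3 : t * r * ‖f‖ = δ * ‖f‖ := by rw [e2]
  nlinarith

theorem berman_hanes_eight_vertices (p : Fin 8 → EuclideanSpace ℝ (Fin 3)) (hp : ∀ i, ‖p i‖ = 1) :
    (volume (convexHull ℝ (Set.range p))).toReal ≤ Real.sqrt ((475 + 29 * Real.sqrt 145) / 250) := by
  have hcpt : IsCompact (convexHull ℝ (Set.range p)) := (Set.finite_range p).isCompact_convexHull (𝕜 := ℝ)
  have hfin : volume (convexHull ℝ (Set.range p)) ≠ ⊤ := hcpt.measure_lt_top.ne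
  set B := Real.sqrt ((475 + 29 * Real.sqrt 145) / 250) with hB
  have hB0 : 0 ≤ B := Real.sqrt_nonneg _
  by_cases hnei : (interior (convexHull ℝ (Set.range p))).Nonempty
  swap
  · have h0 : volume (convexHull ℝ (Set.range p)) = 0 := by
      rw [Set.not_nonempty_iff_eq_empty] at hnei
      refine measure_mono_null ?_ ((convex_convexHull ℝ (Set.range p)).addHaar_frontier volume)
      rw [frontier, hnei, Set.sdiff_empty]
      exact subset_closure
    rw [h0]; simpa using hB0
  obtain ⟨c, hc⟩ := hnei
  obtain ⟨r, hr, hball⟩ := Metric.nhds_basis_closedBall.mem_iff.1 (mem_interior_iff_mem_nhds.1 hc)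
  let P : Cfg := fun i => ⟨p i, by simpa using hp i⟩
  set V := (volume (convexHull ℝ (Set.range p))).toReal with hV
  have key : ∀ t : ℝ, 0 < t → t ≤ 1 → (1 - t) ^ 3 * V ≤ B := by
    intro t ht ht1
    have hO : IsOpen (Metric.ball P (t * r)) := Metric.isOpen_ball
    obtain ⟨Q, hQ, hQb⟩ := dense_gen.exists_mem_open hO ⟨P, Metric.mem_ball_self (by positivity)⟩
    have hd : ∀ i, ‖p i - (Q i : E3)‖ ≤ t * r := by
      intro i
      have h1 : dist (Q i) (P i) ≤ dist Q P := dist_le_pi_dist Q P i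
      rw [← dist_eq_norm, dist_comm]
      exact h1.trans (Metric.mem_ball.1 hQb).le
    have h1 := homothety_sub (q := fun i => (Q i : E3)) hr hball (by positivity)
      (by nlinarith) hd
    have h2 := (measure_mono h1).trans (gen_bound hQ)
    rw [Measure.addHaar_image_homothety, mul_div_cancel_right₀ _ hr.ne'] at h2
    have h3 := ENNReal.toReal_mono ENNReal.ofReal_ne_top h2
    rw [ENNReal.toReal_mul, ENNReal.toReal_ofReal (abs_nonneg _), ENNReal.toReal_ofReal hB0,
      finrank_euclideanSpace_fin, abs_of_nonneg (pow_nonneg (by linarith) 3)] at h3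
    exact h3
  have hlim : Filter.Tendsto (fun t : ℝ => (1 - t) ^ 3 * V) (nhdsWithin 0 (Set.Ioi 0)) (nhds V) := by
    have : Filter.Tendsto (fun t : ℝ => (1 - t) ^ 3 * V) (nhds 0) (nhds ((1 - 0) ^ 3 * V)) :=
      Continuous.tendsto (by fun_prop) 0
    simp only [sub_zero, one_pow, one_mul] at this
    exact this.mono_left nhdsWithin_le_nhds
  refine le_of_tendsto hlim ?_
  filter_upwards [Ioc_mem_nhdsGT (zero_lt_one' ℝ)] with t ht
  exact key t ht.1 ht.2
end

section
/- Let d ≥ 2 and let p₁,…,p_{d+1} be d+1 points in EuclideanSpace ℝ (Fin d), each of norm 1. Then vol(convexHull ℝ {p₁,…,p_{d+1}}) ≤ (d+1)^{(d+1)/2} / (d! · d^{d/2}), and equality holds if and only if the points form a regular simplex inscribed in the unit sphere, i.e., all pairwise distances dist(pᵢ,pⱼ) (i ≠ j) are equal to √(2(d+1)/d). -/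
open MeasureTheory Real

/-- Volume of the corner simplex of size `t`. -/
lemma volume_corner (n : ℕ) : ∀ t : ℝ, 0 ≤ t →
    volume {x : Fin n → ℝ | (∀ i, 0 ≤ x i) ∧ ∑ i, x i ≤ t} =
      ENNReal.ofReal (t ^ n / (n.factorial : ℝ)) := by
  induction n with
  | zero =>
    intro t ht
    have : {x : Fin 0 → ℝ | (∀ i, 0 ≤ x i) ∧ ∑ i, x i ≤ t} = Set.univ := by
      ext x; simp [ht]
    rw [this, volume_pi, Measure.pi_univ]
    simp
  | succ n ih =>
    intro t ht
    have hmeas : ∀ (m : ℕ) (s : ℝ),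
        MeasurableSet {x : Fin m → ℝ | (∀ i, 0 ≤ x i) ∧ ∑ i, x i ≤ s} := by
      intro m s
      refine IsClosed.measurableSet ?_
      have : {x : Fin m → ℝ | (∀ i, 0 ≤ x i) ∧ ∑ i, x i ≤ s} =
          (⋂ i, {x : Fin m → ℝ | 0 ≤ x i}) ∩ {x | ∑ i, x i ≤ s} := by
        ext x; simp
      rw [this]
      refine IsClosed.inter (isClosed_iInter fun i => ?_) ?_
      · exact isClosed_le continuous_const (continuous_apply i)
      · exact isClosed_le (by fun_prop) continuous_const
    have hmp := (volume_preserving_piFinSuccAbove (fun _ : Fin (n + 1) => ℝ) 0).symm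
    rw [← hmp.measure_preimage (hmeas (n+1) t).nullMeasurableSet]
    rw [Measure.volume_eq_prod, Measure.prod_apply (hmp.measurable (hmeas (n+1) t))]
    have hslice : ∀ a : ℝ, volume (Prod.mk a ⁻¹'
        ((MeasurableEquiv.piFinSuccAbove (fun _ : Fin (n + 1) => ℝ) 0).symm ⁻¹'
          {x : Fin (n+1) → ℝ | (∀ i, 0 ≤ x i) ∧ ∑ i, x i ≤ t})) =
        (Set.Icc 0 t).indicator (fun a => ENNReal.ofReal ((t - a) ^ n / (n.factorial : ℝ))) a := by
      intro a
      have : (Prod.mk a ⁻¹'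
        ((MeasurableEquiv.piFinSuccAbove (fun _ : Fin (n + 1) => ℝ) 0).symm ⁻¹'
          {x : Fin (n+1) → ℝ | (∀ i, 0 ≤ x i) ∧ ∑ i, x i ≤ t})) =
          {y : Fin n → ℝ | 0 ≤ a ∧ (∀ i, 0 ≤ y i) ∧ ∑ i, y i ≤ t - a} := by
        ext y
        simp [Fin.forall_fin_succ, Fin.sum_univ_succ, MeasurableEquiv.piFinSuccAbove,
          Fin.insertNthEquiv, and_assoc, le_sub_iff_add_le']
      rw [this]
      by_cases h : a ∈ Set.Icc 0 t
      · rw [Set.indicator_of_mem h, ← ih (t - a) (by linarith [h.2])]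
        simp [h.1]
      · rw [Set.indicator_of_notMem h]
        convert measure_empty (μ := (volume : Measure (Fin n → ℝ)))
        ext y
        simp only [Set.mem_ofPred_eq, Set.mem_empty_iff_false, iff_false]
        rintro ⟨h0, h1, h2⟩
        exact h ⟨h0, by linarith [Finset.sum_nonneg (fun i (_ : i ∈ Finset.univ) => h1 i)]⟩
    simp_rw [hslice]
    rw [lintegral_indicator measurableSet_Icc, ← ofReal_integral_eq_lintegral_ofReal]
    · congr 1
      rw [integral_Icc_eq_integral_Ioc, ← intervalIntegral.integral_of_le ht,
        intervalIntegral.integral_div,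
        intervalIntegral.integral_comp_sub_left (fun x => x ^ n) t]
      simp [Nat.factorial_succ]
      field_simp
    · exact (Continuous.integrableOn_Icc (by fun_prop))
    · refine (ae_restrict_iff' measurableSet_Icc).2 (ae_of_all _ fun a h => ?_)
      have : 0 ≤ t - a := by linarith [h.2]
      positivity

lemma volume_hull {d : ℕ} (q : Fin (d + 1) → Fin d → ℝ) :
    volume (convexHull ℝ (Set.range q)) =
      ENNReal.ofReal (|(Matrix.of fun i j : Fin d => q i.succ j - q 0 j).det| / (d.factorial : ℝ)) := by
  set M : Matrix (Fin d) (Fin d) ℝ := Matrix.of fun i j : Fin d => q i.succ j - q 0 j with hM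
  have h : convexHull ℝ (Set.range q) = (fun x => q 0 + x) ''
      ((Matrix.toLin' M.transpose) '' {x : Fin d → ℝ | (∀ i, 0 ≤ x i) ∧ ∑ i, x i ≤ 1}) := by
    have h1 : Set.range q = (Fintype.linearCombination ℝ q) ''
        (Set.range fun i : Fin (d+1) => (Pi.single i 1 : Fin (d+1) → ℝ)) := by
      rw [← Set.range_comp]
      congr 1
      ext i : 1
      simp [Fintype.linearCombination_apply_single]
    rw [h1, ← LinearMap.image_convexHull, convexHull_rangle_single_eq_stdSimplex]
    have key : ∀ (a : ℝ) (y : Fin d → ℝ), a + ∑ i, y i = 1 →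
        a • q 0 + ∑ i, y i • q i.succ = q 0 + Matrix.toLin' M.transpose y := by
      intro a y hy
      have : a = 1 - ∑ i, y i := by linarith
      ext j
      simp only [this, hM, Matrix.toLin'_apply, Matrix.mulVec, dotProduct, Pi.add_apply,
        Pi.smul_apply, Finset.sum_apply, smul_eq_mul, Matrix.transpose_apply, Matrix.of_apply]
      simp only [sub_mul, one_mul, Finset.sum_mul, Finset.sum_sub_distrib, mul_comm]
      simp only [mul_sub, Finset.sum_sub_distrib]
      ring
    ext z
    constructor
    · rintro ⟨w, ⟨hw0, hw1⟩, rfl⟩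
      rw [Fin.sum_univ_succ] at hw1
      refine ⟨_, ⟨fun i => w i.succ, ⟨fun i => hw0 _, by linarith [hw0 0]⟩, rfl⟩, ?_⟩
      simp only [Fintype.linearCombination_apply, Fin.sum_univ_succ]
      exact (key _ _ hw1).symm
    · rintro ⟨_, ⟨y, ⟨hy0, hy1⟩, rfl⟩, rfl⟩
      refine ⟨Fin.cons (1 - ∑ i, y i) y, ⟨?_, ?_⟩, ?_⟩
      · intro i
        refine Fin.cases ?_ ?_ i
        · simpa using hy1
        · simpa using hy0
      · simp [Fin.sum_univ_succ]
      · simp only [Fintype.linearCombination_apply, Fin.sum_univ_succ, Fin.cons_zero, Fin.cons_succ]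
        exact key _ _ (by ring)
  rw [h, Set.image_add_left, measure_preimage_add, Measure.addHaar_image_linearMap,
    volume_corner d 1 zero_le_one, LinearMap.det_toLin', Matrix.det_transpose,
    ← ENNReal.ofReal_mul (abs_nonneg _)]
  congr 1
  simp [div_eq_mul_inv]

lemma volume_hull' {d : ℕ} (p : Fin (d + 1) → EuclideanSpace ℝ (Fin d)) :
    (volume (convexHull ℝ (Set.range p))).toReal =
      |(Matrix.of fun i j : Fin d => p i.succ j - p 0 j).det| / (d.factorial : ℝ) := by
  have hmp := EuclideanSpace.volume_preserving_symm_measurableEquiv_toLp (Fin d)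
  have h1 : convexHull ℝ (Set.range p) = (MeasurableEquiv.toLp 2 (Fin d → ℝ)).symm ⁻¹'
      (convexHull ℝ (Set.range fun i => (p i).ofLp)) := by
    have : (Set.range fun i => (p i).ofLp) =
        (WithLp.linearEquiv 2 ℝ (Fin d → ℝ)).toLinearMap '' (Set.range p) := by
      rw [← Set.range_comp]; rfl
    rw [this, ← LinearMap.image_convexHull]
    exact (Set.preimage_image_eq _ (WithLp.linearEquiv 2 ℝ (Fin d → ℝ)).injective).symm
  rw [h1, hmp.measure_preimage_equiv, volume_hull, ENNReal.toReal_ofReal (by positivity)]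

lemma det_aug {d : ℕ} (c : ℝ) (q : Fin (d + 1) → Fin d → ℝ) :
    (Matrix.of fun i => (Fin.cons c (q i) : Fin (d+1) → ℝ)).det =
      c * (Matrix.of fun i j : Fin d => q i.succ j - q 0 j).det := by
  have h := Matrix.det_eq_of_forall_row_eq_smul_add_const
    (A := Matrix.of fun i => (Fin.cons c (q i) : Fin (d+1) → ℝ))
    (B := Matrix.of fun i => (Fin.cons (if i = 0 then c else 0)
      (fun j => if i = 0 then q 0 j else q i j - q 0 j) : Fin (d+1) → ℝ))
    (fun i => if i = 0 then 0 else 1) 0 (by simp) (by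
      intro i j
      by_cases hi : i = 0
      · subst hi; refine Fin.cases ?_ ?_ j <;> simp
      · refine Fin.cases ?_ ?_ j <;> simp [hi])
  rw [h, Matrix.det_succ_column_zero, Fin.sum_univ_succ]
  simp [Matrix.submatrix, Fin.succ_ne_zero]

lemma det_le_one {n : ℕ} (N : Matrix (Fin n) (Fin n) ℝ) (hN : N.PosSemidef)
    (htr : ∀ i, N i i = 1) : N.det ≤ 1 ∧ (N.det = 1 ↔ N = 1) := by
  have hdet := hN.1.det_eq_prod_eigenvalues
  have hsum := hN.1.trace_eq_sum_eigenvalues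
  simp only [Matrix.trace, Matrix.diag, htr, RCLike.ofReal_real_eq_id, id] at hdet hsum
  have hexp : ∏ i, Real.exp (hN.1.eigenvalues i - 1) = 1 := by
    rw [← Real.exp_sum, Finset.sum_sub_distrib, ← hsum]; simp
  have hle : ∀ i, hN.1.eigenvalues i ≤ Real.exp (hN.1.eigenvalues i - 1) := fun i => by
    linarith [Real.add_one_le_exp (hN.1.eigenvalues i - 1)]
  refine ⟨?_, ?_, ?_⟩
  · rw [hdet, ← hexp]
    exact Finset.prod_le_prod (fun i _ => hN.eigenvalues_nonneg i) (fun i _ => hle i)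
  · intro h1
    have hpos : ∀ i, 0 < hN.1.eigenvalues i := by
      intro i
      refine lt_of_le_of_ne (hN.eigenvalues_nonneg i) fun h0 => ?_
      rw [hdet, Finset.prod_eq_zero (Finset.mem_univ i) h0.symm] at h1
      exact zero_ne_one h1
    have hall : ∀ i, hN.1.eigenvalues i = 1 := by
      intro i
      by_contra hne
      have : ∏ i, hN.1.eigenvalues i < ∏ i, Real.exp (hN.1.eigenvalues i - 1) := by
        refine Finset.prod_lt_prod (fun i _ => hpos i) (fun i _ => hle i)
          ⟨i, Finset.mem_univ i, ?_⟩
        linarith [Real.add_one_lt_exp (sub_ne_zero.2 hne)]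
      rw [← hdet, hexp, h1] at this
      exact lt_irrefl _ this
    have hs := hN.1.spectral_theorem
    have : (RCLike.ofReal ∘ hN.1.eigenvalues : Fin n → ℝ) = fun _ => 1 := by
      ext i; simp [hall i]
    rw [this] at hs
    rw [hs]
    simp
  · rintro rfl; simp

/-- The maximal volume of a simplex with `d+1` vertices inscribed in the unit sphere of
Euclidean `d`-space is `(d+1)^((d+1)/2) / (d! · d^(d/2))`, attained exactly by the regular
simplex (all pairwise vertex distances equal to `√(2(d+1)/d)`). -/
theorem max_volume_inscribed_simplex (d : ℕ) (hd : 2 ≤ d)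
    (p : Fin (d + 1) → EuclideanSpace ℝ (Fin d)) (hp : ∀ i, ‖p i‖ = 1) :
    (volume (convexHull ℝ (Set.range p))).toReal ≤
      ((d : ℝ) + 1) ^ (((d : ℝ) + 1) / 2) / ((d.factorial : ℝ) * (d : ℝ) ^ ((d : ℝ) / 2)) ∧
    ((volume (convexHull ℝ (Set.range p))).toReal =
        ((d : ℝ) + 1) ^ (((d : ℝ) + 1) / 2) / ((d.factorial : ℝ) * (d : ℝ) ^ ((d : ℝ) / 2)) ↔
      ∀ i j, i ≠ j → dist (p i) (p j) = Real.sqrt (2 * ((d : ℝ) + 1) / (d : ℝ))) := by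
  have hd0 : (0 : ℝ) < d := by exact_mod_cast (by omega : 0 < d)
  rw [volume_hull']
  set D := (Matrix.of fun i j : Fin d => p i.succ j - p 0 j).det with hD
  set c : ℝ := 1 / √(d : ℝ) with hc
  have hc2 : c * c = 1 / d := by
    rw [hc, div_mul_div_comm, Real.mul_self_sqrt hd0.le, one_mul]
  set A : Matrix (Fin (d+1)) (Fin (d+1)) ℝ :=
    Matrix.of fun i => (Fin.cons c (p i) : Fin (d+1) → ℝ) with hA
  have hdetA : A.det = c * D := det_aug c fun i => (p i).ofLp
  set s : ℝ := d / (d + 1) with hs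
  have hs0 : 0 < s := by positivity
  set N : Matrix (Fin (d+1)) (Fin (d+1)) ℝ := s • (A * A.transpose) with hN
  have hNpsd : N.PosSemidef := by
    have := (Matrix.posSemidef_self_mul_conjTranspose A).smul hs0.le
    simpa [hN, Matrix.conjTranspose_eq_transpose_of_trivial] using this
  have hNij : ∀ i j, N i j = s * (1 / d + inner ℝ (p i) (p j)) := by
    intro i j
    simp [hN, hA, Matrix.mul_apply, Fin.sum_univ_succ, hc2, PiLp.inner_apply, mul_comm]
  have hNii : ∀ i, N i i = 1 := by
    intro i
    rw [hNij, real_inner_self_eq_norm_sq, hp, hs]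
    field_simp
    ring
  obtain ⟨hle, heq⟩ := det_le_one N hNpsd hNii
  have hNdet : N.det = s ^ (d + 1) * (1 / d * D ^ 2) := by
    rw [hN, Matrix.det_smul, Matrix.det_mul, Matrix.det_transpose, hdetA, Fintype.card_fin, ← hc2]
    ring
  set K : ℝ := ((d : ℝ) + 1) ^ (((d : ℝ) + 1) / 2) / (d : ℝ) ^ ((d : ℝ) / 2) with hK
  have hK0 : 0 < K := by positivity
  have hK2 : K ^ 2 = ((d : ℝ) + 1) ^ (d + 1) / (d : ℝ) ^ d := by
    rw [hK, div_pow, ← Real.rpow_mul_natCast (by positivity), ← Real.rpow_mul_natCast hd0.le]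
    congr 1
    · rw [← Real.rpow_natCast]; congr 1; push_cast; ring
    · rw [← Real.rpow_natCast]; congr 1; push_cast; ring
  have hDK : D ^ 2 = K ^ 2 * N.det := by
    rw [hNdet, hK2, hs, div_pow]
    field_simp
    ring
  have hRHS : ((d : ℝ) + 1) ^ (((d : ℝ) + 1) / 2) / ((d.factorial : ℝ) * (d : ℝ) ^ ((d : ℝ) / 2))
      = K / (d.factorial : ℝ) := by
    rw [hK, div_div, mul_comm]
  have hf : (0 : ℝ) < d.factorial := by exact_mod_cast d.factorial_pos
  rw [hRHS, div_le_div_iff_of_pos_right hf, div_left_inj' hf.ne']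
  constructor
  · refine abs_le_of_sq_le_sq ?_ hK0.le
    rw [hDK]
    nlinarith [sq_nonneg K]
  · have e1 : |D| = K ↔ N.det = 1 := by
      rw [← sq_eq_sq₀ (abs_nonneg D) hK0.le, sq_abs, hDK]
      constructor
      · intro h
        exact mul_left_cancel₀ (pow_ne_zero 2 hK0.ne') (by rw [h, mul_one])
      · intro h; rw [h, mul_one]
    have e2 : ∀ i j, dist (p i) (p j) = √(2 * ((d : ℝ) + 1) / d) ↔
        1 / d + inner ℝ (p i) (p j) = 0 := by
      intro i j
      have h3 : dist (p i) (p j) ^ 2 = 2 - 2 * inner ℝ (p i) (p j) := by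
        rw [dist_eq_norm, norm_sub_sq_real, hp, hp]; ring
      have h4 : 2 * ((d : ℝ) + 1) / d = 2 + 2 * (1 / d) := by field_simp
      rw [← sq_eq_sq₀ dist_nonneg (Real.sqrt_nonneg _), Real.sq_sqrt (by positivity), h3, h4]
      constructor <;> intro h <;> linarith
    rw [e1, heq]
    constructor
    · intro h i j hij
      rw [e2]
      have := hNij i j
      rw [h, Matrix.one_apply_ne hij] at this
      exact (mul_eq_zero.1 this.symm).resolve_left hs0.ne'
    · intro h
      ext i j
      by_cases hij : i = j
      · subst hij; rw [hNii, Matrix.one_apply_eq]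
      · rw [Matrix.one_apply_ne hij, hNij, (e2 i j).1 (h i j hij), mul_zero]
end
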